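/- arXiv:2209.10757 — 4 statements merged into one kernel-verified Lean document; each statement's English description precedes it below -/
import Mathlib

section
/- Let (A_r)_{r∈ℚ} be a graded extension of V in K[ℚ,σ] and let r ∈ ℚ with r > 0. If H_r is of Type (a) (respectively Type (b), Type (c), Type (d), Type (f), Type (g)), then for every positive integer n, H_{nr} is of Type (a) (respectively of the same type). -/
open scoped Pointwise

variable {K : Type*} [DivisionRing K]

/-- `V` is a total valuation ring of the division ring `K`. -/
def IsTVR (V : Subring K) : Prop := ∀ k : K, k ≠ 0 → k ∈ V ∨ k⁻¹ ∈ V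

/-- The additive group generated by the elementwise products of two subsets, as a set. -/
def aprod (S T : Set K) : Set K := (AddSubgroup.closure (S * T) : Set K)

/-- `O_l(S) = {a ∈ K : aS ⊆ S}`. -/
def Ol (S : Set K) : Set K := {a : K | ∀ x ∈ S, a * x ∈ S}

/-- `O_r(S) = {a ∈ K : Sa ⊆ S}`. -/
def Orr (S : Set K) : Set K := {a : K | ∀ x ∈ S, x * a ∈ S}

/-- `(J : I)_r = {a ∈ K : Ia ⊆ J}`. -/
def residR (J I : Set K) : Set K := {a : K | ∀ x ∈ I, x * a ∈ J}

/-- The Jacobson radical of a total valuation ring `W`, as a set: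
`{x ∈ W : x = 0 ∨ x⁻¹ ∉ W}`. -/
def jacS (W : Set K) : Set K := {x : K | x ∈ W ∧ (x = 0 ∨ x⁻¹ ∉ W)}

/-- `S⁻ = {c⁻¹ : 0 ≠ c ∈ S}`. -/
def invS (S : Set K) : Set K := {x : K | ∃ c ∈ S, c ≠ 0 ∧ x = c⁻¹}

/-- `S` is an additive subgroup of `K`. -/
def IsAddSubgrp (S : Set K) : Prop := (0 : K) ∈ S ∧ ∀ x ∈ S, ∀ y ∈ S, x - y ∈ S

/-- `*I = ⋂ {Wc : c ∈ K, I ⊆ Wc}` where `W = O_l(I)`. -/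
def lstar (I : Set K) : Set K := ⋂ c ∈ {c : K | I ⊆ Ol I * {c}}, Ol I * {c}

/-- A family `(A_r)` of additive subgroups of `K` is a graded extension of `V0`
with support the additive subgroup `H ⊆ ℚ`. -/
def IsGradedExtOn (H : Set ℚ) (V0 : Set K) (σ : ℚ → (K ≃+* K)) (A : ℚ → Set K) : Prop :=
  (∀ r ∈ H, IsAddSubgrp (A r)) ∧ A 0 = V0 ∧
  (∀ r ∈ H, A r ∪ (σ r '' invS (A (-r))) = Set.univ) ∧
  (∀ r ∈ H, ∀ s ∈ H, aprod (A r) (σ r '' A s) ⊆ A (r + s))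

/-- `ℤr = {ir : i ∈ ℤ}` as a subset of `ℚ`. -/
def zmulSet (r : ℚ) : Set ℚ := {s : ℚ | ∃ i : ℤ, s = (i : ℚ) * r}

/-- Graded extension of `V0` in `K[ℚ,σ]`. -/
def IsGradedExtQ (V0 : Set K) (σ : ℚ → (K ≃+* K)) (A : ℚ → Set K) : Prop :=
  IsGradedExtOn Set.univ V0 σ A

/-- `H_r` is a graded extension of `V0` in `K[X^r, X^{-r}; σ(r)]`. -/
def IsGradedExtHr (V0 : Set K) (σ : ℚ → (K ≃+* K)) (A : ℚ → Set K) (r : ℚ) : Prop :=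
  IsGradedExtOn (zmulSet r) V0 σ A

/-- `H_r` is of Type (I). -/
def HrTypeI (σ : ℚ → (K ≃+* K)) (A : ℚ → Set K) (r : ℚ) : Prop :=
  ∀ i j : ℤ, 0 < i → 0 < j →
    aprod (A ((i : ℚ) * r)) (σ ((i : ℚ) * r) '' A ((j : ℚ) * r)) = A (((i + j : ℤ) : ℚ) * r) ∧
    aprod (A (-((i : ℚ) * r))) (σ (-((i : ℚ) * r)) '' A (-((j : ℚ) * r)))
      = A (-(((i + j : ℤ) : ℚ) * r))

/-- The whole family `(A_r)_{r ∈ ℚ}` is of Type (I). -/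
def FamTypeI (σ : ℚ → (K ≃+* K)) (A : ℚ → Set K) : Prop :=
  ∀ g h : ℚ, 0 < g → 0 < h →
    aprod (A g) (σ g '' A h) = A (g + h) ∧
    aprod (A (-g)) (σ (-g) '' A (-h)) = A (-g - h)

/-- `M_0 = V`, `M_{ir} = A_r A_r^{σ(r)} ⋯ A_r^{σ((i-1)r)}`. -/
def Mir (V0 : Set K) (σ : ℚ → (K ≃+* K)) (A : ℚ → Set K) (r : ℚ) : ℕ → Set K
  | 0 => V0
  | 1 => A r
  | n + 2 => aprod (Mir V0 σ A r (n + 1)) (σ (((n + 1 : ℕ) : ℚ) * r) '' A r)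

/-- `H_r` is of Type (a). -/
def HrTypeA (V0 : Set K) (σ : ℚ → (K ≃+* K)) (A : ℚ → Set K) (r : ℚ) : Prop :=
  ∃ a : K, A r = V0 * {a} ∧ A r = {a} * (σ r '' V0) ∧ A (-r) = V0 * {σ (-r) a⁻¹}

/-- `H_r` is of Type (b). -/
def HrTypeB (σ : ℚ → (K ≃+* K)) (A : ℚ → Set K) (r : ℚ) : Prop :=
  ∃ a : K, A r = Ol (A r) * {a} ∧ {a} * (σ r '' Ol (A r)) ⊂ A r

/-- `H_r` is of Type (c). -/
def HrTypeC (σ : ℚ → (K ≃+* K)) (A : ℚ → Set K) (r : ℚ) : Prop :=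
  ∃ a : K, A r = Ol (A r) * {a} ∧ A r ⊂ {a} * (σ r '' Ol (A r))

/-- `H_r` is of Type (d). -/
def HrTypeD (σ : ℚ → (K ≃+* K)) (A : ℚ → Set K) (r : ℚ) : Prop :=
  ∃ a : K, A r = Ol (A r) * {a} ∧ A r = {a} * (σ r '' Ol (A r)) ∧
    A (-r) = jacS (Ol (A r)) * {σ (-r) a⁻¹} ∧
    aprod (jacS (Ol (A r))) (jacS (Ol (A r))) = jacS (Ol (A r))

/-- `H_r` is of Type (e). -/
def HrTypeE (σ : ℚ → (K ≃+* K)) (A : ℚ → Set K) (r : ℚ) : Prop :=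
  ∃ a b : K, A r = Ol (A r) * {a} ∧ A r = {a} * (σ r '' Ol (A r)) ∧
    A (-r) = jacS (Ol (A r)) * {σ (-r) a⁻¹} ∧
    jacS (Ol (A r)) = Ol (A r) * {b⁻¹}

/-- `H_r` is of Type (f). -/
def HrTypeF (A : ℚ → Set K) (r : ℚ) : Prop := A r ⊂ lstar (A r)

/-- `H_r` is of Type (g). -/
def HrTypeG (V0 : Set K) (σ : ℚ → (K ≃+* K)) (A : ℚ → Set K) (r : ℚ) : Prop :=
  lstar (A r) = A r ∧
    ∀ i : ℕ, 0 < i → ¬ ∃ c : K, lstar (Mir V0 σ A r i) = Ol (A r) * {c}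

/-- `H_r` is of Type (h). -/
def HrTypeH (V0 : Set K) (σ : ℚ → (K ≃+* K)) (A : ℚ → Set K) (r : ℚ) : Prop :=
  lstar (A r) = A r ∧
    ∃ i : ℕ, 0 < i ∧ ∃ c : K, lstar (Mir V0 σ A r i) = Ol (A r) * {c}

/-- A graded map `f : ℚ → ℤ`. -/
def IsGradedMap (f : ℚ → ℤ) : Prop :=
  f 0 = 0 ∧ (∀ s t : ℚ, f s + f t ≤ f (s + t)) ∧ (∀ s : ℚ, -1 ≤ f s + f (-s))

section Core

variable {G : Type*} [Group G]

/-- left order -/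
def gOL (S : Set G) : Set G := {g | ∀ x ∈ S, g * x ∈ S}
/-- right order -/
def gOR (S : Set G) : Set G := {g | ∀ x ∈ S, x * g ∈ S}
/-- radical -/
def gJ (W : Set G) : Set G := {g | g ∈ W ∧ g⁻¹ ∉ W}
/-- star -/
def gLST (d : G → ℤ) (i : ℤ) (S : Set G) : Set G :=
  {y | d y = i ∧ ∀ c, (∀ s ∈ S, s * c⁻¹ ∈ gOL S) → y * c⁻¹ ∈ gOL S}
/-- homogeneous part -/
def gP (d : G → ℤ) (P : Set G) (i : ℤ) : Set G := {x | x ∈ P ∧ d x = i}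

/-- homogeneous elements of a graded extension -/
structure GE (d : G → ℤ) (P : Set G) : Prop where
  dm : ∀ x y, d (x * y) = d x + d y
  mul : ∀ x y, x ∈ P → y ∈ P → x * y ∈ P
  tot : ∀ x, x ∉ P → x⁻¹ ∈ P

variable {d : G → ℤ} {P : Set G}

lemma GE.d1 (h : GE d P) : d 1 = 0 := by
  have := h.dm 1 1
  rw [mul_one] at this; omega

lemma GE.di (h : GE d P) (x : G) : d x⁻¹ = - d x := by
  have := h.dm x x⁻¹
  rw [mul_inv_cancel, h.d1] at this; omega

lemma GE.dp (h : GE d P) (x : G) (n : ℕ) : d (x ^ n) = n * d x := by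
  induction n with
  | zero => simp [h.d1]
  | succ n ih => rw [pow_succ, h.dm, ih]; push_cast; ring

lemma GE.one (h : GE d P) : (1 : G) ∈ P := by
  by_contra h1
  have := h.tot 1 h1
  rw [inv_one] at this; exact h1 this

lemma GE.pw (h : GE d P) {x : G} (hx : x ∈ P) (n : ℕ) : x ^ n ∈ P := by
  induction n with
  | zero => simpa using h.one
  | succ n ih => rw [pow_succ]; exact h.mul _ _ ih hx

lemma gOL_one (S : Set G) : (1 : G) ∈ gOL S := fun x hx => by simpa using hx
lemma gOL_mul {S : Set G} {a b : G} (ha : a ∈ gOL S) (hb : b ∈ gOL S) : a * b ∈ gOL S :=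
  fun x hx => by rw [mul_assoc]; exact ha _ (hb _ hx)
lemma gOR_mul {S : Set G} {a b : G} (ha : a ∈ gOR S) (hb : b ∈ gOR S) : a * b ∈ gOR S :=
  fun x hx => by rw [← mul_assoc]; exact hb _ (ha _ hx)

lemma gOL_P (h : GE d P) {i : ℤ} {g : G} (hg : g ∈ P) (h0 : d g = 0) : g ∈ gOL (gP d P i) :=
  fun x hx => ⟨h.mul _ _ hg hx.1, by rw [h.dm, h0, hx.2, zero_add]⟩
lemma gOR_P (h : GE d P) {i : ℤ} {g : G} (hg : g ∈ P) (h0 : d g = 0) : g ∈ gOR (gP d P i) :=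
  fun x hx => ⟨h.mul _ _ hx.1 hg, by rw [h.dm, h0, hx.2, add_zero]⟩

lemma gOL_deg (h : GE d P) {i : ℤ} {S : Set G} (hS : S.Nonempty) (hd : ∀ s ∈ S, d s = i) {g : G}
    (hg : g ∈ gOL S) : d g = 0 := by
  obtain ⟨s, hs⟩ := hS
  have h1 := hd _ (hg s hs)
  rw [h.dm, hd s hs] at h1; omega
lemma gOR_deg (h : GE d P) {i : ℤ} {S : Set G} (hS : S.Nonempty) (hd : ∀ s ∈ S, d s = i) {g : G}
    (hg : g ∈ gOR S) : d g = 0 := by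
  obtain ⟨s, hs⟩ := hS
  have h1 := hd _ (hg s hs)
  rw [h.dm, hd s hs] at h1; omega

lemma gOL_eq {S W : Set G} {x : G} (h1 : (1 : G) ∈ W) (hm : ∀ a ∈ W, ∀ b ∈ W, a * b ∈ W)
    (hS : ∀ y, y ∈ S ↔ y * x⁻¹ ∈ W) : gOL S = W := by
  ext g
  constructor
  · intro hg
    have := (hS _).1 (hg x ((hS x).2 (by simpa using h1)))
    simpa using this
  · intro hg s hs
    rw [hS] at hs ⊢
    rw [mul_assoc]; exact hm _ hg _ hs

/-- conjugation closure iterates -/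
lemma conj_iter {W : Set G} {x : G} (h : ∀ w ∈ W, x * w * x⁻¹ ∈ W) (n : ℕ) :
    ∀ w ∈ W, x ^ n * w * (x ^ n)⁻¹ ∈ W := by
  induction n with
  | zero => intro w hw; simpa using hw
  | succ n ih =>
    intro w hw
    have := h _ (ih w hw)
    convert this using 1
    rw [pow_succ']; group

lemma conj_iter' {W : Set G} {x : G} (h : ∀ w ∈ W, x⁻¹ * w * x ∈ W) (n : ℕ) :
    ∀ w ∈ W, (x ^ n)⁻¹ * w * x ^ n ∈ W := by
  have := conj_iter (W := W) (x := x⁻¹) (by simpa using h) n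
  simpa using this

theorem coreB (h : GE d P) {W : Set G} (hW : W = gOL (gP d P 1)) {x : G}
    (hx : ∀ y, y ∈ gP d P 1 ↔ y * x⁻¹ ∈ W) (hc : ∀ w ∈ W, x * w * x⁻¹ ∈ W)
    (hs : ∃ w ∈ W, x⁻¹ * w * x ∉ W) (n : ℕ) :
    (∀ y, y ∈ gP d P (n + 1 : ℕ) ↔ y * (x ^ (n + 1))⁻¹ ∈ W) ∧ gOL (gP d P (n + 1 : ℕ)) = W ∧
    (∃ w ∈ W, (x ^ (n + 1))⁻¹ * w * x ^ (n + 1) ∉ W) := by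
  have h1 : (1 : G) ∈ W := hW ▸ gOL_one _
  have hm : ∀ a ∈ W, ∀ b ∈ W, a * b ∈ W := fun a ha b hb => by
    rw [hW] at *; exact gOL_mul ha hb
  have hxP : x ∈ gP d P 1 := (hx x).2 (by simpa using h1)
  have hd0 : ∀ w ∈ W, d w = 0 := fun w hw => by
    rw [hW] at hw; exact gOL_deg h ⟨x, hxP⟩ (fun s hs => hs.2) hw
  have hz : ∀ z, d z = 0 → z ∉ W → x⁻¹ * z⁻¹ ∈ P := by
    intro z hz0 hz
    by_contra hc
    have := h.tot _ hc
    apply hz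
    have h2 : z * x ∈ gP d P 1 := ⟨by simpa using this, by rw [h.dm, hz0, hxP.2, zero_add]⟩
    simpa using (hx _).1 h2
  have key : ∀ y, y ∈ gP d P (n + 1 : ℕ) ↔ y * (x ^ (n + 1))⁻¹ ∈ W := by
    induction n with
    | zero => intro y; simpa using hx y
    | succ n ih =>
      intro y
      constructor
      · intro hy
        by_contra hu
        obtain ⟨w, hw, hw'⟩ := hs
        apply hw'
        set u := y * (x ^ (n + 1 + 1))⁻¹ with hudef
        have hyu : y = u * x ^ (n + 1 + 1) := by rw [hudef]; group
        have hdu : d u = 0 := by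
          rw [hudef, h.dm, h.di, h.dp, hxP.2, hy.2]; ring
        have h3 : u * w⁻¹ ∉ W := fun h4 => hu (by simpa using hm _ h4 _ hw)
        have h5 := hz _ (by rw [h.dm, h.di, hdu, hd0 w hw]; rfl) h3
        have h6 : x⁻¹ * (u * w⁻¹)⁻¹ * y ∈ gP d P (n + 1 : ℕ) := by
          refine ⟨h.mul _ _ h5 hy.1, ?_⟩
          rw [h.dm, h.dm, h.di, h.di, h.dm, h.di, hdu, hd0 w hw, hxP.2, hy.2]; push_cast; ring
        have h7 := (ih _).1 h6
        convert h7 using 1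
        rw [hyu, pow_succ' x (n+1)]; group
      · intro hy
        have h3 : y * (x ^ (n + 1 + 1))⁻¹ * x ∈ gP d P 1 := (hx _).2 (by simpa using hy)
        have h4 := h.mul _ _ h3.1 (h.pw hxP.1 (n + 1))
        have h5 : y * (x ^ (n + 1 + 1))⁻¹ * x * x ^ (n + 1) = y := by
          rw [pow_succ' x (n+1)]; group
        rw [h5] at h4
        refine ⟨h4, ?_⟩
        have := hd0 _ hy
        rw [h.dm, h.di, h.dp, hxP.2] at this
        push_cast at *; linarith
  refine ⟨key, gOL_eq h1 hm key, ?_⟩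
  obtain ⟨w, hw, hw'⟩ := hs
  refine ⟨w, hw, fun h3 => hw' ?_⟩
  have := conj_iter hc n _ h3
  convert this using 1
  rw [pow_succ]; group

theorem coreC (h : GE d P) {W : Set G} (hW : W = gOL (gP d P 1)) {x : G}
    (hx : ∀ y, y ∈ gP d P 1 ↔ y * x⁻¹ ∈ W) (hc : ∀ w ∈ W, x⁻¹ * w * x ∈ W)
    (hs : ∃ w ∈ W, x * w * x⁻¹ ∉ W) (n : ℕ) :
    (∀ y, y ∈ gP d P (n + 1 : ℕ) ↔ y * (x ^ (n + 1))⁻¹ ∈ gOL (gP d P (n + 1 : ℕ))) ∧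
    (∀ y, y ∈ gP d P (n + 1 : ℕ) → (x ^ (n + 1))⁻¹ * y ∈ gOL (gP d P (n + 1 : ℕ))) ∧
    (∃ y, y ∉ gP d P (n + 1 : ℕ) ∧ (x ^ (n + 1))⁻¹ * y ∈ gOL (gP d P (n + 1 : ℕ))) := by
  have h1 : (1 : G) ∈ W := hW ▸ gOL_one _
  have hm : ∀ a ∈ W, ∀ b ∈ W, a * b ∈ W := fun a ha b hb => by
    rw [hW] at *; exact gOL_mul ha hb
  have hxP : x ∈ gP d P 1 := (hx x).2 (by simpa using h1)
  have hd0 : ∀ w ∈ W, d w = 0 := fun w hw => by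
    rw [hW] at hw; exact gOL_deg h ⟨x, hxP⟩ (fun s hs => hs.2) hw
  obtain ⟨w, hw, hw'⟩ := hs
  have hz : x⁻¹ * (x * w * x⁻¹)⁻¹ ∈ P := by
    by_contra hc
    have := h.tot _ hc
    apply hw'
    have h2 : x * w * x⁻¹ * x ∈ gP d P 1 :=
      ⟨by simpa [mul_assoc] using this, by rw [h.dm, h.dm, h.dm, h.di, hd0 w hw, hxP.2]; rfl⟩
    exact by simpa using (hx _).1 h2
  have key : ∀ y, y ∈ gP d P (n + 1 : ℕ) ↔ (x ^ n)⁻¹ * y * x⁻¹ ∈ W := by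
    induction n with
    | zero => intro y; simpa using hx y
    | succ n ih =>
      intro y
      constructor
      · intro hy
        have h6 : x⁻¹ * (x * w * x⁻¹)⁻¹ * y ∈ gP d P (n + 1 : ℕ) := by
          refine ⟨h.mul _ _ hz hy.1, ?_⟩
          simp only [h.dm, h.di, hd0 w hw, hxP.2, hy.2]; push_cast; ring
        have h7 := hm _ (conj_iter' hc n _ hw) _ ((ih _).1 h6)
        convert h7 using 1
        rw [pow_succ']; group
      · intro hy
        have h3 : (x ^ (n + 1))⁻¹ * y ∈ gP d P 1 := (hx _).2 hy
        have h4 := h.mul _ _ (h.pw hxP.1 (n + 1)) h3.1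
        rw [mul_inv_cancel_left] at h4
        refine ⟨h4, ?_⟩
        have := h3.2
        rw [h.dm, h.di, h.dp, hxP.2] at this
        push_cast at *; linarith
  have hO : ∀ g, g ∈ gOL (gP d P (n + 1 : ℕ)) ↔ (x ^ n)⁻¹ * g * x ^ n ∈ W := by
    intro g
    constructor
    · intro hg
      have h3 : x ^ (n + 1) ∈ gP d P (n + 1 : ℕ) := by
        rw [key]; convert h1 using 1; rw [pow_succ]; group
      have h4 := (key _).1 (hg _ h3)
      convert h4 using 1
      rw [pow_succ]; group
    · intro hg y hy
      rw [key] at hy ⊢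
      have := hm _ hg _ hy
      convert this using 1
      group
  refine ⟨fun y => ?_, fun y hy => ?_, ⟨x ^ n * (x * w), ?_, ?_⟩⟩
  · rw [hO, key]
    have : (x ^ n)⁻¹ * (y * (x ^ (n + 1))⁻¹) * x ^ n = (x ^ n)⁻¹ * y * x⁻¹ := by
      rw [pow_succ']; group
    rw [this]
  · rw [hO]
    rw [key] at hy
    have := conj_iter' hc (n + 1) _ hy
    convert this using 1
    rw [pow_succ x n]; simp only [mul_inv_rev]; group
  · rw [key]
    convert hw' using 2
    group
  · rw [hO]
    have := conj_iter' hc n _ hw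
    convert this using 1
    rw [pow_succ]; group

theorem coreD (h : GE d P) {W : Set G} (hW : W = gOL (gP d P 1)) {x : G}
    (hx : ∀ y, y ∈ gP d P 1 ↔ y * x⁻¹ ∈ W) (hx' : ∀ y, y ∈ gP d P 1 ↔ x⁻¹ * y ∈ W)
    (hn : ∀ y, y ∈ gP d P (-1) ↔ y * x ∈ gJ W)
    (hJ : ∀ t ∈ gJ W, ∃ a ∈ gJ W, ∃ b ∈ gJ W, t = a * b) (n : ℕ) :
    (∀ y, y ∈ gP d P (n + 1 : ℕ) ↔ y * (x ^ (n + 1))⁻¹ ∈ W) ∧ gOL (gP d P (n + 1 : ℕ)) = W ∧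
    (∀ y, y ∈ gP d P (n + 1 : ℕ) ↔ (x ^ (n + 1))⁻¹ * y ∈ W) ∧
    (∀ y, y ∈ gP d P (-(n + 1 : ℕ)) ↔ y * x ^ (n + 1) ∈ gJ W) := by
  have h1 : (1 : G) ∈ W := hW ▸ gOL_one _
  have hm : ∀ a ∈ W, ∀ b ∈ W, a * b ∈ W := fun a ha b hb => by
    rw [hW] at *; exact gOL_mul ha hb
  have hxP : x ∈ gP d P 1 := (hx x).2 (by simpa using h1)
  have hd0 : ∀ w ∈ W, d w = 0 := fun w hw => by
    rw [hW] at hw; exact gOL_deg h ⟨x, hxP⟩ (fun s hs => hs.2) hw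
  have htot : ∀ w, d w = 0 → w ∉ W → w⁻¹ ∈ W := by
    intro w hw0 hw
    rw [hW] at hw ⊢
    exact gOL_P h (h.tot _ (fun h3 => hw (gOL_P h h3 hw0))) (by rw [h.di, hw0]; rfl)
  have hc : ∀ w ∈ W, x * w * x⁻¹ ∈ W := fun w hw => (hx _).1 ((hx' _).2 (by simpa using hw))
  have hc' : ∀ w ∈ W, x⁻¹ * w * x ∈ W := fun w hw => by
    have := (hx' _).1 ((hx (w * x)).2 (by simpa using hw)); simpa [mul_assoc] using this
  have hJc' : ∀ w ∈ gJ W, ∀ m : ℕ, (x ^ m)⁻¹ * w * x ^ m ∈ gJ W := fun w hw m =>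
    ⟨conj_iter' hc' m _ hw.1, fun h3 => hw.2 (by
      have := conj_iter hc m _ h3
      convert this using 1; group)⟩
  have hJc : ∀ w ∈ gJ W, ∀ m : ℕ, (x ^ m) * w * (x ^ m)⁻¹ ∈ gJ W := fun w hw m =>
    ⟨conj_iter hc m _ hw.1, fun h3 => hw.2 (by
      have := conj_iter' hc' m _ h3
      convert this using 1; group)⟩
  have key : ∀ y, y ∈ gP d P (n + 1 : ℕ) ↔ y * (x ^ (n + 1))⁻¹ ∈ W := by
    induction n with
    | zero => intro y; simpa using hx y
    | succ n ih =>
      intro y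
      constructor
      · intro hy
        have hv : x⁻¹ * (y * (x ^ (n + 1 + 1))⁻¹) * x ∈ W := by
          by_contra hv
          set v := x⁻¹ * (y * (x ^ (n + 1 + 1))⁻¹) * x with hvd
          have hdv : d v = 0 := by
            simp only [hvd, h.dm, h.di, h.dp, hxP.2, hy.2]; ring
          obtain ⟨a, ha, b, hb, hab⟩ := hJ v⁻¹ ⟨htot _ hdv hv, by simpa using hv⟩
          have h3 : b * x⁻¹ ∈ gP d P (-1) := (hn _).2 (by simpa using hb)
          have h4 : b * x⁻¹ * y ∈ gP d P (n + 1 : ℕ) := ⟨h.mul _ _ h3.1 hy.1, by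
            rw [h.dm, h3.2, hy.2]; push_cast; ring⟩
          have h5 := (ih _).1 h4
          have h6 : b * x⁻¹ * y * (x ^ (n + 1))⁻¹ = b * v := by
            rw [hvd, pow_succ x (n + 1)]; group
          have h7 : b * v = a⁻¹ := by
            have : v = (a * b)⁻¹ := by rw [← hab, inv_inv]
            rw [this]; group
          rw [h6, h7] at h5
          exact ha.2 h5
        have := hc _ hv
        convert this using 1; group
      · intro hy
        have h3 : y * (x ^ (n + 1 + 1))⁻¹ * x ∈ gP d P 1 := (hx _).2 (by simpa using hy)
        have h4 := h.mul _ _ h3.1 (h.pw hxP.1 (n + 1))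
        have h5 : y * (x ^ (n + 1 + 1))⁻¹ * x * x ^ (n + 1) = y := by
          rw [pow_succ' x (n+1)]; group
        rw [h5] at h4
        refine ⟨h4, ?_⟩
        have := hd0 _ hy
        rw [h.dm, h.di, h.dp, hxP.2] at this
        push_cast at *; linarith
  refine ⟨key, gOL_eq h1 hm key, fun y => ?_, fun y => ?_⟩
  · rw [key]
    constructor
    · intro h3
      have := conj_iter' hc' (n + 1) _ h3
      convert this using 1; group
    · intro h3
      have := conj_iter hc (n + 1) _ h3
      convert this using 1; group
  · constructor
    · intro hy
      have h3 : x ^ n * y ∈ gP d P (-1) := ⟨h.mul _ _ (h.pw hxP.1 n) hy.1, by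
        rw [h.dm, h.dp, hxP.2, hy.2]; push_cast; ring⟩
      have h4 := hJc' _ ((hn _).1 h3) n
      convert h4 using 1
      rw [pow_succ']; group
    · intro hy
      have hdy : d y = -(n + 1 : ℕ) := by
        have := hd0 _ hy.1
        rw [h.dm, h.dp, hxP.2] at this; linarith
      refine ⟨?_, hdy⟩
      by_contra h3
      have h4 : y⁻¹ ∈ gP d P (n + 1 : ℕ) := ⟨h.tot _ h3, by rw [h.di, hdy]; ring⟩
      have h5 := conj_iter' hc' (n + 1) _ ((key _).1 h4)
      apply hy.2
      convert h5 using 1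
      group

lemma gOL_trans {S T : Set G} {a b : G} (hS : ∀ y, y ∈ S ↔ a * y * b ∈ T) (g : G) :
    g ∈ gOL S ↔ a * g * a⁻¹ ∈ gOL T := by
  constructor
  · intro hg t ht
    have h1 : a⁻¹ * t * b⁻¹ ∈ S := by rw [hS]; convert ht using 1; group
    have h2 := (hS _).1 (hg _ h1)
    convert h2 using 1; group
  · intro hg y hy
    rw [hS] at hy ⊢
    convert hg _ hy using 1; group

lemma gLST_trans_aux (h : GE d P) {S T : Set G} {a b : G} (hS : ∀ y, y ∈ S ↔ a * y * b ∈ T)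
    {i j : ℤ} (hij : d a + i + d b = j) (y : G) (hy : y ∈ gLST d i S) :
    a * y * b ∈ gLST d j T := by
  refine ⟨by rw [h.dm, h.dm, hy.1, hij], fun c hc => ?_⟩
  have h1 := hy.2 (a⁻¹ * c * b⁻¹) (fun s hs => by
    rw [gOL_trans hS]
    convert hc _ ((hS s).1 hs) using 1
    group)
  rw [gOL_trans hS] at h1
  convert h1 using 1
  group

lemma gLST_trans (h : GE d P) {S T : Set G} {a b : G} (hS : ∀ y, y ∈ S ↔ a * y * b ∈ T)
    {i j : ℤ} (hij : d a + i + d b = j) (y : G) : y ∈ gLST d i S ↔ a * y * b ∈ gLST d j T := by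
  refine ⟨gLST_trans_aux h hS hij y, fun hy => ?_⟩
  have := gLST_trans_aux h (S := T) (T := S) (a := a⁻¹) (b := b⁻¹)
    (fun z => by rw [hS]; simp [mul_assoc]) (i := j) (j := i) (by rw [h.di, h.di]; omega) _ hy
  simpa [mul_assoc] using this

lemma gsub_LST (i : ℤ) (S : Set G) (hd : ∀ s ∈ S, d s = i) : S ⊆ gLST d i S :=
  fun s hs => ⟨hd s hs, fun _ hc => hc s hs⟩

lemma ssub_trans (h : GE d P) {S T : Set G} {a b : G} (hS : ∀ y, y ∈ S ↔ a * y * b ∈ T)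
    {i j : ℤ} (hij : d a + i + d b = j) (hT : T ⊂ gLST d j T) : S ⊂ gLST d i S := by
  have h1 := gLST_trans h hS hij
  obtain ⟨h2, h3⟩ := hT
  refine ⟨fun y hy => (h1 y).2 (h2 ((hS y).1 hy)), fun h4 => h3 fun t ht => ?_⟩
  have h5 := h4 ((h1 (a⁻¹ * t * b⁻¹)).2 (by convert ht using 1; group))
  rw [hS] at h5
  convert h5 using 1; group

theorem coreF (h : GE d P) (hne : (gP d P 1).Nonempty) (hF : gP d P 1 ⊂ gLST d 1 (gP d P 1))
    (n : ℕ) : gP d P (n + 1 : ℕ) ⊂ gLST d (n + 1 : ℕ) (gP d P (n + 1 : ℕ)) := by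
  obtain ⟨x, hxL, hxP⟩ := Set.exists_of_ssubset hF
  obtain ⟨W, hW⟩ : ∃ W, W = gOL (gP d P 1) := ⟨_, rfl⟩
  have h1 : (1 : G) ∈ W := hW ▸ gOL_one _
  have hm : ∀ a ∈ W, ∀ b ∈ W, a * b ∈ W := fun a ha b hb => by
    rw [hW] at *; exact gOL_mul ha hb
  have hd0 : ∀ w ∈ W, d w = 0 := fun w hw => by
    rw [hW] at hw; exact gOL_deg h hne (fun s hs => hs.2) hw
  have htot : ∀ w, d w = 0 → w ∉ W → w⁻¹ ∈ W := by
    intro w hw0 hw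
    rw [hW] at hw ⊢
    exact gOL_P h (h.tot _ (fun h3 => hw (gOL_P h h3 hw0))) (by rw [h.di, hw0]; rfl)
  have hdx : d x = 1 := hxL.1
  have f1 : ∀ c, d c = 1 → c ∉ gP d P 1 → ∀ p ∈ gP d P 1, p * c⁻¹ ∈ gJ W := by
    intro c hc hcP p hp
    have h3 : (p * c⁻¹)⁻¹ ∉ W := by
      intro h4
      rw [hW] at h4
      apply hcP
      have := h4 p hp
      simpa using this
    refine ⟨?_, h3⟩
    have := htot _ (by rw [h.di, h.dm, h.di, hp.2, hc]; rfl) h3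
    simpa using this
  have f2 : ∀ j ∈ gJ W, j * x ∈ gP d P 1 := by
    intro j hj
    by_contra h3
    have h4 := f1 (j * x) (by rw [h.dm, hd0 j hj.1, hdx]; rfl) h3
    have h5 := hxL.2 (j * x) (fun s hs => hW ▸ (h4 s hs).1)
    apply hj.2
    rw [← hW] at h5
    simpa using h5
  have hP1 : ∀ y, y ∈ gP d P 1 ↔ y * x⁻¹ ∈ gJ W := fun y =>
    ⟨f1 x hdx hxP y, fun hy => by simpa using f2 _ hy⟩
  have hJJ : ∀ t ∈ gJ W, ∃ a ∈ gJ W, ∃ b ∈ gJ W, t = a * b := by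
    intro t ht
    have : ∃ j ∈ gJ W, j * t⁻¹ ∉ W := by
      by_contra hcon
      push Not at hcon
      have h5 := hxL.2 (t * x) (fun s hs => by
        rw [← hW]
        have := hcon _ ((hP1 s).1 hs)
        simpa [mul_assoc] using this)
      apply ht.2
      rw [← hW] at h5
      simpa using h5
    obtain ⟨j, hj, hjt⟩ := this
    refine ⟨t * j⁻¹, ⟨?_, by simpa using hjt⟩, j, hj, by group⟩
    have := htot _ (by rw [h.dm, h.di, hd0 j hj.1, hd0 t ht.1]; rfl) hjt
    simpa using this
  have hxi : x⁻¹ ∈ P := h.tot _ (fun h3 => hxP ⟨h3, hdx⟩)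
  have hT : ∀ v ∈ gP d P 0, x * v * x⁻¹ ∈ W := by
    intro v hv
    by_contra h3
    have hdg : d (x * v * x⁻¹) = 0 := by rw [h.dm, h.dm, h.di, hv.2]; ring
    have h4 := htot _ hdg h3
    have h5 := f2 _ ⟨h4, by simpa using h3⟩
    have h6 := gOR_P h (i := 1) hv.1 hv.2 _ h5
    apply hxP
    convert h6 using 1; group
  have hcomp : (∀ w ∈ W, x * w * x⁻¹ ∈ W) ∨ (∀ w ∈ W, x⁻¹ * w * x ∈ W) := by
    by_contra hcon
    push Not at hcon
    obtain ⟨⟨a, ha, ha'⟩, b, hb, hb'⟩ := hcon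
    by_cases h3 : a * (x⁻¹ * b * x)⁻¹ ∈ P
    · have h4 := hT _ ⟨h3, by simp only [h.dm, h.di, hd0 a ha, hd0 b hb]; ring⟩
      apply ha'
      have := hm _ h4 _ hb
      convert this using 1; group
    · have h4 : (x⁻¹ * b * x) * a⁻¹ ∈ gP d P 0 :=
        ⟨by simpa using h.tot _ h3, by simp only [h.dm, h.di, hd0 a ha, hd0 b hb]; ring⟩
      apply hb'
      have h5 : (x⁻¹ * b * x) * a⁻¹ ∈ W := by rw [hW]; exact gOL_P h h4.1 h4.2
      have := hm _ h5 _ ha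
      convert this using 1; group
  rcases hcomp with hc | hc
  · have hJc : ∀ j ∈ gJ W, x⁻¹ * j * x ∈ gJ W := by
      intro j hj
      have h3 : (x⁻¹ * j * x)⁻¹ ∉ W := fun h4 => hj.2 (by
        convert hc _ h4 using 1; group)
      refine ⟨?_, h3⟩
      have := htot _ (by simp only [h.dm, h.di, hd0 j hj.1]; ring) h3
      rwa [inv_inv] at this
    have key : ∀ y, y ∈ gP d P (n + 1 : ℕ) ↔ y * (x ^ n)⁻¹ ∈ gP d P 1 := by
      clear hF
      induction n with
      | zero => intro y; simp
      | succ n ih =>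
        intro y
        constructor
        · intro hy
          have h3 : y * x⁻¹ ∈ gP d P (n + 1 : ℕ) :=
            ⟨h.mul _ _ hy.1 hxi, by rw [h.dm, h.di, hy.2, hdx]; push_cast; ring⟩
          have := (ih _).1 h3
          convert this using 1
          rw [pow_succ]; group
        · intro hy
          obtain ⟨a, ha, b, hb, hab⟩ := hJJ _ ((hP1 _).1 hy)
          have h3 := f2 _ ha
          have h4 : (x⁻¹ * b * x) * x ^ (n + 1) ∈ gP d P (n + 1 : ℕ) := by
            rw [ih, hP1]
            convert hJc _ hb using 1
            rw [pow_succ']; group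
          have h5 : y = (a * x) * ((x⁻¹ * b * x) * x ^ (n + 1)) := by
            have h6 : (a * x) * ((x⁻¹ * b * x) * x ^ (n + 1)) = (a * b) * x * x ^ (n + 1) := by group
            rw [h6, ← hab]; group
          rw [h5]
          exact ⟨h.mul _ _ h3.1 h4.1, by rw [h.dm, h3.2, h4.2]; push_cast; ring⟩
    refine ssub_trans h (a := 1) (b := (x ^ n)⁻¹) (j := 1) (fun y => ?_) ?_ hF
    · rw [one_mul]; exact key y
    · rw [h.d1, h.di, h.dp, hdx]; push_cast; ring
  · have hJc : ∀ j ∈ gJ W, x * j * x⁻¹ ∈ gJ W := by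
      intro j hj
      have h3 : (x * j * x⁻¹)⁻¹ ∉ W := fun h4 => hj.2 (by
        convert hc _ h4 using 1; group)
      refine ⟨?_, h3⟩
      have := htot _ (by simp only [h.dm, h.di, hd0 j hj.1]; ring) h3
      rwa [inv_inv] at this
    have key : ∀ y, y ∈ gP d P (n + 1 : ℕ) ↔ (x ^ n)⁻¹ * y ∈ gP d P 1 := by
      clear hF
      induction n with
      | zero => intro y; simp
      | succ n ih =>
        intro y
        constructor
        · intro hy
          have h3 : x⁻¹ * y ∈ gP d P (n + 1 : ℕ) :=
            ⟨h.mul _ _ hxi hy.1, by rw [h.dm, h.di, hy.2, hdx]; push_cast; ring⟩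
          have := (ih _).1 h3
          convert this using 1
          rw [pow_succ']; group
        · intro hy
          obtain ⟨a, ha, b, hb, hab⟩ := hJJ _ ((hP1 _).1 hy)
          have h3 := f2 _ (conj_iter hJc (n + 1) _ ha)
          have h4 : x ^ n * (b * x) ∈ gP d P (n + 1 : ℕ) := by
            rw [ih]
            convert f2 _ hb using 1
            group
          have h5 : y = (x ^ (n + 1) * a * (x ^ (n + 1))⁻¹ * x) * (x ^ n * (b * x)) := by
            have h6 : (x ^ (n + 1) * a * (x ^ (n + 1))⁻¹ * x) * (x ^ n * (b * x))
                = x ^ (n + 1) * (a * b) * x := by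
              rw [pow_succ']; group
            rw [h6, ← hab]; group
          rw [h5]
          exact ⟨h.mul _ _ h3.1 h4.1, by rw [h.dm, h3.2, h4.2]; push_cast; ring⟩
    refine ssub_trans h (a := (x ^ n)⁻¹) (b := 1) (j := 1) (fun y => ?_) ?_ hF
    · rw [mul_one]; exact key y
    · rw [h.d1, h.di, h.dp, hdx]; push_cast; ring

/-- star closed and non principal -/
def gGood (d : G → ℤ) (i : ℤ) (S : Set G) : Prop :=
  gLST d i S = S ∧ ¬ ∃ c, ∀ y, y ∈ S ↔ y * c⁻¹ ∈ gOL S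

lemma good_trans (h : GE d P) {S T : Set G} {a b : G} (hS : ∀ y, y ∈ S ↔ a * y * b ∈ T)
    {i j : ℤ} (hij : d a + i + d b = j) (hT : gGood d j T) : gGood d i S := by
  have h1 := gLST_trans h hS hij
  obtain ⟨h2, h3⟩ := hT
  refine ⟨?_, fun ⟨c, hc⟩ => h3 ⟨a * c * b, fun y => ?_⟩⟩
  · ext y; rw [h1, h2, hS]
  · have h4 := hc (a⁻¹ * y * b⁻¹)
    rw [hS, gOL_trans hS] at h4
    convert h4 using 2 <;> group

lemma good_of (h : GE d P) {i : ℤ} {M : Set G} (hne : M.Nonempty) (hd : ∀ s ∈ M, d s = i)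
    (hVM : ∀ v ∈ gP d P 0, v ∈ gOL M)
    (hM : ¬ ∃ c, ∀ y, y ∈ gLST d i M ↔ y * c⁻¹ ∈ gOL M) : gGood d i M := by
  have h1 : gLST d i M = M := by
    refine Set.Subset.antisymm ?_ (gsub_LST i M hd)
    intro y hy
    by_contra hyM
    apply hM
    have hMy : ∀ s ∈ M, s * y⁻¹ ∈ gOL M := by
      intro s hs
      apply hVM
      refine ⟨?_, by rw [h.dm, h.di, hd s hs, hy.1]; ring⟩
      by_contra h3
      apply hyM
      have := hVM _ ⟨h.tot _ h3, by rw [h.di, h.dm, h.di, hd s hs, hy.1]; ring⟩ s hs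
      convert this using 1; group
    refine ⟨y, fun z => ⟨fun hz => hz.2 y hMy, fun hz => ⟨?_, fun c hc => ?_⟩⟩⟩
    · have := gOL_deg h hne hd hz
      rw [h.dm, h.di, hy.1] at this; omega
    · have := gOL_mul hz (hy.2 c hc)
      convert this using 1; group
  exact ⟨h1, by rw [h1] at hM; exact hM⟩

lemma gpow_sub (h : GE d P) (n : ℕ) : (gP d P 1) ^ (n + 1) ⊆ gP d P (n + 1 : ℕ) := by
  induction n with
  | zero => simp
  | succ n ih =>
    rw [pow_succ]
    rintro y ⟨a, ha, b, hb, rfl⟩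
    have ha := ih ha
    exact ⟨h.mul _ _ ha.1 hb.1, by rw [h.dm, ha.2, hb.2]; push_cast; ring⟩

theorem coreG0 (h : GE d P) (hne : (gP d P 1).Nonempty) (hg1 : gGood d 1 (gP d P 1))
    (hG : ∀ i : ℕ, 0 < i → ¬ ∃ c, ∀ y, y ∈ gLST d i ((gP d P 1) ^ i) ↔ y * c⁻¹ ∈ gOL (gP d P 1))
    (n : ℕ) : gP d P (n + 1 : ℕ) = (gP d P 1) ^ (n + 1) ∧
      gGood d (n + 1 : ℕ) (gP d P (n + 1 : ℕ)) := by
  have hdL : ∀ w ∈ gOL (gP d P 1), d w = 0 := fun w hw => gOL_deg h hne (fun s hs => hs.2) hw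
  have hdR : ∀ w ∈ gOR (gP d P 1), d w = 0 := fun w hw => gOR_deg h hne (fun s hs => hs.2) hw
  by_cases c1 : ∃ w ∈ gOL (gP d P 1), w ∉ gOR (gP d P 1)
  · obtain ⟨w, hw, hwR⟩ := c1
    have : ∃ x ∈ gP d P 1, x * w ∉ gP d P 1 := by
      by_contra hcon; push Not at hcon; exact hwR hcon
    obtain ⟨x, hx, hxw⟩ := this
    have hdw := hdL w hw
    have hxwP : x * w ∉ P := fun h3 => hxw ⟨h3, by rw [h.dm, hx.2, hdw]; rfl⟩
    have hxW : ∀ p ∈ gP d P 1, x⁻¹ * p ∈ gOL (gP d P 1) := by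
      intro p hp
      by_contra hq
      set q := x⁻¹ * p with hqd
      have hdq : d q = 0 := by rw [hqd, h.dm, h.di, hx.2, hp.2]; rfl
      have h3 : w⁻¹ * q ∉ gOL (gP d P 1) := fun h4 => hq (by simpa using gOL_mul hw h4)
      have hd3 : d (w⁻¹ * q) = 0 := by rw [h.dm, h.di, hdq, hdw]; rfl
      have h5 := h.tot (w⁻¹ * q) (fun h4 => h3 (gOL_P h h4 hd3))
      apply hxwP
      have := h.mul _ _ hp.1 h5
      convert this using 1
      rw [hqd]; group
    have hc : ∀ w ∈ gOL (gP d P 1), x⁻¹ * w * x ∈ gOL (gP d P 1) := fun w hw => by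
      rw [mul_assoc]; exact hxW _ (hw _ hx)
    have key : ∀ y, y ∈ gP d P (n + 1 : ℕ) ↔ (x ^ n)⁻¹ * y ∈ gP d P 1 := by
      induction n with
      | zero => intro y; simp
      | succ n ih =>
        intro y
        constructor
        · intro hy
          have h3 : (x * w)⁻¹ * y ∈ gP d P (n + 1 : ℕ) := ⟨h.mul _ _ (h.tot _ hxwP) hy.1, by
            rw [h.dm, h.di, h.dm, hx.2, hdw, hy.2]; push_cast; ring⟩
          have h4 := conj_iter' hc n _ hw _ ((ih _).1 h3)
          convert h4 using 1
          rw [pow_succ']; group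
        · intro hy
          have := h.mul _ _ (h.pw hx.1 (n + 1)) hy.1
          rw [mul_inv_cancel_left] at this
          refine ⟨this, ?_⟩
          have := hy.2
          rw [h.dm, h.di, h.dp, hx.2] at this
          push_cast at *; linarith
    refine ⟨Set.Subset.antisymm ?_ (gpow_sub h n), ?_⟩
    · intro y hy
      rw [pow_succ]
      exact ⟨x ^ n, Set.pow_mem_pow hx, _, (key y).1 hy, by simp⟩
    · refine good_trans h (a := (x ^ n)⁻¹) (b := 1) (j := 1) (fun y => ?_) ?_ hg1
      · rw [mul_one]; exact key y
      · rw [h.d1, h.di, h.dp, hx.2]; push_cast; ring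
  by_cases c2 : ∃ w ∈ gOR (gP d P 1), w ∉ gOL (gP d P 1)
  · obtain ⟨w, hw, hwR⟩ := c2
    have : ∃ x ∈ gP d P 1, w * x ∉ gP d P 1 := by
      by_contra hcon; push Not at hcon; exact hwR hcon
    obtain ⟨x, hx, hxw⟩ := this
    have hdw := hdR w hw
    have hxwP : w * x ∉ P := fun h3 => hxw ⟨h3, by rw [h.dm, hx.2, hdw]; rfl⟩
    have hxW : ∀ p ∈ gP d P 1, p * x⁻¹ ∈ gOR (gP d P 1) := by
      intro p hp
      by_contra hq
      set q := p * x⁻¹ with hqd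
      have hdq : d q = 0 := by rw [hqd, h.dm, h.di, hx.2, hp.2]; rfl
      have h3 : q * w⁻¹ ∉ gOR (gP d P 1) := fun h4 => hq (by simpa using gOR_mul h4 hw)
      have hd3 : d (q * w⁻¹) = 0 := by rw [h.dm, h.di, hdq, hdw]; rfl
      have h5 := h.tot (q * w⁻¹) (fun h4 => h3 (gOR_P h h4 hd3))
      apply hxwP
      have := h.mul _ _ h5 hp.1
      convert this using 1
      rw [hqd]; group
    have hc : ∀ w ∈ gOR (gP d P 1), x * w * x⁻¹ ∈ gOR (gP d P 1) := fun w hw =>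
      hxW _ (hw _ hx)
    have key : ∀ y, y ∈ gP d P (n + 1 : ℕ) ↔ y * (x ^ n)⁻¹ ∈ gP d P 1 := by
      induction n with
      | zero => intro y; simp
      | succ n ih =>
        intro y
        constructor
        · intro hy
          have h3 : y * (w * x)⁻¹ ∈ gP d P (n + 1 : ℕ) := ⟨h.mul _ _ hy.1 (h.tot _ hxwP), by
            rw [h.dm, h.di, h.dm, hx.2, hdw, hy.2]; push_cast; ring⟩
          have h4 := conj_iter hc n _ hw _ ((ih _).1 h3)
          convert h4 using 1
          rw [pow_succ]; group
        · intro hy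
          have := h.mul _ _ hy.1 (h.pw hx.1 (n + 1))
          rw [inv_mul_cancel_right] at this
          refine ⟨this, ?_⟩
          have := hy.2
          rw [h.dm, h.di, h.dp, hx.2] at this
          push_cast at *; linarith
    refine ⟨Set.Subset.antisymm ?_ (gpow_sub h n), ?_⟩
    · intro y hy
      rw [pow_succ']
      exact ⟨_, (key y).1 hy, x ^ n, Set.pow_mem_pow hx, by simp⟩
    · refine good_trans h (a := 1) (b := (x ^ n)⁻¹) (j := 1) (fun y => ?_) ?_ hg1
      · rw [one_mul]; exact key y
      · rw [h.d1, h.di, h.dp, hx.2]; push_cast; ring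
  push Not at c1 c2
  have main : gP d P (n + 1 : ℕ) = (gP d P 1) ^ (n + 1) ∧
      gGood d (n + 1 : ℕ) (gP d P (n + 1 : ℕ)) ∧ gOL (gP d P (n + 1 : ℕ)) = gOL (gP d P 1) := by
    induction n with
    | zero => simpa using hg1
    | succ n ih =>
      obtain ⟨ih1, -, ih3⟩ := ih
      obtain ⟨M, hM⟩ : ∃ M, M = (gP d P 1) ^ (n + 1 + 1) := ⟨_, rfl⟩
      have hM' : M = gP d P 1 * gP d P (n + 1 : ℕ) := by rw [hM, ih1, pow_succ']
      have hMs : M ⊆ gP d P (n + 1 + 1 : ℕ) := hM ▸ gpow_sub h (n + 1)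
      have hMne : M.Nonempty := hM ▸ hne.pow
      have hOM : gOL M = gOL (gP d P 1) := by
        refine Set.Subset.antisymm ?_ ?_
        · intro u hu
          by_contra huW
          have hdu : d u = 0 := gOL_deg h hMne (fun s hs => (hMs hs).2) hu
          have : ∃ x ∈ gP d P 1, u * x ∉ gP d P 1 := by
            by_contra hcon; push Not at hcon; exact huW hcon
          obtain ⟨x, hx, hux⟩ := this
          have hI : ∀ p ∈ gP d P 1, (u * x)⁻¹ * p ∈ gP d P 0 := by
            intro p hp
            refine ⟨?_, by simp only [h.dm, h.di, hdu, hx.2, hp.2]; rfl⟩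
            by_contra h3
            apply hux
            have := h.mul _ _ hp.1 (h.tot _ h3)
            refine ⟨by convert this using 1; group, by rw [h.dm, hdu, hx.2]; rfl⟩
          have h3 : x⁻¹ * u * x ∈ gOL (gP d P (n + 1 : ℕ)) := by
            intro y hy
            have h4 : x * y ∈ M := by rw [hM']; exact ⟨x, hx, y, hy, rfl⟩
            have h5 := hu _ (hu _ h4)
            rw [hM'] at h5
            obtain ⟨p, hp, z, hz, hpz⟩ := h5
            have h6 := hI p hp
            have h7 := gOL_P h h6.1 h6.2 z hz
            convert h7 using 1
            have hpz : p * z = u * (u * (x * y)) := hpz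
            rw [mul_assoc (u * x)⁻¹ p z, hpz]; group
          rw [ih3] at h3
          have := c1 _ h3 x hx
          apply hux
          convert this using 1; group
        · intro g hg y hy
          rw [hM'] at hy ⊢
          obtain ⟨p, hp, z, hz, rfl⟩ := hy
          exact ⟨g * p, hg p hp, z, hz, by simp [mul_assoc]⟩
      have hgood : gGood d (n + 1 + 1 : ℕ) M := by
        refine good_of h hMne (fun s hs => (hMs hs).2) (fun v hv => ?_) ?_
        · rw [hOM]; exact gOL_P h hv.1 hv.2
        · rw [hOM, hM]; exact hG _ (Nat.succ_pos _)
      have hfin : gP d P (n + 1 + 1 : ℕ) = M := by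
        refine Set.Subset.antisymm ?_ hMs
        intro y hy
        by_contra hyM
        have hJy : ∀ j, d j = 0 → j⁻¹ ∉ gOL (gP d P 1) → j * y ∈ M := by
          intro j hj0 hj
          have : ∃ p ∈ gP d P 1, j⁻¹ * p ∉ gP d P 1 := by
            by_contra hcon; push Not at hcon; exact hj hcon
          obtain ⟨p, hp, hjp⟩ := this
          have h3 : (j⁻¹ * p)⁻¹ ∈ P := h.tot _ (fun h4 => hjp ⟨h4, by
            rw [h.dm, h.di, hj0, hp.2]; rfl⟩)
          rw [hM']
          refine ⟨p, hp, (j⁻¹ * p)⁻¹ * y, ⟨h.mul _ _ h3 hy.1, ?_⟩, by simp [mul_assoc]⟩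
          simp only [h.dm, h.di, hj0, hp.2, hy.2]; push_cast; ring
        apply hyM
        rw [← hgood.1]
        refine ⟨hy.2, fun c hc => ?_⟩
        rw [hOM] at hc ⊢
        by_contra h3
        have hdc : d c = (n + 1 + 1 : ℕ) := by
          obtain ⟨m, hm⟩ := hMne
          have := hdL _ (hc m hm)
          rw [h.dm, h.di, (hMs hm).2] at this; omega
        have h4 := hJy (c * y⁻¹) (by rw [h.dm, h.di, hdc, hy.2]; ring) (by simpa using h3)
        rw [inv_mul_cancel_right] at h4
        apply hgood.2
        refine ⟨c, fun z => ⟨fun hz => hOM ▸ hc z hz, fun hz => ?_⟩⟩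
        simpa using hz c h4
      refine ⟨by rw [hfin, hM], by rw [hfin]; exact hgood, by rw [hfin, hOM]⟩
  exact ⟨main.1, main.2.1⟩

theorem coreG (h : GE d P) (hne : (gP d P 1).Nonempty) (hg0 : gLST d 1 (gP d P 1) = gP d P 1)
    (hG : ∀ i : ℕ, 0 < i → ¬ ∃ c, ∀ y, y ∈ gLST d i ((gP d P 1) ^ i) ↔ y * c⁻¹ ∈ gOL (gP d P 1))
    (n : ℕ) (hn : 0 < n) : gLST d n (gP d P n) = gP d P n ∧
    ∀ i : ℕ, 0 < i → ¬ ∃ c, ∀ y,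
      y ∈ gLST d ((n * i : ℕ) : ℤ) ((gP d P n) ^ i) ↔ y * c⁻¹ ∈ gOL (gP d P n) := by
  have hg1 : gGood d 1 (gP d P 1) := by
    refine ⟨hg0, ?_⟩
    have := hG 1 one_pos
    rw [pow_one, Nat.cast_one, hg0] at this
    exact this
  have key : ∀ m : ℕ, 0 < m → gP d P m = (gP d P 1) ^ m ∧ gGood d m (gP d P m) := by
    intro m hm
    obtain ⟨k, rfl⟩ := Nat.exists_eq_succ_of_ne_zero hm.ne'
    exact coreG0 h hne hg1 hG k
  refine ⟨(key n hn).2.1, fun i hi ⟨c, hc⟩ => ?_⟩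
  have h1 := key (n * i) (Nat.mul_pos hn hi)
  have h2 : (gP d P n) ^ i = gP d P (n * i : ℕ) := by
    rw [h1.1, (key n hn).1, pow_mul]
  rw [h2, h1.2.1] at hc
  apply h1.2.2
  refine ⟨c, ?_⟩
  rw [gOL_eq (gOL_one _) (fun a ha b hb => gOL_mul ha hb) hc]
  exact hc

end Core
section Tr

/-- the action -/
def phiZ (s : ℤ → (K ≃+* K)) (hs : ∀ i j x, s (i + j) x = s i (s j x)) :
    Multiplicative ℤ →* MulAut Kˣ where
  toFun i := Units.mapEquiv (s i.toAdd).toMulEquiv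
  map_one' := by
    ext x
    have h := hs 0 0 (x : K)
    have h2 : (x : K) = s 0 x := (s 0).injective (by simpa using h)
    simpa using h2.symm
  map_mul' i j := by
    ext x
    simpa using hs i.toAdd j.toAdd x

/-- homogeneous units -/
abbrev HG (s : ℤ → (K ≃+* K)) (hs : ∀ i j x, s (i + j) x = s i (s j x)) :=
  SemidirectProduct Kˣ (Multiplicative ℤ) (phiZ s hs)

variable {s : ℤ → (K ≃+* K)} {hs : ∀ i j x, s (i + j) x = s i (s j x)}

/-- degree -/
def dg (g : HG s hs) : ℤ := g.right.toAdd
/-- leading coefficient -/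
def lc (g : HG s hs) : K := (g.left : K)
/-- make -/
def mkG (s : ℤ → (K ≃+* K)) (hs : ∀ i j x, s (i + j) x = s i (s j x)) (i : ℤ) (a : K) (ha : a ≠ 0) :
    HG s hs := ⟨Units.mk0 a ha, Multiplicative.ofAdd i⟩

lemma dg_mk (i : ℤ) (a : K) (ha : a ≠ 0) : dg (mkG s hs i a ha) = i := rfl
lemma lc_mk (i : ℤ) (a : K) (ha : a ≠ 0) : lc (mkG s hs i a ha) = a := rfl
lemma lc_ne (g : HG s hs) : lc g ≠ 0 := g.left.ne_zero
lemma dg_mul (x y : HG s hs) : dg (x * y) = dg x + dg y := rfl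
lemma lc_mul (x y : HG s hs) : lc (x * y) = lc x * s (dg x) (lc y) := rfl
lemma dg_inv (x : HG s hs) : dg x⁻¹ = - dg x := rfl
lemma lc_inv (x : HG s hs) : lc x⁻¹ = s (- dg x) (lc x)⁻¹ := by
  rw [map_inv₀]
  simp only [lc, SemidirectProduct.inv_left, phiZ, dg]
  simp

lemma s_zero (hs : ∀ i j x, s (i + j) x = s i (s j x)) (x : K) : s 0 x = x := by
  have h := hs 0 0 x
  exact (s 0).injective (by simpa using h.symm)
lemma s_neg (hs : ∀ i j x, s (i + j) x = s i (s j x)) (i : ℤ) (x : K) : s i (s (-i) x) = x := by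
  rw [← hs, add_neg_cancel, s_zero hs]
lemma s_neg' (hs : ∀ i j x, s (i + j) x = s i (s j x)) (i : ℤ) (x : K) : s (-i) (s i x) = x := by
  rw [← hs, neg_add_cancel, s_zero hs]

/-- lift of a set -/
def lf (s : ℤ → (K ≃+* K)) (hs : ∀ i j x, s (i + j) x = s i (s j x)) (i : ℤ) (S : Set K) :
    Set (HG s hs) := {g | dg g = i ∧ lc g ∈ S}

lemma lf_sub {i : ℤ} {S T : Set K} (h0 : (0 : K) ∈ T) : lf s hs i S ⊆ lf s hs i T ↔ S ⊆ T := by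
  constructor
  · intro h k hk
    by_cases hk0 : k = 0
    · rwa [hk0]
    · exact (h (show mkG s hs i k hk0 ∈ lf s hs i S from ⟨rfl, hk⟩)).2
  · exact fun h g hg => ⟨hg.1, h hg.2⟩

lemma lf_eq {i : ℤ} {S T : Set K} (h0 : (0 : K) ∈ S) (h1 : (0 : K) ∈ T) :
    lf s hs i S = lf s hs i T ↔ S = T := by
  rw [Set.Subset.antisymm_iff, Set.Subset.antisymm_iff, lf_sub h1, lf_sub h0]

lemma lf_ssub {i : ℤ} {S T : Set K} (h0 : (0 : K) ∈ S) (h1 : (0 : K) ∈ T) :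
    lf s hs i S ⊂ lf s hs i T ↔ S ⊂ T := by
  rw [ssubset_iff_subset_not_subset, ssubset_iff_subset_not_subset, lf_sub h1, lf_sub h0]

lemma lf_ne {i : ℤ} {S : Set K} {k : K} (hk : k ∈ S) (h0 : k ≠ 0) : (lf s hs i S).Nonempty :=
  ⟨mkG s hs i k h0, rfl, hk⟩

lemma lf_Ol {i : ℤ} {S : Set K} (h0 : (0 : K) ∈ S) (hne : (lf s hs i S).Nonempty) :
    gOL (lf s hs i S) = lf s hs 0 (Ol S) := by
  ext g
  constructor
  · intro hg
    have hd : dg g = 0 := by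
      obtain ⟨y, hy⟩ := hne
      have := (hg y hy).1
      rw [dg_mul, hy.1] at this; omega
    refine ⟨hd, fun k hk => ?_⟩
    by_cases hk0 : k = 0
    · rw [hk0, mul_zero]; exact h0
    · have := (hg (mkG s hs i k hk0) ⟨rfl, hk⟩).2
      rwa [lc_mul, hd, s_zero hs, lc_mk] at this
  · rintro ⟨hd, hg⟩ y hy
    refine ⟨by rw [dg_mul, hd, hy.1, zero_add], ?_⟩
    rw [lc_mul, hd, s_zero hs]
    exact hg _ hy.2

lemma mem_mul_sing {W : Set K} {a k : K} (ha : a ≠ 0) : k ∈ W * {a} ↔ k * a⁻¹ ∈ W := by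
  constructor
  · rintro ⟨w, hw, b, rfl, rfl⟩
    simpa [ha] using hw
  · intro h
    exact ⟨_, h, a, rfl, by simp [ha]⟩

lemma lf_mulr (W : Set K) (x : HG s hs) :
    lf s hs (dg x) (W * {lc x}) = {y | y * x⁻¹ ∈ lf s hs 0 W} := by
  ext y
  simp only [lf, Set.mem_ofPred_eq, dg_mul, dg_inv, lc_mul, lc_inv]
  rw [mem_mul_sing (lc_ne x)]
  constructor
  · rintro ⟨h1, h2⟩
    refine ⟨by omega, ?_⟩
    rw [h1, s_neg hs]; exact h2
  · rintro ⟨h1, h2⟩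
    have h1 : dg y = dg x := by omega
    refine ⟨h1, ?_⟩
    rw [h1, s_neg hs] at h2; exact h2

lemma lf_mull (W : Set K) (x : HG s hs) :
    lf s hs (dg x) ({lc x} * (s (dg x) '' W)) = {y | x⁻¹ * y ∈ lf s hs 0 W} := by
  ext y
  simp only [lf, Set.mem_ofPred_eq, dg_mul, dg_inv, lc_mul, lc_inv]
  rw [← map_mul]
  constructor
  · rintro ⟨h1, ⟨a, ha, b, ⟨w, hw, rfl⟩, h2⟩⟩
    refine ⟨by omega, ?_⟩
    rw [Set.mem_singleton_iff] at ha
    have h2 : a * s (dg x) w = lc y := h2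
    rw [← h2, ha, inv_mul_cancel_left₀ (lc_ne x), s_neg' hs]; exact hw
  · rintro ⟨h1, h2⟩
    refine ⟨by omega, lc x, rfl, _, ⟨_, h2, rfl⟩, ?_⟩
    simp only [s_neg hs]
    exact mul_inv_cancel_left₀ (lc_ne x) _

lemma lf_jac (W : Set K) : lf s hs 0 (jacS W) = gJ (lf s hs 0 W) := by
  ext g
  simp only [lf, jacS, gJ, Set.mem_ofPred_eq, dg_inv, lc_inv]
  have := lc_ne g
  constructor
  · rintro ⟨h1, h2, h3⟩
    refine ⟨⟨h1, h2⟩, ?_⟩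
    rintro ⟨-, h4⟩
    rw [h1, neg_zero, s_zero hs] at h4
    tauto
  · rintro ⟨⟨h1, h2⟩, h3⟩
    refine ⟨h1, h2, Or.inr fun h4 => h3 ⟨by omega, ?_⟩⟩
    rw [h1, neg_zero, s_zero hs]; exact h4

lemma lf_mul (i j : ℤ) (S T : Set K) :
    lf s hs (i + j) (S * (s i '' T)) = lf s hs i S * lf s hs j T := by
  ext g
  constructor
  · rintro ⟨h1, a, ha, b, ⟨t, ht, rfl⟩, h2⟩
    have h2 : a * s i t = lc g := h2
    have h3 := lc_ne g
    have ha0 : a ≠ 0 := by rintro rfl; simp at h2; exact h3 h2.symm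
    have ht0 : t ≠ 0 := by rintro rfl; simp at h2; exact h3 h2.symm
    refine ⟨mkG s hs i a ha0, ⟨rfl, ha⟩, mkG s hs j t ht0, ⟨rfl, ht⟩, ?_⟩
    apply SemidirectProduct.ext
    · apply Units.ext; exact h2
    · exact h1.symm
  · rintro ⟨a, ha, b, hb, rfl⟩
    refine ⟨by simp only [dg_mul, ha.1, hb.1], lc a, ha.2, _, ⟨lc b, hb.2, rfl⟩, ?_⟩
    simp only [lc_mul, ha.1]

lemma zero_Ol {S : Set K} (h0 : (0 : K) ∈ S) : (0 : K) ∈ Ol S := fun x _ => by simpa using h0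
lemma zero_mulr {W : Set K} (a : K) (h0 : (0 : K) ∈ W) : (0 : K) ∈ W * {a} :=
  ⟨0, h0, a, rfl, by simp⟩
lemma zero_mull {W : Set K} (a : K) (e : K ≃+* K) (h0 : (0 : K) ∈ W) : (0 : K) ∈ {a} * (e '' W) :=
  ⟨a, rfl, 0, ⟨0, h0, by simp⟩, by simp⟩
lemma zero_lstar {S : Set K} (h0 : (0 : K) ∈ S) : (0 : K) ∈ lstar S := by
  simp only [lstar, Set.mem_iInter]
  exact fun c _ => zero_mulr c (zero_Ol h0)
lemma sub_lstar (S : Set K) : S ⊆ lstar S := by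
  intro x hx
  simp only [lstar, Set.mem_iInter]
  exact fun c hc => hc hx
lemma mulr_zero {W : Set K} (h0 : (0 : K) ∈ W) : W * {(0 : K)} = {0} := by
  ext k
  constructor
  · rintro ⟨w, -, b, rfl, rfl⟩; simp
  · rintro rfl; exact zero_mulr _ h0

lemma lf_lstar {i : ℤ} {S : Set K} (h0 : (0 : K) ∈ S) (hne : (lf s hs i S).Nonempty) :
    lf s hs i (lstar S) = gLST dg i (lf s hs i S) := by
  have hO := lf_Ol h0 hne
  ext g
  simp only [gLST, Set.mem_ofPred_eq, hO]
  constructor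
  · rintro ⟨h1, h2⟩
    refine ⟨h1, fun c hc => ?_⟩
    have hdc : dg c = i := by
      obtain ⟨y, hy⟩ := hne
      have := (hc y hy).1
      rw [dg_mul, dg_inv, hy.1] at this; omega
    have hr := lf_mulr (Ol S) c
    rw [hdc] at hr
    have h3 : S ⊆ Ol S * {lc c} := by
      rw [← lf_sub (s := s) (hs := hs) (i := i) (zero_mulr _ (zero_Ol h0)), hr]
      exact hc
    simp only [lstar, Set.mem_iInter] at h2
    have h4 : g ∈ lf s hs i (Ol S * {lc c}) := ⟨h1, h2 _ h3⟩
    rw [hr] at h4; exact h4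
  · rintro ⟨h1, h2⟩
    refine ⟨h1, ?_⟩
    simp only [lstar, Set.mem_iInter]
    intro c hc
    by_cases hc0 : c = 0
    · exfalso
      obtain ⟨y, hy⟩ := hne
      have := hc hy.2
      rw [hc0, mulr_zero (zero_Ol h0)] at this
      exact lc_ne y this
    · have hr := lf_mulr (s := s) (hs := hs) (Ol S) (mkG s hs i c hc0)
      rw [dg_mk, lc_mk] at hr
      have h4 : g ∈ lf s hs i (Ol S * {c}) := by
        rw [hr]
        apply h2
        intro y hy
        have : y ∈ lf s hs i (Ol S * {c}) := (lf_sub (zero_mulr _ (zero_Ol h0))).2 hc hy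
        rw [hr] at this; exact this
      exact h4.2

/-- left `V`-stable with zero -/
def Stb (V : Subring K) (S : Set K) : Prop := (0 : K) ∈ S ∧ ∀ v ∈ V, ∀ x ∈ S, v * x ∈ S

lemma Stb.sub {V : Subring K} (hV : IsTVR V) {S : Set K} (h : Stb V S) :
    ∀ x ∈ S, ∀ y ∈ S, x - y ∈ S := by
  intro x hx y hy
  by_cases hx0 : x = 0
  · rw [hx0]
    have := h.2 (-1) (V.neg_mem V.one_mem) y hy
    simpa using this
  by_cases hy0 : y = 0
  · rw [hy0, sub_zero]; exact hx
  rcases hV (x * y⁻¹) (mul_ne_zero hx0 (inv_ne_zero hy0)) with h1 | h1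
  · have := h.2 _ (V.sub_mem h1 V.one_mem) y hy
    rwa [sub_mul, inv_mul_cancel_right₀ hy0, one_mul] at this
  · rw [mul_inv_rev, inv_inv] at h1
    have := h.2 _ (V.sub_mem V.one_mem h1) x hx
    rwa [sub_mul, inv_mul_cancel_right₀ hx0, one_mul] at this

lemma Stb.mul {V : Subring K} {S T : Set K} (h : Stb V S) (h0 : (0 : K) ∈ T) : Stb V (S * T) := by
  refine ⟨⟨0, h.1, 0, h0, by simp⟩, ?_⟩
  rintro v hv _ ⟨a, ha, b, hb, rfl⟩
  exact ⟨v * a, h.2 v hv a ha, b, hb, by simp [mul_assoc]⟩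

lemma Stb.aprod_eq {V : Subring K} (hV : IsTVR V) {S T : Set K} (h : Stb V S) (h0 : (0 : K) ∈ T) :
    aprod S T = S * T := by
  have h1 := h.mul h0
  have h2 := h1.sub hV
  refine Set.Subset.antisymm ?_ AddSubgroup.subset_closure
  let H : AddSubgroup K := AddSubgroup.ofSub (S * T) ⟨0, h1.1⟩ (fun x hx y hy => by
    simpa [sub_eq_add_neg] using h2 x hx y hy)
  exact (AddSubgroup.closure_le H).2 (fun x hx => hx)

end Tr
section Fin

/-- integer graded extension -/
structure ZS (V : Subring K) (s : ℤ → (K ≃+* K)) (hs : ∀ i j x, s (i + j) x = s i (s j x))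
    (B : ℤ → Set K) : Prop where
  tv : IsTVR V
  zero : ∀ i, (0 : K) ∈ B i
  B0 : B 0 = V
  mul : ∀ i j x y, x ∈ B i → y ∈ B j → x * s i y ∈ B (i + j)
  tot : ∀ i x, x ∉ B i → s (-i) x⁻¹ ∈ B (-i)

variable {V : Subring K} {s : ℤ → (K ≃+* K)} {hs : ∀ i j x, s (i + j) x = s i (s j x)}
  {B : ℤ → Set K}

/-- the cone -/
def PP (s : ℤ → (K ≃+* K)) (hs : ∀ i j x, s (i + j) x = s i (s j x)) (B : ℤ → Set K) :
    Set (HG s hs) := {g | lc g ∈ B (dg g)}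

lemma gP_PP (i : ℤ) : gP dg (PP s hs B) i = lf s hs i (B i) := by
  ext g
  constructor
  · rintro ⟨h1, h2⟩
    refine ⟨h2, ?_⟩
    rw [← h2]; exact h1
  · rintro ⟨h1, h2⟩
    refine ⟨?_, h1⟩
    show lc g ∈ B (dg g)
    rw [h1]; exact h2

lemma ZS.ge (h : ZS V s hs B) : GE dg (PP s hs B) where
  dm := dg_mul
  mul x y hx hy := h.mul _ _ _ _ hx hy
  tot x hx := by
    show lc x⁻¹ ∈ B (dg x⁻¹)
    rw [lc_inv, dg_inv]
    exact h.tot _ _ hx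

lemma ZS.stb (h : ZS V s hs B) (i : ℤ) : Stb V (B i) := by
  refine ⟨h.zero i, fun v hv x hx => ?_⟩
  have := h.mul 0 i v x (by rw [h.B0]; exact hv) hx
  rwa [s_zero hs, zero_add] at this

lemma ZS.eq_zero {i : ℤ} (h : ZS V s hs B) (hne : ¬ (gP dg (PP s hs B) i).Nonempty) :
    B i = {0} := by
  rw [gP_PP] at hne
  ext k
  constructor
  · intro hk
    by_contra hk0
    exact hne (lf_ne hk hk0)
  · rintro rfl; exact h.zero i

lemma ZS.OL (h : ZS V s hs B) {i : ℤ} (hne : (gP dg (PP s hs B) i).Nonempty) :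
    gOL (gP dg (PP s hs B) i) = lf s hs 0 (Ol (B i)) := by
  rw [gP_PP] at *; exact lf_Ol (h.zero i) hne

lemma ZS.eqR (h : ZS V s hs B) {i : ℤ} (hne : (gP dg (PP s hs B) i).Nonempty) (x : HG s hs)
    (hx : dg x = i) : B i = Ol (B i) * {lc x} ↔
      ∀ y, y ∈ gP dg (PP s hs B) i ↔ y * x⁻¹ ∈ gOL (gP dg (PP s hs B) i) := by
  rw [h.OL hne, gP_PP, ← lf_eq (s := s) (hs := hs) (i := i) (h.zero i)
    (zero_mulr _ (zero_Ol (h.zero i)))]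
  have := lf_mulr (Ol (B i)) x
  rw [hx] at this
  rw [this, Set.ext_iff]; rfl

lemma ZS.lfL (h : ZS V s hs B) {i : ℤ} (hne : (gP dg (PP s hs B) i).Nonempty) (x : HG s hs)
    (hx : dg x = i) : lf s hs i ({lc x} * (s i '' Ol (B i))) =
      {y | x⁻¹ * y ∈ gOL (gP dg (PP s hs B) i)} := by
  rw [h.OL hne]
  have := lf_mull (Ol (B i)) x
  rw [hx] at this
  rw [this]

lemma ZS.zL (h : ZS V s hs B) (i : ℤ) (a : K) (e : K ≃+* K) : (0 : K) ∈ {a} * (e '' Ol (B i)) :=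
  zero_mull _ _ (zero_Ol (h.zero i))

theorem ZS.tB (h : ZS V s hs B)
    (hyp : ∃ a, B 1 = Ol (B 1) * {a} ∧ {a} * (s 1 '' Ol (B 1)) ⊂ B 1) (n : ℕ) :
    ∃ a, B (n + 1 : ℕ) = Ol (B (n + 1 : ℕ)) * {a} ∧
      {a} * (s (n + 1 : ℕ) '' Ol (B (n + 1 : ℕ))) ⊂ B (n + 1 : ℕ) := by
  obtain ⟨a, ha1, ha2⟩ := hyp
  have hz := zero_Ol (h.zero 1)
  have ha0 : a ≠ 0 := by
    rintro rfl
    rw [mulr_zero hz] at ha1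
    refine ha2.2 ?_
    intro k hk
    rw [ha1] at hk
    rw [Set.mem_singleton_iff.1 hk]; exact h.zL 1 _ _
  obtain ⟨x, hx1, hxa⟩ : ∃ x : HG s hs, dg x = 1 ∧ lc x = a := ⟨mkG s hs 1 a ha0, rfl, rfl⟩
  have haB : a ∈ B 1 := by
    rw [ha1]; exact ⟨1, fun y hy => by simpa using hy, a, rfl, by simp⟩
  have hne : (gP dg (PP s hs B) 1).Nonempty := by rw [gP_PP]; exact lf_ne haB ha0
  rw [← hxa] at ha1 ha2
  rw [h.eqR hne x hx1] at ha1
  rw [← lf_ssub (s := s) (hs := hs) (i := 1) (h.zL 1 _ _) (h.zero 1), h.lfL hne x hx1, ← gP_PP] at ha2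
  have hc : ∀ w ∈ gOL (gP dg (PP s hs B) 1), x * w * x⁻¹ ∈ gOL (gP dg (PP s hs B) 1) := by
    intro w hw
    rw [← ha1]
    apply ha2.1
    simpa using hw
  obtain ⟨y, hy1, hy2⟩ := Set.exists_of_ssubset ha2
  have hs' : ∃ w ∈ gOL (gP dg (PP s hs B) 1), x⁻¹ * w * x ∉ gOL (gP dg (PP s hs B) 1) :=
    ⟨y * x⁻¹, (ha1 y).1 hy1, fun h3 => hy2 (by simpa [mul_assoc] using h3)⟩
  obtain ⟨k1, k2, w, hw, hw'⟩ := coreB h.ge rfl ha1 hc hs' n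
  have hdx : dg (x ^ (n + 1)) = (n + 1 : ℕ) := by rw [h.ge.dp, hx1, mul_one]
  have hne' : (gP dg (PP s hs B) (n + 1 : ℕ)).Nonempty :=
    ⟨x ^ (n + 1), (k1 _).2 (by simpa using gOL_one _)⟩
  refine ⟨lc (x ^ (n + 1)), ?_, ?_⟩
  · rw [h.eqR hne' _ hdx, k2]; exact k1
  · rw [← lf_ssub (s := s) (hs := hs) (i := (n + 1 : ℕ)) (h.zL _ _ _) (h.zero _),
      h.lfL hne' _ hdx, ← gP_PP, k2]
    refine ⟨fun y hy => ?_, fun h3 => ?_⟩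
    · rw [k1]
      have := conj_iter hc (n + 1) _ hy
      simpa using this
    · apply hw'
      have := h3 ((k1 (w * x ^ (n + 1))).2 (by simpa using hw))
      simpa [mul_assoc] using this

theorem ZS.tC (h : ZS V s hs B)
    (hyp : ∃ a, B 1 = Ol (B 1) * {a} ∧ B 1 ⊂ {a} * (s 1 '' Ol (B 1))) (n : ℕ) :
    ∃ a, B (n + 1 : ℕ) = Ol (B (n + 1 : ℕ)) * {a} ∧
      B (n + 1 : ℕ) ⊂ {a} * (s (n + 1 : ℕ) '' Ol (B (n + 1 : ℕ))) := by
  obtain ⟨a, ha1, ha2⟩ := hyp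
  have hz := zero_Ol (h.zero 1)
  have ha0 : a ≠ 0 := by
    rintro rfl
    refine ha2.2 ?_
    rintro _ ⟨b, hb, c, -, rfl⟩
    rw [Set.mem_singleton_iff.1 hb]
    simpa using h.zero 1
  obtain ⟨x, hx1, hxa⟩ : ∃ x : HG s hs, dg x = 1 ∧ lc x = a := ⟨mkG s hs 1 a ha0, rfl, rfl⟩
  have haB : a ∈ B 1 := by
    rw [ha1]; exact ⟨1, fun y hy => by simpa using hy, a, rfl, by simp⟩
  have hne : (gP dg (PP s hs B) 1).Nonempty := by rw [gP_PP]; exact lf_ne haB ha0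
  rw [← hxa] at ha1 ha2
  rw [h.eqR hne x hx1] at ha1
  rw [← lf_ssub (s := s) (hs := hs) (i := 1) (h.zero 1) (h.zL 1 _ _), h.lfL hne x hx1, ← gP_PP] at ha2
  have hc : ∀ w ∈ gOL (gP dg (PP s hs B) 1), x⁻¹ * w * x ∈ gOL (gP dg (PP s hs B) 1) := by
    intro w hw
    have := ha2.1 ((ha1 (w * x)).2 (by simpa using hw))
    simpa [mul_assoc] using this
  obtain ⟨y, hy1, hy2⟩ := Set.exists_of_ssubset ha2
  have hs' : ∃ w ∈ gOL (gP dg (PP s hs B) 1), x * w * x⁻¹ ∉ gOL (gP dg (PP s hs B) 1) :=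
    ⟨x⁻¹ * y, hy1, fun h3 => hy2 ((ha1 y).2 (by simpa [mul_assoc] using h3))⟩
  obtain ⟨k1, k2, w, hw, hw'⟩ := coreC h.ge rfl ha1 hc hs' n
  have hdx : dg (x ^ (n + 1)) = (n + 1 : ℕ) := by rw [h.ge.dp, hx1, mul_one]
  have hne' : (gP dg (PP s hs B) (n + 1 : ℕ)).Nonempty :=
    ⟨x ^ (n + 1), (k1 _).2 (by simpa using gOL_one _)⟩
  refine ⟨lc (x ^ (n + 1)), ?_, ?_⟩
  · rw [h.eqR hne' _ hdx]; exact k1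
  · rw [← lf_ssub (s := s) (hs := hs) (i := (n + 1 : ℕ)) (h.zero _) (h.zL _ _ _),
      h.lfL hne' _ hdx, ← gP_PP]
    exact ⟨fun y hy => k2 y hy, fun h3 => hw (h3 hw')⟩

lemma zero_jac {W : Set K} (h0 : (0 : K) ∈ W) : (0 : K) ∈ jacS W := ⟨h0, Or.inl rfl⟩

lemma ZS.stbJ (h : ZS V s hs B) (i : ℤ) : Stb V (jacS (Ol (B i))) := by
  have hVO : ∀ v ∈ V, v ∈ Ol (B i) := fun v hv x hx => (h.stb i).2 v hv x hx
  have hm : ∀ a ∈ Ol (B i), ∀ b ∈ Ol (B i), a * b ∈ Ol (B i) := fun a ha b hb x hx => by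
    rw [mul_assoc]; exact ha _ (hb _ hx)
  refine ⟨zero_jac (zero_Ol (h.zero i)), fun v hv x hx => ?_⟩
  refine ⟨hm _ (hVO v hv) _ hx.1, ?_⟩
  by_cases h0 : v * x = 0
  · exact Or.inl h0
  · right
    intro h1
    have hv0 : v ≠ 0 := left_ne_zero_of_mul h0
    have hx0 : x ≠ 0 := right_ne_zero_of_mul h0
    rcases hx.2 with h2 | h2
    · exact hx0 h2
    · apply h2
      have := hm _ h1 _ (hVO v hv)
      rwa [mul_inv_rev, inv_mul_cancel_right₀ hv0] at this

lemma ZS.JJ (h : ZS V s hs B) {i : ℤ} (hne : (gP dg (PP s hs B) i).Nonempty) :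
    aprod (jacS (Ol (B i))) (jacS (Ol (B i))) = jacS (Ol (B i)) ↔
      gJ (gOL (gP dg (PP s hs B) i)) * gJ (gOL (gP dg (PP s hs B) i)) =
        gJ (gOL (gP dg (PP s hs B) i)) := by
  have hJ := h.stbJ i
  rw [hJ.aprod_eq h.tv hJ.1, ← lf_eq (s := s) (hs := hs) (i := 0) (hJ.mul hJ.1).1 hJ.1]
  have h1 : (s 0 '' jacS (Ol (B i))) = jacS (Ol (B i)) := by
    ext k
    simp [s_zero hs]
  have h2 := lf_mul (s := s) (hs := hs) 0 0 (jacS (Ol (B i))) (jacS (Ol (B i)))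
  rw [h1, add_zero] at h2
  rw [h2, lf_jac, ← h.OL hne]

lemma gJ_sub {G : Type*} [Group G] {W : Set G} (hm : ∀ a ∈ W, ∀ b ∈ W, a * b ∈ W) :
    gJ W * gJ W ⊆ gJ W := by
  rintro _ ⟨a, ha, b, hb, rfl⟩
  refine ⟨hm _ ha.1 _ hb.1, fun h => ha.2 ?_⟩
  have := hm _ hb.1 _ h
  simpa using this

theorem ZS.tD (h : ZS V s hs B)
    (hyp : ∃ a, B 1 = Ol (B 1) * {a} ∧ B 1 = {a} * (s 1 '' Ol (B 1)) ∧
      B (-1) = jacS (Ol (B 1)) * {s (-1) a⁻¹} ∧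
      aprod (jacS (Ol (B 1))) (jacS (Ol (B 1))) = jacS (Ol (B 1))) (n : ℕ) :
    ∃ a, B (n + 1 : ℕ) = Ol (B (n + 1 : ℕ)) * {a} ∧
      B (n + 1 : ℕ) = {a} * (s (n + 1 : ℕ) '' Ol (B (n + 1 : ℕ))) ∧
      B (-(n + 1 : ℕ)) = jacS (Ol (B (n + 1 : ℕ))) * {s (-(n + 1 : ℕ)) a⁻¹} ∧
      aprod (jacS (Ol (B (n + 1 : ℕ)))) (jacS (Ol (B (n + 1 : ℕ)))) = jacS (Ol (B (n + 1 : ℕ))) := by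
  obtain ⟨a, ha1, ha2, ha3, ha4⟩ := hyp
  have hz := zero_Ol (h.zero 1)
  have ha0 : a ≠ 0 := by
    rintro rfl
    have h1 : (1 : K) ∉ B 1 := by
      rw [ha1, mulr_zero hz]; simp
    have h2 := h.tot _ _ h1
    rw [ha3, inv_zero, map_zero, mulr_zero (zero_jac hz)] at h2
    simp at h2
  obtain ⟨x, hx1, hxa⟩ : ∃ x : HG s hs, dg x = 1 ∧ lc x = a := ⟨mkG s hs 1 a ha0, rfl, rfl⟩
  have haB : a ∈ B 1 := by
    rw [ha1]; exact ⟨1, fun y hy => by simpa using hy, a, rfl, by simp⟩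
  have hne : (gP dg (PP s hs B) 1).Nonempty := by rw [gP_PP]; exact lf_ne haB ha0
  rw [← hxa] at ha1 ha2 ha3
  rw [h.eqR hne x hx1] at ha1
  rw [← lf_eq (s := s) (hs := hs) (i := 1) (h.zero 1) (h.zL 1 _ _), h.lfL hne x hx1, ← gP_PP] at ha2
  have neg : ∀ (i : ℤ) (y : HG s hs), dg y = i → (gP dg (PP s hs B) i).Nonempty →
      (B (-i) = jacS (Ol (B i)) * {s (-i) (lc y)⁻¹} ↔
      ∀ z, z ∈ gP dg (PP s hs B) (-i) ↔ z * y ∈ gJ (gOL (gP dg (PP s hs B) i))) := by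
    intro i y hy hi
    have h1 := lf_mulr (s := s) (hs := hs) (jacS (Ol (B i))) y⁻¹
    rw [dg_inv, lc_inv, hy, lf_jac, ← h.OL hi, inv_inv] at h1
    rw [← lf_eq (s := s) (hs := hs) (i := -i) (h.zero (-i))
      (zero_mulr _ (zero_jac (zero_Ol (h.zero i)))), h1, ← gP_PP, Set.ext_iff]; rfl
  rw [neg 1 x hx1 hne] at ha3
  rw [h.JJ hne] at ha4
  obtain ⟨k1, k2, k3, k4⟩ := coreD h.ge rfl ha1 (fun y => by rw [Set.ext_iff] at ha2; exact ha2 y) ha3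
    (fun t ht => by
      rw [← ha4] at ht
      obtain ⟨a, ha, b, hb, hab⟩ := ht
      exact ⟨a, ha, b, hb, hab.symm⟩) n
  have hdx : dg (x ^ (n + 1)) = (n + 1 : ℕ) := by rw [h.ge.dp, hx1, mul_one]
  have hne' : (gP dg (PP s hs B) (n + 1 : ℕ)).Nonempty :=
    ⟨x ^ (n + 1), (k1 _).2 (by simpa using gOL_one _)⟩
  refine ⟨lc (x ^ (n + 1)), ?_, ?_, ?_, ?_⟩
  · rw [h.eqR hne' _ hdx, k2]; exact k1
  · rw [← lf_eq (s := s) (hs := hs) (i := (n + 1 : ℕ)) (h.zero _) (h.zL _ _ _),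
      h.lfL hne' _ hdx, ← gP_PP, k2, Set.ext_iff]
    exact k3
  · rw [neg _ _ hdx hne', k2]; exact k4
  · rw [h.JJ hne', k2]; exact ha4

theorem ZS.tA (h : ZS V s hs B)
    (hyp : ∃ a, B 1 = V * {a} ∧ B 1 = {a} * (s 1 '' V) ∧ B (-1) = V * {s (-1) a⁻¹}) (n : ℕ) :
    ∃ a, B n = V * {a} ∧ B n = {a} * (s n '' V) ∧ B (-n) = V * {s (-n) a⁻¹} := by
  obtain ⟨a, ha1, ha2, ha3⟩ := hyp
  have hz : (0 : K) ∈ (V : Set K) := V.zero_mem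
  have ha0 : a ≠ 0 := by
    rintro rfl
    have h1 : (1 : K) ∉ B 1 := by
      rw [ha1, mulr_zero hz]; simp
    have h2 := h.tot _ _ h1
    rw [ha3, inv_zero, map_zero, mulr_zero hz] at h2
    simp at h2
  obtain ⟨x, hx1, hxa⟩ : ∃ x : HG s hs, dg x = 1 ∧ lc x = a := ⟨mkG s hs 1 a ha0, rfl, rfl⟩
  have hxP : x ∈ PP s hs B := by
    show lc x ∈ B (dg x)
    rw [hx1, hxa, ha1]; exact ⟨1, V.one_mem, a, rfl, by simp⟩
  have hxi : x⁻¹ ∈ PP s hs B := by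
    show lc x⁻¹ ∈ B (dg x⁻¹)
    rw [dg_inv, lc_inv, hx1, hxa, ha3]; exact ⟨1, V.one_mem, _, rfl, by simp⟩
  have hge := h.ge
  have hdx : dg (x ^ n) = n := by rw [hge.dp, hx1, mul_one]
  have hp := hge.pw hxP n
  have hpi : (x ^ n)⁻¹ ∈ PP s hs B := by rw [← inv_pow]; exact hge.pw hxi n
  have h0 : lf s hs 0 (V : Set K) = gP dg (PP s hs B) 0 := by rw [gP_PP, h.B0]
  refine ⟨lc (x ^ n), ?_, ?_, ?_⟩
  · have h1 := lf_mulr (s := s) (hs := hs) (V : Set K) (x ^ n)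
    rw [hdx, h0] at h1
    rw [← lf_eq (s := s) (hs := hs) (i := n) (h.zero _) (zero_mulr _ hz), h1, ← gP_PP]
    ext y
    constructor
    · rintro ⟨h2, h3⟩
      exact ⟨hge.mul _ _ h2 hpi, by rw [dg_mul, dg_inv, h3, hdx]; ring⟩
    · rintro ⟨h2, h3⟩
      rw [dg_mul, dg_inv, hdx] at h3
      exact ⟨by simpa using hge.mul _ _ h2 hp, by omega⟩
  · have h1 := lf_mull (s := s) (hs := hs) (V : Set K) (x ^ n)
    rw [hdx, h0] at h1
    rw [← lf_eq (s := s) (hs := hs) (i := n) (h.zero _) (zero_mull _ _ hz), h1, ← gP_PP]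
    ext y
    constructor
    · rintro ⟨h2, h3⟩
      exact ⟨hge.mul _ _ hpi h2, by rw [dg_mul, dg_inv, h3, hdx]; ring⟩
    · rintro ⟨h2, h3⟩
      rw [dg_mul, dg_inv, hdx] at h3
      exact ⟨by simpa using hge.mul _ _ hp h2, by omega⟩
  · have h1 := lf_mulr (s := s) (hs := hs) (V : Set K) (x ^ n)⁻¹
    rw [dg_inv, lc_inv, hdx, h0, inv_inv] at h1
    rw [← lf_eq (s := s) (hs := hs) (i := -n) (h.zero _) (zero_mulr _ hz), h1, ← gP_PP]
    ext y
    constructor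
    · rintro ⟨h2, h3⟩
      exact ⟨hge.mul _ _ h2 hp, by rw [dg_mul, h3, hdx]; ring⟩
    · rintro ⟨h2, h3⟩
      rw [dg_mul, hdx] at h3
      exact ⟨by simpa using hge.mul _ _ h2 hpi, by omega⟩

lemma lstar_zero : lstar ({0} : Set K) = {0} := by
  refine Set.Subset.antisymm ?_ (sub_lstar _)
  intro k hk
  simp only [lstar, Set.mem_iInter] at hk
  have h0 : (0 : K) ∈ Ol ({0} : Set K) := zero_Ol rfl
  have := hk 0 (by
    show ({0} : Set K) ⊆ Ol ({0} : Set K) * {(0:K)}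
    rw [mulr_zero h0])
  rwa [mulr_zero h0] at this

lemma ZS.ne (h : ZS V s hs B) (h1 : (gP dg (PP s hs B) 1).Nonempty) (n : ℕ) :
    (gP dg (PP s hs B) n).Nonempty := by
  obtain ⟨x, hx⟩ := h1
  exact ⟨x ^ n, h.ge.pw hx.1 n, by rw [h.ge.dp, hx.2, mul_one]⟩

theorem ZS.tF (h : ZS V s hs B) (hyp : B 1 ⊂ lstar (B 1)) (n : ℕ) :
    B (n + 1 : ℕ) ⊂ lstar (B (n + 1 : ℕ)) := by
  have hne : (gP dg (PP s hs B) 1).Nonempty := by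
    by_contra hne
    rw [h.eq_zero hne, lstar_zero] at hyp
    exact hyp.2 (fun _ h => h)
  have hne' := h.ne hne (n + 1)
  have h1 := coreF h.ge hne
  rw [← lf_ssub (s := s) (hs := hs) (i := (n + 1 : ℕ)) (h.zero _) (zero_lstar (h.zero _)),
    lf_lstar (h.zero _) (by rw [← gP_PP]; exact hne'), ← gP_PP]
  rw [← lf_ssub (s := s) (hs := hs) (i := 1) (h.zero _) (zero_lstar (h.zero _)),
    lf_lstar (h.zero _) (by rw [← gP_PP]; exact hne), ← gP_PP] at hyp
  exact h1 hyp n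

theorem ZS.tG (h : ZS V s hs B) (M : ℕ → ℕ → Set K)
    (hM1 : ∀ n, M n 1 = B n)
    (hM2 : ∀ n i : ℕ, M n (i + 2) = aprod (M n (i + 1)) (s (((n * (i + 1) : ℕ)) : ℤ) '' B n))
    (hyp : lstar (B 1) = B 1 ∧ ∀ i : ℕ, 0 < i → ¬ ∃ c : K, lstar (M 1 i) = Ol (B 1) * {c})
    (n : ℕ) (hn : 0 < n) :
    lstar (B n) = B n ∧ ∀ i : ℕ, 0 < i → ¬ ∃ c : K, lstar (M n i) = Ol (B n) * {c} := by
  obtain ⟨hy1, hy2⟩ := hyp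
  have hne : (gP dg (PP s hs B) 1).Nonempty := by
    by_contra hne
    apply hy2 1 one_pos
    refine ⟨0, ?_⟩
    rw [hM1, Nat.cast_one, hy1, mulr_zero (zero_Ol (h.zero _)), h.eq_zero hne]
  have hMM : ∀ n i : ℕ, Stb V (M n (i + 1)) ∧
      lf s hs (n * (i + 1) : ℕ) (M n (i + 1)) = (gP dg (PP s hs B) n) ^ (i + 1) := by
    intro n i
    induction i with
    | zero => rw [hM1]; exact ⟨h.stb _, by rw [gP_PP]; simp⟩
    | succ i ih =>
      have h0 : (0 : K) ∈ s (((n * (i + 1) : ℕ)) : ℤ) '' B n := ⟨0, h.zero _, by simp⟩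
      rw [hM2, ih.1.aprod_eq h.tv h0]
      refine ⟨ih.1.mul h0, ?_⟩
      have h1 := lf_mul (s := s) (hs := hs) ((n * (i + 1) : ℕ)) n (M n (i + 1)) (B n)
      rw [ih.2, ← gP_PP, ← pow_succ] at h1
      rw [← h1]
      congr 1
  have hst : ∀ n i : ℕ, 0 < i → lf s hs (n * i : ℕ) (lstar (M n i)) =
      gLST dg (n * i : ℕ) ((gP dg (PP s hs B) n) ^ i) := by
    intro n i hi
    obtain ⟨k, rfl⟩ := Nat.exists_eq_succ_of_ne_zero hi.ne'
    obtain ⟨h1, h2⟩ := hMM n k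
    have h3 : (lf s hs (n * (k + 1) : ℕ) (M n (k + 1))).Nonempty := by
      rw [h2]; exact (h.ne hne n).pow
    have := lf_lstar h1.1 h3
    rw [h2] at this
    exact this
  have hsz : ∀ n i : ℕ, 0 < i → (0 : K) ∈ lstar (M n i) := by
    intro n i hi
    obtain ⟨k, rfl⟩ := Nat.exists_eq_succ_of_ne_zero hi.ne'
    exact zero_lstar (hMM n k).1.1
  have hnp : ∀ n i : ℕ, 0 < i → ((∃ c : K, lstar (M n i) = Ol (B n) * {c}) ↔
      ∃ c, ∀ y, y ∈ gLST dg (n * i : ℕ) ((gP dg (PP s hs B) n) ^ i) ↔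
        y * c⁻¹ ∈ gOL (gP dg (PP s hs B) n)) := by
    intro n i hi
    have hnn := h.ne hne n
    obtain ⟨m, hm⟩ : ((gP dg (PP s hs B) n) ^ i).Nonempty := hnn.pow
    have hml : m ∈ gLST dg (n * i : ℕ) ((gP dg (PP s hs B) n) ^ i) := by
      obtain ⟨k, rfl⟩ := Nat.exists_eq_succ_of_ne_zero hi.ne'
      refine gsub_LST _ _ (fun y hy => ?_) hm
      rw [Nat.succ_eq_add_one, ← (hMM n k).2] at hy
      exact hy.1
    have hx : ∀ x : HG s hs, dg x = (n * i : ℕ) → (lstar (M n i) = Ol (B n) * {lc x} ↔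
      ∀ y, y ∈ gLST dg (n * i : ℕ) ((gP dg (PP s hs B) n) ^ i) ↔
        y * x⁻¹ ∈ gOL (gP dg (PP s hs B) n)) := by
      intro x hx
      have h1 := lf_mulr (Ol (B n)) x
      rw [hx] at h1
      rw [← lf_eq (s := s) (hs := hs) (i := (n * i : ℕ)) (hsz n i hi)
        (zero_mulr _ (zero_Ol (h.zero _))), hst n i hi, h1, ← h.OL hnn, Set.ext_iff]
      rfl
    constructor
    · rintro ⟨c, hc⟩
      have hc0 : c ≠ 0 := by
        rintro rfl
        rw [mulr_zero (zero_Ol (h.zero _))] at hc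
        rw [← hst n i hi] at hml
        have := hml.2
        rw [hc] at this
        exact lc_ne m this
      exact ⟨mkG s hs (n * i : ℕ) c hc0, (hx _ rfl).1 hc⟩
    · rintro ⟨c, hc⟩
      refine ⟨lc c, (hx c ?_).2 hc⟩
      have h1 := (hc m).1 hml
      rw [h.OL hnn] at h1
      have h2 := h1.1
      rw [dg_mul, dg_inv, hml.1] at h2
      omega
  have hl : ∀ n : ℕ, lstar (B n) = B n ↔
      gLST dg n (gP dg (PP s hs B) n) = gP dg (PP s hs B) n := by
    intro n
    have hnn := h.ne hne n
    rw [← lf_eq (s := s) (hs := hs) (i := n) (zero_lstar (h.zero _)) (h.zero _),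
      lf_lstar (h.zero _) (by rw [← gP_PP]; exact hnn), ← gP_PP]
  have hy1' := (hl 1).1 (by simpa using hy1)
  have hG := coreG h.ge hne (by simpa using hy1') (fun i hi hc => hy2 i hi (by
    have := hnp 1 i hi
    rw [one_mul, Nat.cast_one] at this
    exact this.2 hc)) n hn
  refine ⟨(hl n).2 hG.1, fun i hi hc => hG.2 i hi ((hnp n i hi).1 hc)⟩

end Fin

/-- If `H_r` is of Type (a) (resp. (b), (c), (d), (f), (g)), then `H_{nr}` is of the same type
for every positive integer `n`. -/
theorem stmt3 (V : Subring K) (hV : IsTVR V) (hVK : (V : Set K) ≠ Set.univ)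
    (σ : ℚ → (K ≃+* K)) (hσ : ∀ r s : ℚ, σ (r + s) = (σ r).trans (σ s))
    (A : ℚ → Set K) (hA : IsGradedExtQ (V : Set K) σ A)
    (r : ℚ) (hr : 0 < r) :
    (HrTypeA (V : Set K) σ A r → ∀ n : ℕ, 0 < n → HrTypeA (V : Set K) σ A ((n : ℚ) * r)) ∧
    (HrTypeB σ A r → ∀ n : ℕ, 0 < n → HrTypeB σ A ((n : ℚ) * r)) ∧
    (HrTypeC σ A r → ∀ n : ℕ, 0 < n → HrTypeC σ A ((n : ℚ) * r)) ∧
    (HrTypeD σ A r → ∀ n : ℕ, 0 < n → HrTypeD σ A ((n : ℚ) * r)) ∧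
    (HrTypeF A r → ∀ n : ℕ, 0 < n → HrTypeF A ((n : ℚ) * r)) ∧
    (HrTypeG (V : Set K) σ A r → ∀ n : ℕ, 0 < n → HrTypeG (V : Set K) σ A ((n : ℚ) * r)) := by
  obtain ⟨hA1, hA2, hA3, hA4⟩ := hA
  let s : ℤ → (K ≃+* K) := fun i => σ ((i : ℚ) * r)
  let B : ℤ → Set K := fun i => A ((i : ℚ) * r)
  have hs : ∀ i j x, s (i + j) x = s i (s j x) := by
    intro i j x
    show σ (((i + j : ℤ) : ℚ) * r) x = _
    rw [show ((i + j : ℤ) : ℚ) * r = (j : ℚ) * r + (i : ℚ) * r by push_cast; ring, hσ]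
    rfl
  have h : ZS V s hs B := by
    refine ⟨hV, fun i => (hA1 _ trivial).1, ?_, ?_, ?_⟩
    · show A (((0 : ℤ) : ℚ) * r) = V
      rw [Int.cast_zero, zero_mul, hA2]
    · intro i j x y hx hy
      have h1 := hA4 ((i : ℚ) * r) trivial ((j : ℚ) * r) trivial
        (AddSubgroup.subset_closure ⟨x, hx, _, ⟨y, hy, rfl⟩, rfl⟩)
      show _ ∈ A (((i + j : ℤ) : ℚ) * r)
      rw [show ((i + j : ℤ) : ℚ) * r = (i : ℚ) * r + (j : ℚ) * r by push_cast; ring]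
      exact h1
    · intro i x hx
      have h1 : x ∈ A ((i : ℚ) * r) ∪ (σ ((i : ℚ) * r) '' invS (A (-((i : ℚ) * r)))) := by
        rw [hA3 _ trivial]; trivial
      rcases h1 with h1 | ⟨_, ⟨c, hc, -, rfl⟩, h2⟩
      · exact absurd h1 hx
      · have h2 : s i c⁻¹ = x := h2
        rw [← h2, ← map_inv₀, inv_inv, s_neg' hs]
        show c ∈ A (((-i : ℤ) : ℚ) * r)
        rw [Int.cast_neg, neg_mul]; exact hc
  have eB : ∀ n : ℕ, B n = A ((n : ℚ) * r) := fun n => by simp [B]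
  have es : ∀ n : ℕ, s n = σ ((n : ℚ) * r) := fun n => by simp [s]
  have eB' : ∀ n : ℕ, B (-n) = A (-((n : ℚ) * r)) := fun n => by simp [B]
  have es' : ∀ n : ℕ, s (-n) = σ (-((n : ℚ) * r)) := fun n => by simp [s]
  have eB1 : B 1 = A r := by simp [B]
  have es1 : s 1 = σ r := by simp [s]
  have eB1' : B (-1) = A (-r) := by simp [B]
  have es1' : s (-1) = σ (-r) := by simp [s]
  refine ⟨?_, ?_, ?_, ?_, ?_, ?_⟩
  · intro hyp n hn
    unfold HrTypeA at *
    rw [← eB1, ← es1, ← eB1', ← es1'] at hyp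
    rw [← eB, ← es, ← eB', ← es']
    exact h.tA hyp n
  · intro hyp n hn
    obtain ⟨n, rfl⟩ := Nat.exists_eq_succ_of_ne_zero hn.ne'
    unfold HrTypeB at *
    rw [← eB1, ← es1] at hyp
    rw [← eB, ← es]
    exact h.tB hyp n
  · intro hyp n hn
    obtain ⟨n, rfl⟩ := Nat.exists_eq_succ_of_ne_zero hn.ne'
    unfold HrTypeC at *
    rw [← eB1, ← es1] at hyp
    rw [← eB, ← es]
    exact h.tC hyp n
  · intro hyp n hn
    obtain ⟨n, rfl⟩ := Nat.exists_eq_succ_of_ne_zero hn.ne'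
    unfold HrTypeD at *
    rw [← eB1, ← es1, ← eB1', ← es1'] at hyp
    rw [← eB, ← es, ← eB', ← es']
    exact h.tD hyp n
  · intro hyp n hn
    obtain ⟨n, rfl⟩ := Nat.exists_eq_succ_of_ne_zero hn.ne'
    unfold HrTypeF at *
    rw [← eB1] at hyp
    rw [← eB]
    exact h.tF hyp n
  · intro hyp n hn
    unfold HrTypeG at *
    have := h.tG (fun n i => Mir (V : Set K) σ A ((n : ℚ) * r) i) (fun n => (eB n).symm)
      (fun n i => by
        show Mir (V : Set K) σ A ((n : ℚ) * r) (i + 2) = _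
        rw [Mir, es, eB]
        congr 4
        push_cast; ring) (by
        simp only [Nat.cast_one, one_mul]
        rw [eB1]; exact hyp) n hn
    rw [eB] at this
    exact this
end

section
/- Let (A_r)_{r∈ℚ} be a graded extension of V in K[ℚ,σ] and let s ∈ ℚ with s > 0. If H_s is of Type (II), then O_l(A_{is}) ⊆ O_l(A_s) = O_l(A_{-s}) for every integer i. -/
open scoped Pointwise

variable {K : Type*} [DivisionRing K]

section abstr
variable {G : Type*} [Group G]

def LL (d : G → ℤ) (S : Set G) (n : ℤ) : Set G :=
  {u | d u = 0 ∧ ∀ x ∈ S, d x = n → u * x ∈ S}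

def Failing (d : G → ℤ) (S : Set G) (i j : ℕ) (c : G) : Prop :=
  0 < i ∧ 0 < j ∧ c ∈ S ∧ d c = (i : ℤ) + j ∧ ∀ b ∈ S, d b = i → b⁻¹ * c ∉ S

theorem LL_dual (d : G → ℤ) (hd : ∀ x y, d (x * y) = d x + d y) (hdi : ∀ x, d x⁻¹ = - d x)
    (S : Set G) (hm : ∀ x ∈ S, ∀ y ∈ S, x * y ∈ S) (ht : ∀ x, x ∈ S ∨ x⁻¹ ∈ S) (n : ℤ) (u : G) :
    u ∈ LL d S n ↔ (d u = 0 ∧ ∀ x ∈ S, d x = -n → x * u ∈ S) := by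
  constructor
  · rintro ⟨h0, h⟩
    refine ⟨h0, fun y hy hdy => ?_⟩
    rcases ht (y * u) with h1 | h1
    · exact h1
    · have h2 := h _ h1 (by rw [hdi, hd]; omega)
      have h3 : y⁻¹ ∈ S := by simpa [mul_assoc] using h2
      have h4 := h _ h3 (by rw [hdi]; omega)
      have h5 := hm _ hy _ (hm _ h4 _ hy)
      simpa [mul_assoc] using h5
  · rintro ⟨h0, h⟩
    refine ⟨h0, fun y hy hdy => ?_⟩
    rcases ht (u * y) with h1 | h1
    · exact h1
    · have h2 := h _ h1 (by rw [hdi, hd]; omega)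
      have h3 : y⁻¹ ∈ S := by simpa [mul_assoc] using h2
      have h4 := h _ h3 (by rw [hdi]; omega)
      have h5 := hm _ (hm _ hy _ h4) _ hy
      simpa [mul_assoc] using h5

theorem abs_main (d : G → ℤ) (hd : ∀ x y, d (x * y) = d x + d y)
    (S : Set G) (hm : ∀ x ∈ S, ∀ y ∈ S, x * y ∈ S) (ht : ∀ x, x ∈ S ∨ x⁻¹ ∈ S)
    (hF : ∃ i j c, Failing d S i j c) :
    (∀ n, LL d S n ⊆ LL d S 1) ∧ LL d S 1 = LL d S (-1) := by
  classical
  have hd1 : d 1 = 0 := by have := hd 1 1; simp at this; exact this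
  have hdi : ∀ x, d x⁻¹ = - d x := by
    intro x; have := hd x x⁻¹; rw [mul_inv_cancel, hd1] at this; omega
  have hdual := LL_dual d hd hdi S hm ht
  have hone : (1 : G) ∈ S := by rcases ht 1 with h | h <;> simpa using h
  have hP : ∃ k : ℕ, ∃ i j c, i + j = k ∧ Failing d S i j c := by
    obtain ⟨i, j, c, h⟩ := hF; exact ⟨_, i, j, c, rfl, h⟩
  obtain ⟨i, j, c, hij, hi, hj, hc, hdc, hfail⟩ := Nat.find_spec hP
  have hmin := fun m => @Nat.find_min _ _ hP m
  generalize Nat.find hP = k at hij hmin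
  have hfac : ∀ (a b : ℤ) (x : G), 0 < a → 0 < b → a + b < k → x ∈ S → d x = a + b →
      ∃ y ∈ S, ∃ z ∈ S, d y = a ∧ d z = b ∧ y * z = x := by
    intro a b x ha hb hab hx hdx
    lift a to ℕ using ha.le
    lift b to ℕ using hb.le
    by_contra hcon
    refine hmin (a + b) (by omega) ⟨a, b, x, rfl, by omega, by omega, hx, hdx, ?_⟩
    intro y hy hdy hz
    exact hcon ⟨y, hy, _, hz, hdy, by rw [hd, hdi]; omega, by group⟩
  have hdk : d c = k := by omega
  have hk2 : 2 ≤ k := by omega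
  -- no factorization (1,k-1) or (k-1,1)
  have hnf1 : ∀ b ∈ S, d b = 1 → b⁻¹ * c ∉ S := by
    intro b hb hdb h
    by_cases hi1 : i = 1
    · exact hfail b hb (by omega) h
    obtain ⟨y, hy, z, hz, hdy, hdz, hyz⟩ := hfac (i - 1) j (b⁻¹ * c) (by omega) (by omega)
      (by omega) h (by rw [hd, hdi]; omega)
    refine hfail (b * y) (hm _ hb _ hy) (by rw [hd]; omega) ?_
    have : (b * y)⁻¹ * c = z := by rw [mul_inv_rev, mul_assoc, ← hyz]; group
    rwa [this]
  have hnf2 : ∀ b ∈ S, d b = k - 1 → b⁻¹ * c ∉ S := by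
    intro b hb hdb h
    by_cases hj1 : j = 1
    · exact hfail b hb (by omega) h
    obtain ⟨y, hy, z, hz, hdy, hdz, hyz⟩ := hfac i (j - 1) b (by omega) (by omega)
      (by omega) hb (by omega)
    refine hfail y hy hdy ?_
    have : y⁻¹ * c = z * (b⁻¹ * c) := by rw [← hyz]; group
    rw [this]; exact hm _ hz _ h
  have ha1 : ∀ b ∈ S, d b = 1 → c⁻¹ * b ∈ S := by
    intro b hb hdb
    rcases ht (c⁻¹ * b) with h | h
    · exact h
    · exact absurd (by simpa using h) (hnf1 b hb hdb)
  have hb1 : ∀ b ∈ S, d b = k - 1 → c⁻¹ * b ∈ S := by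
    intro b hb hdb
    rcases ht (c⁻¹ * b) with h | h
    · exact h
    · exact absurd (by simpa using h) (hnf2 b hb hdb)
  have ha2 : ∀ b ∈ S, d b = 1 → b * c⁻¹ ∈ S := by
    intro b hb hdb
    rcases ht (b * c⁻¹) with h | h
    · exact h
    · exact absurd (by simpa using hb) (hnf2 _ h (by rw [hdi, hd, hdi]; omega))
  have hb2 : ∀ b ∈ S, d b = k - 1 → b * c⁻¹ ∈ S := by
    intro b hb hdb
    rcases ht (b * c⁻¹) with h | h
    · exact h
    · exact absurd (by simpa using hb) (hnf1 _ h (by rw [hdi, hd, hdi]; omega))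
  have hmono : ∀ a : ℤ, 0 < a → a < k → LL d S a ⊆ LL d S (k - 1) := by
    rintro a ha hak u ⟨hu0, hu⟩
    refine ⟨hu0, fun x hx hdx => ?_⟩
    by_cases hak1 : a = k - 1
    · exact hu x hx (by omega)
    obtain ⟨y, hy, z, hz, hdy, hdz, rfl⟩ := hfac a (k - 1 - a) x ha (by omega) (by omega) hx
      (by omega)
    rw [← mul_assoc]; exact hm _ (hu y hy hdy) _ hz
  have e1 : LL d S (k - 1) ⊆ LL d S (-1) := by
    rintro u ⟨hu0, hu⟩
    refine ⟨hu0, fun y hy hdy => ?_⟩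
    have h1 := hu _ (hm _ hy _ hc) (by rw [hd]; omega)
    have h2 := hb2 _ h1 (by rw [hd, hd]; omega)
    simpa [mul_assoc] using h2
  have e2 : LL d S (-1) ⊆ LL d S (1 - k) := by
    intro u hu
    rw [hdual] at hu ⊢
    obtain ⟨hu0, hu⟩ := hu
    refine ⟨hu0, fun x hx hdx => ?_⟩
    by_cases hk : k = 2
    · exact hu x hx (by omega)
    obtain ⟨y, hy, z, hz, hdy, hdz, rfl⟩ := hfac (k - 2) 1 x (by omega) (by omega) (by omega) hx
      (by omega)
    rw [mul_assoc]; exact hm _ hy _ (hu z hz (by omega))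
  have e3 : LL d S (1 - k) ⊆ LL d S 1 := by
    rintro u ⟨hu0, hu⟩
    refine ⟨hu0, fun y hy hdy => ?_⟩
    have h1 := hu _ (ha2 _ hy hdy) (by rw [hd, hdi]; omega)
    have h2 := hm _ h1 _ hc
    simpa [mul_assoc] using h2
  have e4 : LL d S 1 ⊆ LL d S (k - 1) := hmono 1 (by omega) (by omega)
  have E1 : LL d S 1 = LL d S (-1) :=
    Set.Subset.antisymm (e4.trans e1) (e2.trans e3)
  have E2 : LL d S (k - 1) = LL d S 1 :=
    Set.Subset.antisymm (e1.trans E1.symm.subset) e4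
  refine ⟨?_, E1⟩
  have hcj : ∀ w ∈ LL d S 1, c * w * c⁻¹ ∈ LL d S 1 := by
    intro w hw
    rw [E1] at hw
    rw [← E2]
    obtain ⟨hw0, hw⟩ := hw
    refine ⟨by rw [hd, hd, hdi]; omega, fun x hx hdx => ?_⟩
    have h1 := hw _ (hb1 x hx hdx) (by rw [hd, hdi]; omega)
    have h2 := hm _ hc _ h1
    simpa [mul_assoc] using h2
  have hcj' : ∀ w ∈ LL d S 1, c⁻¹ * w * c ∈ LL d S 1 := by
    intro w hw
    rw [← E2] at hw
    rw [E1]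
    obtain ⟨hw0, hw⟩ := hw
    refine ⟨by rw [hd, hd, hdi]; omega, fun x hx hdx => ?_⟩
    have h1 := hw _ (hm _ hc x hx) (by rw [hd]; omega)
    have h2 := hb1 _ h1 (by rw [hd, hd]; omega)
    simpa [mul_assoc] using h2
  have hBk : ∀ x ∈ S, d x = k → x * c⁻¹ ∈ LL d S 1 := by
    intro x hx hdx
    have : c⁻¹ * x ∈ LL d S 1 := by
      rw [E1]
      refine ⟨by rw [hd, hdi]; omega, fun y hy hdy => ?_⟩
      have h2 := hb1 _ (hm _ hx _ hy) (by rw [hd]; omega)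
      simpa [mul_assoc] using h2
    simpa [mul_assoc] using hcj _ this
  have hJ : ∀ u, d u = 0 → u ∉ LL d S 1 → c⁻¹ * u⁻¹ ∈ S := by
    intro u hu0 hu
    rcases ht (c⁻¹ * u⁻¹) with h | h
    · exact h
    · exact absurd (by simpa using hBk _ h (by rw [hdi, hd, hdi, hdi]; omega)) hu
  have hdown : ∀ n : ℤ, (∃ u ∈ LL d S n, u ∉ LL d S 1) → ∃ u ∈ LL d S (n - k), u ∉ LL d S 1 := by
    rintro n ⟨u, ⟨hu0, hu⟩, hu1⟩
    refine ⟨c⁻¹ * u * c, ⟨by rw [hd, hd, hdi]; omega, fun z hz hdz => ?_⟩, fun h => hu1 ?_⟩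
    · have h1 := hu _ (hm _ hc _ hz) (by rw [hd]; omega)
      have h2 := hu _ h1 (by rw [hd, hd]; omega)
      have h3 := hm _ (hJ u hu0 hu1) _ h2
      simpa [mul_assoc] using h3
    · simpa [mul_assoc] using hcj _ h
  have hup : ∀ n : ℤ, (∃ u ∈ LL d S n, u ∉ LL d S 1) → ∃ u ∈ LL d S (n + k), u ∉ LL d S 1 := by
    rintro n ⟨u, ⟨hu0, hu⟩, hu1⟩
    have hu' : c * u * c⁻¹ ∉ LL d S 1 := fun h => hu1 (by simpa [mul_assoc] using hcj' _ h)
    have hd' : d (c * u * c⁻¹) = 0 := by rw [hd, hd, hdi]; omega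
    refine ⟨c * u * c⁻¹, ⟨hd', fun z hz hdz => ?_⟩, hu'⟩
    have h1 := hm _ (hJ _ hd' hu') _ hz
    have dh1 : d (c⁻¹ * (c * u * c⁻¹)⁻¹ * z) = n := by rw [hd, hd, hdi, hdi]; omega
    have h2 := hu _ h1 dh1
    have h3 := hu _ h2 (by rw [hd]; omega)
    have h4 := hm _ hc _ h3
    simpa [mul_assoc] using h4
  have hall : ∀ (m n : ℤ), (∃ u ∈ LL d S n, u ∉ LL d S 1) →
      ∃ u ∈ LL d S (n + m * k), u ∉ LL d S 1 := by
    intro m n h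
    induction m using Int.induction_on with
    | zero => simpa using h
    | succ m ih =>
      have := hup _ ih
      rwa [show n + (m : ℤ) * k + k = n + ((m : ℤ) + 1) * k by ring] at this
    | pred m ih =>
      have := hdown _ ih
      rwa [show n + -(m : ℤ) * k - k = n + (-(m : ℤ) - 1) * k by ring] at this
  intro n u hu
  by_contra hu1
  obtain ⟨v, hv, hv1⟩ := hall (-(n / k)) n ⟨u, hu, hu1⟩
  have hmod : n + -(n / k) * k = n % k := by
    have := Int.emod_add_mul_ediv n k; linarith
  rw [hmod] at hv
  have hk0 : (0 : ℤ) < k := by omega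
  have l1 := Int.emod_nonneg n hk0.ne'
  have l2 := Int.emod_lt_of_pos n hk0
  rcases l1.eq_or_lt with h0 | h0
  · rw [← h0] at hv
    have hvS : v ∈ S := by simpa using hv.2 1 hone hd1
    exact hv1 ⟨hv.1, fun x hx _ => hm _ hvS _ hx⟩
  · exact hv1 (E2 ▸ hmono _ h0 l2 hv)

end abstr

def phiS (σ : ℚ → (K ≃+* K)) (hσ : ∀ r s : ℚ, σ (r + s) = (σ r).trans (σ s)) (s : ℚ) :
    Multiplicative ℤ →* MulAut Kˣ where
  toFun n := Units.mapEquiv (σ ((n.toAdd : ℚ) * s)).toMulEquiv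
  map_one' := by
    ext x
    have h := hσ 0 0
    have h2 : σ 0 (σ 0 x) = σ 0 x := by
      conv_rhs => rw [← add_zero (0 : ℚ), h]
      rfl
    simpa using (σ 0).injective h2
  map_mul' m n := by
    ext x
    have h := hσ ((n.toAdd : ℚ) * s) ((m.toAdd : ℚ) * s)
    have : (((m * n).toAdd : ℤ) : ℚ) * s = (n.toAdd : ℚ) * s + (m.toAdd : ℚ) * s := by
      rw [toAdd_mul]; push_cast; ring
    simp only [this, h]
    simp

/-- If `H_s` is of Type (II), then `O_l(A_{is}) ⊆ O_l(A_s) = O_l(A_{-s})` for every `i ∈ ℤ`. -/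
theorem stmt6 (V : Subring K) (hV : IsTVR V) (hVK : (V : Set K) ≠ Set.univ)
    (σ : ℚ → (K ≃+* K)) (hσ : ∀ r s : ℚ, σ (r + s) = (σ r).trans (σ s))
    (A : ℚ → Set K) (hA : IsGradedExtQ (V : Set K) σ A)
    (s : ℚ) (hs : 0 < s) (hII : ¬ HrTypeI σ A s) :
    (∀ i : ℤ, Ol (A ((i : ℚ) * s)) ⊆ Ol (A s)) ∧ Ol (A s) = Ol (A (-s)) := by
  obtain ⟨hgrp, hA0, htot, hmul⟩ := hA
  have hs00 : ∀ x, σ 0 x = x := by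
    intro x
    have h2 : σ 0 (σ 0 x) = σ 0 x := by
      conv_rhs => rw [← add_zero (0 : ℚ), hσ 0 0]
      rfl
    exact (σ 0).injective h2
  have hneg : ∀ r x, σ (-r) (σ r x) = x := by
    intro r x
    have := hσ r (-r)
    rw [add_neg_cancel] at this
    rw [← RingEquiv.trans_apply, ← this, hs00]
  have hmul' : ∀ r t x y, x ∈ A r → y ∈ A t → x * σ r y ∈ A (r + t) := by
    intro r t x y hx hy
    exact hmul r trivial t trivial
      (AddSubgroup.subset_closure (Set.mul_mem_mul hx ⟨y, hy, rfl⟩))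
  let G := Kˣ ⋊[phiS σ hσ s] Multiplicative ℤ
  let d : G → ℤ := fun g => g.right.toAdd
  let S : Set G := {g | (g.left : K) ∈ A ((d g : ℚ) * s)}
  have hd : ∀ x y : G, d (x * y) = d x + d y := fun x y => rfl
  have hleft : ∀ x y : G, ((x * y).left : K) = x.left * σ ((d x : ℚ) * s) y.left :=
    fun x y => rfl
  have hm : ∀ x ∈ S, ∀ y ∈ S, x * y ∈ S := by
    intro x hx y hy
    change ((x * y).left : K) ∈ A ((d (x * y) : ℚ) * s)
    rw [hleft, hd, Int.cast_add, add_mul]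
    exact hmul' _ _ _ _ hx hy
  have hinv : ∀ x : G, ((x⁻¹).left : K) = σ (-((d x : ℚ) * s)) (x.left : K)⁻¹ := by
    intro x
    have h1 : ((x⁻¹).left : K) = σ (((-(d x) : ℤ) : ℚ) * s) ((x.left⁻¹ : Kˣ) : K) := rfl
    rw [h1, Units.val_inv_eq_inv_val]
    push_cast
    rw [neg_mul]
  have hdi : ∀ x : G, d x⁻¹ = - d x := fun x => rfl
  have ht : ∀ x : G, x ∈ S ∨ x⁻¹ ∈ S := by
    intro x
    have h := htot ((d x : ℚ) * s) trivial
    have hx : (x.left : K) ∈ A ((d x : ℚ) * s) ∪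
      (σ ((d x : ℚ) * s) '' invS (A (-((d x : ℚ) * s)))) := by rw [h]; trivial
    rcases hx with hx | ⟨y, ⟨z, hz, hz0, rfl⟩, hy⟩
    · exact Or.inl hx
    · right
      change ((x⁻¹).left : K) ∈ A ((d x⁻¹ : ℚ) * s)
      rw [hinv, hdi, ← hy, map_inv₀, map_inv₀, map_inv₀, hneg, inv_inv]
      push_cast
      rwa [neg_mul]
  have hOl : ∀ (n : ℤ) (u : Kˣ), (u : K) ∈ Ol (A ((n : ℚ) * s)) ↔
      (⟨u, 1⟩ : G) ∈ LL d S n := by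
    intro n u
    have key : ∀ x : G, ((((⟨u, 1⟩ : G) * x).left : Kˣ) : K) = u * x.left := by
      intro x
      rw [hleft]
      have : d (⟨u, 1⟩ : G) = 0 := rfl
      rw [this, Int.cast_zero, zero_mul, hs00]
    have key2 : ∀ x : G, d ((⟨u, 1⟩ : G) * x) = d x := by
      intro x
      rw [hd]
      exact zero_add _
    constructor
    · intro h
      refine ⟨rfl, fun x hx hdx => ?_⟩
      change (((⟨u, 1⟩ : G) * x).left : K) ∈ A ((d ((⟨u, 1⟩ : G) * x) : ℚ) * s)
      rw [key, key2, hdx]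
      refine h _ ?_
      rw [← hdx]; exact hx
    · rintro ⟨-, h⟩ x hx
      by_cases hx0 : x = 0
      · rw [hx0, mul_zero, ← hx0]; exact hx
      have h1 := h (⟨Units.mk0 x hx0, Multiplicative.ofAdd n⟩ : G) hx rfl
      change ((((⟨u, 1⟩ : G) * (⟨Units.mk0 x hx0, Multiplicative.ofAdd n⟩ : G)).left : Kˣ) : K) ∈
        A ((d ((⟨u, 1⟩ : G) * (⟨Units.mk0 x hx0, Multiplicative.ofAdd n⟩ : G)) : ℚ) * s) at h1
      rw [key, key2] at h1
      exact h1
  have hfin : (∀ n : ℤ, LL d S n ⊆ LL d S 1) ∧ LL d S 1 = LL d S (-1) := by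
    have hE : ∀ i j : ℤ,
        aprod (A ((i : ℚ) * s)) (σ ((i : ℚ) * s) '' A ((j : ℚ) * s)) ≠
          A (((i + j : ℤ) : ℚ) * s) →
        ∃ c ∈ S, d c = i + j ∧ ∀ b ∈ S, d b = i → b⁻¹ * c ∉ S := by
      intro i j hne
      have hsub : aprod (A ((i : ℚ) * s)) (σ ((i : ℚ) * s) '' A ((j : ℚ) * s)) ⊆
          A (((i + j : ℤ) : ℚ) * s) := by
        rw [Int.cast_add, add_mul]; exact hmul _ trivial _ trivial
      have : ∃ c ∈ A (((i + j : ℤ) : ℚ) * s),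
          c ∉ aprod (A ((i : ℚ) * s)) (σ ((i : ℚ) * s) '' A ((j : ℚ) * s)) := by
        by_contra hcon
        push Not at hcon
        exact hne (Set.Subset.antisymm hsub hcon)
      obtain ⟨c, hc, hcn⟩ := this
      have hc0 : c ≠ 0 := by
        rintro rfl
        exact hcn (AddSubgroup.zero_mem _)
      refine ⟨(⟨Units.mk0 c hc0, Multiplicative.ofAdd (i + j)⟩ : G), hc, rfl, ?_⟩
      intro b hb hdb hbc
      apply hcn
      set g : G := ⟨Units.mk0 c hc0, Multiplicative.ofAdd (i + j)⟩ with hg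
      have hdj : d (b⁻¹ * g) = j := by
        have : d g = i + j := rfl
        rw [hd, hdi, hdb, this]; ring
      have h1 : c = b.left * σ ((d b : ℚ) * s) (b⁻¹ * g).left := by
        rw [← hleft, mul_inv_cancel_left]; rfl
      have hb' : (b.left : K) ∈ A ((d b : ℚ) * s) := hb
      have hbc' : ((b⁻¹ * g).left : K) ∈ A ((d (b⁻¹ * g) : ℚ) * s) := hbc
      rw [hdb] at h1 hb'
      rw [hdj] at hbc'
      rw [h1]
      exact AddSubgroup.subset_closure (Set.mul_mem_mul hb' ⟨_, hbc', rfl⟩)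
    unfold HrTypeI at hII
    push Not at hII
    obtain ⟨i, j, hi, hj, hne⟩ := hII
    lift i to ℕ using hi.le
    lift j to ℕ using hj.le
    by_cases hpos : aprod (A (((i : ℤ) : ℚ) * s))
        (σ (((i : ℤ) : ℚ) * s) '' A (((j : ℤ) : ℚ) * s)) = A ((((i : ℤ) + (j : ℤ) : ℤ) : ℚ) * s)
    · have hn := hne hpos
      obtain ⟨c, hc, hdc, hcf⟩ := hE (-(i : ℤ)) (-(j : ℤ)) (by
        intro h
        apply hn
        have e : (((-(i : ℤ) + -(j : ℤ) : ℤ)) : ℚ) = -(((i : ℤ) + (j : ℤ) : ℤ) : ℚ) := by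
          push_cast; ring
        rw [e, Int.cast_neg, Int.cast_neg] at h
        simpa only [neg_mul] using h)
      have hres := abs_main (fun g => - d g) (fun x y => by rw [hd]; ring) S hm ht
        ⟨i, j, c, by omega, by omega, hc, by simp only [hdc]; ring,
          fun b hb hdb => hcf b hb (by simp only at hdb; omega)⟩
      have hLL : ∀ n, LL (fun g => - d g) S n = LL d S (-n) := by
        intro n
        ext u
        simp only [LL, Set.mem_ofPred_eq, neg_eq_iff_eq_neg, neg_zero]
      simp only [hLL, neg_neg] at hres
      refine ⟨fun n => ?_, hres.2.symm⟩
      have := hres.1 (-n)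
      rw [neg_neg, hres.2] at this
      exact this
    · obtain ⟨c, hc, hdc, hcf⟩ := hE i j hpos
      exact abs_main d hd S hm ht ⟨i, j, c, by omega, by omega, hc, hdc, hcf⟩
  have hz : ∀ r, (0 : K) ∈ Ol (A r) := by
    intro r x _
    rw [zero_mul]; exact (hgrp r trivial).1
  have htr : ∀ m n : ℤ, LL d S m ⊆ LL d S n → Ol (A ((m : ℚ) * s)) ⊆ Ol (A ((n : ℚ) * s)) := by
    intro m n h u hu
    by_cases hu0 : u = 0
    · rw [hu0]; exact hz _
    exact (hOl n (Units.mk0 u hu0)).2 (h ((hOl m (Units.mk0 u hu0)).1 hu))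
  have e1 : ((1 : ℤ) : ℚ) * s = s := by simp
  have e2 : ((-1 : ℤ) : ℚ) * s = -s := by simp
  refine ⟨fun i => ?_, Set.Subset.antisymm ?_ ?_⟩
  · have := htr i 1 (hfin.1 i)
    rwa [e1] at this
  · have := htr 1 (-1) hfin.2.subset
    rwa [e1, e2] at this
  · have := htr (-1) 1 hfin.2.symm.subset
    rwa [e1, e2] at this
end

section
/- Let (A_r)_{r∈ℚ} be a graded extension of V in K[ℚ,σ] of Type (e), and assume there exists t ∈ ℚ with O_l(A_t) = W. Then there exists a positive integer l such that H_{1/l} is a graded extension of V in K[X^{1/l}, X^{-1/l}; σ(1/l)] of Type (e) with O_l(A_{1/l}) = W. -/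
open scoped Pointwise

variable {K : Type*} [DivisionRing K]

structure Ctx {G : Type*} [Group G] (d : G → ℚ) (P W : Set G) (p : G) : Prop where
  d_mul : ∀ g h, d (g * h) = d g + d h
  P_mul : ∀ g ∈ P, ∀ h ∈ P, g * h ∈ P
  P_tot : ∀ g, g ∈ P ∨ g⁻¹ ∈ P
  W_deg : ∀ w ∈ W, d w = 0
  W_mul : ∀ g ∈ W, ∀ h ∈ W, g * h ∈ W
  PW : ∀ g ∈ P, d g = 0 → g ∈ W
  stab : ∀ s w, d w = 0 → (∀ g ∈ P, d g = s → w * g ∈ P) → w ∈ W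
  pW : p ∈ W
  pinv : p⁻¹ ∉ W
  hp : ∀ j ∈ W, j⁻¹ ∉ W → p⁻¹ * j ∈ W

namespace Ctx

variable {G : Type*} [Group G] {d : G → ℚ} {P W : Set G} {p : G}

theorem d_one (C : Ctx d P W p) : d 1 = 0 := by
  have := C.d_mul 1 1
  simp at this; exact this

theorem d_inv (C : Ctx d P W p) (g : G) : d g⁻¹ = - d g := by
  have := C.d_mul g g⁻¹
  rw [mul_inv_cancel, C.d_one] at this; linarith

theorem P_one (C : Ctx d P W p) : (1 : G) ∈ P := by
  rcases C.P_tot 1 with h | h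
  · exact h
  · simpa using h

theorem W_tot (C : Ctx d P W p) (w : G) (h : d w = 0) (hn : w ∉ W) : w⁻¹ ∈ W := by
  rcases C.P_tot w with h1 | h1
  · exact absurd (C.PW _ h1 h) hn
  · exact C.PW _ h1 (by rw [C.d_inv, h]; simp)

theorem W_one (C : Ctx d P W p) : (1 : G) ∈ W := C.PW _ C.P_one C.d_one

theorem J_P (C : Ctx d P W p) (j : G) (h : j ∈ W) (hn : j⁻¹ ∉ W) : j ∈ P := by
  rcases C.P_tot j with h1 | h1
  · exact h1
  · exact absurd (C.PW _ h1 (by rw [C.d_inv, C.W_deg _ h]; simp)) hn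

theorem J_l (C : Ctx d P W p) (w j : G) (hw : w ∈ W) (hn : j⁻¹ ∉ W) :
    (w * j)⁻¹ ∉ W := fun h => hn (by simpa using C.W_mul _ h _ hw)

theorem J_r (C : Ctx d P W p) (w j : G) (hw : w ∈ W) (hn : j⁻¹ ∉ W) :
    (j * w)⁻¹ ∉ W := fun h => hn (by simpa using C.W_mul _ hw _ h)

theorem hp' (C : Ctx d P W p) (j : G) (h : j ∈ W) (hn : j⁻¹ ∉ W) : j * p⁻¹ ∈ W := by
  by_contra hc
  have d1 : d (j * p⁻¹) = 0 := by rw [C.d_mul, C.d_inv, C.W_deg _ h, C.W_deg _ C.pW]; simp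
  have h1 := C.W_tot _ d1 hc
  have h2 := C.hp _ h1 (by simpa using hc)
  have h3 : j⁻¹ ∈ W := by simpa using h2
  exact hn h3

/-- stability of `P_t` under `W` -/
def Full (d : G → ℚ) (P W : Set G) (t : ℚ) : Prop :=
  ∀ w ∈ W, ∀ g ∈ P, d g = t → w * g ∈ P

def NoU (d : G → ℚ) (P : Set G) (t : ℚ) : Prop := ∀ u, d u = t → u ∈ P → u⁻¹ ∉ P

theorem gen (C : Ctx d P W p) {t : ℚ} (ht : Full d P W t) :
    ∃ a ∈ P, d a = t ∧ ∀ g ∈ P, d g = t → g * a⁻¹ ∈ W := by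
  have dp := C.W_deg _ C.pW
  have : ∃ a ∈ P, d a = t ∧ p⁻¹ * a ∉ P := by
    by_contra! hc
    exact C.pinv (C.stab t _ (by rw [C.d_inv, dp]; simp) hc)
  obtain ⟨a, ha, da, hpa⟩ := this
  refine ⟨a, ha, da, fun g hg dg => ?_⟩
  by_contra hn
  have h1 := C.W_tot (g * a⁻¹) (by rw [C.d_mul, C.d_inv, dg, da]; ring) hn
  have h2 := C.hp _ h1 (by simpa using hn)
  have h3 := ht _ h2 g hg dg
  apply hpa
  simpa [mul_assoc] using h3

theorem comp (C : Ctx d P W p) (x : G) (hx : ∀ j ∈ W, j⁻¹ ∉ W → x * j * x⁻¹ ∈ W) :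
    (∀ w ∈ W, x * w * x⁻¹ ∈ W) ∨ (∀ w ∈ W, x⁻¹ * w * x ∈ W) := by
  by_contra! hc
  obtain ⟨⟨g, hg, hgn⟩, ⟨h, hh, hhn⟩⟩ := hc
  have dh : d (x⁻¹ * h * x) = 0 := by
    rw [C.d_mul, C.d_mul, C.d_inv, C.W_deg _ hh]; ring
  have h1 := C.W_tot _ dh hhn
  have h2 := hx ((x⁻¹ * h * x)⁻¹ * g) (C.W_mul _ h1 _ hg)
    (C.J_r _ _ hg (by simpa using hhn))
  have h3 := C.W_mul _ hh _ h2
  apply hgn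
  simpa [mul_assoc] using h3

theorem struct (C : Ctx d P W p) {t : ℚ} (ht : Full d P W t) (hu : NoU d P t) :
    ∃ a ∈ P, d a = t ∧ (∀ g, d g = t → (g ∈ P ↔ g * a⁻¹ ∈ W)) ∧
      (∀ g, d g = -t → (g ∈ P ↔ (a * g ∈ W ∧ (a * g)⁻¹ ∉ W))) ∧
      (∀ w ∈ W, a * w * a⁻¹ ∈ W) ∧ (∀ w ∈ W, a⁻¹ * w * a ∈ W) := by
  obtain ⟨a, ha, da, hg⟩ := C.gen ht
  have A1 : ∀ g, d g = t → (g ∈ P ↔ g * a⁻¹ ∈ W) := fun g dg =>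
    ⟨fun h => hg g h dg, fun h => by simpa using ht _ h a ha da⟩
  have A2 : ∀ g, d g = -t → (g ∈ P ↔ (a * g ∈ W ∧ (a * g)⁻¹ ∉ W)) := by
    intro g dg
    have dgi : d g⁻¹ = t := by rw [C.d_inv, dg]; simp
    have key : g⁻¹ ∈ P ↔ (a * g)⁻¹ ∈ W := by rw [A1 _ dgi]; simp
    have dag : d (a * g) = 0 := by rw [C.d_mul, da, dg]; ring
    constructor
    · intro h
      have : g⁻¹ ∉ P := fun h' => hu _ dgi h' (by simpa using h)
      rw [key] at this
      refine ⟨?_, this⟩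
      by_contra hc
      exact this (C.W_tot _ dag hc)
    · rintro ⟨_, h⟩
      rw [← key] at h
      exact (C.P_tot g).resolve_right h
  have dc : ∀ w ∈ W, d (a⁻¹ * w * a) = 0 := fun w hw => by
    rw [C.d_mul, C.d_mul, C.d_inv, C.W_deg _ hw]; ring
  have dc' : ∀ w ∈ W, d (a * w * a⁻¹) = 0 := fun w hw => by
    rw [C.d_mul, C.d_mul, C.d_inv, C.W_deg _ hw]; ring
  refine ⟨a, ha, da, A1, A2, ?_⟩
  have hc := C.comp a (fun j hj hjn => hg _ (C.P_mul _ ha _ (C.J_P j hj hjn))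
    (by rw [C.d_mul, da, C.W_deg _ hj]; simp))
  rcases hc with hc | hc
  · refine ⟨hc, fun w hw => C.stab (-t) _ (dc w hw) fun g hg dg => ?_⟩
    have h1 := (A2 g dg).1 hg
    rw [A2 _ (by rw [C.d_mul, dc w hw, dg]; simp)]
    have e : a * (a⁻¹ * w * a * g) = w * (a * g) := by group
    rw [e]
    exact ⟨C.W_mul _ hw _ h1.1, C.J_l _ _ hw h1.2⟩
  · refine ⟨fun h hh => ?_, hc⟩
    by_contra hn
    have hj := C.W_tot _ (dc' h hh) hn
    apply hn
    refine C.stab (t + t) _ (dc' h hh) fun z hz dz => ?_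
    set j := (a * h * a⁻¹)⁻¹ with hjdef
    have hj1 : a⁻¹ * j ∈ P := by
      rw [A2 _ (by rw [C.d_mul, C.d_inv, da, C.W_deg _ hj]; simp)]
      simp only [mul_inv_cancel_left]
      exact ⟨hj, by simpa [hjdef] using hn⟩
    have h2 := C.P_mul _ hj1 _ hz
    have d2 : d (a⁻¹ * j * z) = t := by
      rw [C.d_mul, C.d_mul, C.d_inv, da, C.W_deg _ hj, dz]; ring
    rw [A1 _ d2] at h2
    have h3 := ht _ (C.W_mul _ (C.W_mul _ hh _ hh) _ h2) a ha da
    have h4 := C.P_mul _ ha _ h3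
    have e : a * (h * h * (a⁻¹ * j * z * a⁻¹) * a) = a * h * a⁻¹ * z := by
      rw [hjdef]; group
    rwa [e] at h4

theorem full_neg (C : Ctx d P W p) {t : ℚ} (ht : Full d P W t) (hu : NoU d P t) :
    Full d P W (-t) := by
  obtain ⟨a, ha, da, A1, A2, h1, h2⟩ := C.struct ht hu
  intro w hw g hg dg
  have h3 := (A2 g dg).1 hg
  rw [A2 _ (by rw [C.d_mul, C.W_deg _ hw, dg]; simp)]
  have e : a * (w * g) = (a * w * a⁻¹) * (a * g) := by group
  rw [e]
  exact ⟨C.W_mul _ (h1 w hw) _ h3.1, C.J_l _ _ (h1 w hw) h3.2⟩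

theorem gen' (C : Ctx d P W p) {t : ℚ} (ht : Full d P W t) (s : ℚ) :
    ∃ x ∈ P, d x = s ∧ ∀ g ∈ P, d g = s → g * x⁻¹ ∈ W := by
  obtain ⟨a, ha, da, hg⟩ := C.gen ht
  have dp := C.W_deg _ C.pW
  by_cases H : ∃ x ∈ P, d x = s ∧ ∀ y ∈ P, d y = s → p⁻¹ * (x * y⁻¹) ∉ W
  · obtain ⟨x, hx, dx, hxy⟩ := H
    refine ⟨x, hx, dx, fun g hg dg => ?_⟩
    by_contra hn
    have h1 := C.W_tot (g * x⁻¹) (by rw [C.d_mul, C.d_inv, dg, dx]; ring) hn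
    have h2 := C.hp _ h1 (by simpa using hn)
    exact hxy g hg dg (by simpa using h2)
  · exfalso
    push Not at H
    apply C.pinv
    refine C.stab s _ (by rw [C.d_inv, dp]; simp) fun y hy dy => ?_
    by_cases hz : y⁻¹ * (p * a) ∈ P
    · exfalso
      obtain ⟨y1, hy1, dy1, h1⟩ := H y hy dy
      obtain ⟨y2, hy2, dy2, h2⟩ := H y1 hy1 dy1
      have h3 := C.P_mul _ hy2 _ hz
      have h4 := hg _ h3 (by
        rw [C.d_mul, C.d_mul, C.d_mul, C.d_inv, dy2, dy, dp, da]; ring)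
      -- p⁻¹ = ... 
      have h5 := C.W_mul _ (C.W_mul _ h2 _ h4) _ C.W_one
      -- (p⁻¹ y y1⁻¹) p (p⁻¹ y1 y2⁻¹) (y2 y⁻¹ p a a⁻¹) = 1
      have h6 := C.W_mul _ h1 _ C.pW
      have h7 := C.J_l _ _ h1 C.pinv
      have h8 := C.J_r _ _ h5 h7
      apply h8
      have e : p⁻¹ * (y * y1⁻¹) * p * (p⁻¹ * (y1 * y2⁻¹) * (y2 * (y⁻¹ * (p * a)) * a⁻¹) * 1) = 1 := by
        group
      rw [e]; simpa using C.W_one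
    · have h1 := (C.P_tot _).resolve_left hz
      have h2 := C.P_mul _ ha _ h1
      have e : a * (y⁻¹ * (p * a))⁻¹ = p⁻¹ * y := by group
      rwa [e] at h2

theorem d_pow (C : Ctx d P W p) (g : G) (n : ℕ) : d (g ^ n) = n * d g := by
  induction n with
  | zero => simp [C.d_one]
  | succ k ih => rw [pow_succ, C.d_mul, ih]; push_cast; ring

theorem P_pow (C : Ctx d P W p) (g : G) (hg : g ∈ P) (n : ℕ) : g ^ n ∈ P := by
  induction n with
  | zero => simpa using C.P_one
  | succ k ih => rw [pow_succ]; exact C.P_mul _ ih _ hg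

theorem full_root (C : Ctx d P W p) {s t : ℚ} (n : ℕ) (hn : n * s = t)
    (ht : Full d P W t) (hu : NoU d P t) : Full d P W s := by
  obtain ⟨a, ha, da, A1, A2, h1, h2⟩ := C.struct ht hu
  obtain ⟨x, hx, dx, hgx⟩ := C.gen' ht s
  have key : ∀ u ∈ W, u * x ∈ P := by
    by_contra! hc
    obtain ⟨u, hu, hux⟩ := hc
    have hi := (C.P_tot _).resolve_left hux
    have hxn : x ^ n * a⁻¹ ∈ W :=
      (A1 _ (by rw [C.d_pow, dx, hn])).1 (C.P_pow _ hx n)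
    have hin := C.P_pow _ hi n
    rw [inv_pow] at hin
    have dux : d (u * x) = s := by rw [C.d_mul, C.W_deg _ hu, dx]; simp
    have hin2 := (A2 _ (by rw [C.d_inv, C.d_pow, dux, hn])).1 hin
    have hcmp := C.comp x (fun j hj hjn => hgx _ (C.P_mul _ hx _ (C.J_P j hj hjn))
      (by rw [C.d_mul, dx, C.W_deg _ hj]; simp))
    have hW : (u * x) ^ n * a⁻¹ ∈ W := by
      rcases hcmp with hcmp | hcmp
      · have : ∀ m : ℕ, (u * x) ^ m * (x ^ m)⁻¹ ∈ W := by
          intro m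
          induction m with
          | zero => simpa using C.W_one
          | succ k ih =>
            have e : (u * x) ^ (k + 1) * (x ^ (k + 1))⁻¹ =
              u * (x * ((u * x) ^ k * (x ^ k)⁻¹) * x⁻¹) := by
              rw [pow_succ' (u * x), pow_succ' x]; group
            rw [e]
            exact C.W_mul _ hu _ (hcmp _ ih)
        have := C.W_mul _ (this n) _ hxn
        simpa [mul_assoc] using this
      · have : ∀ m : ℕ, (x ^ m)⁻¹ * (u * x) ^ m ∈ W := by
          intro m
          induction m with
          | zero => simpa using C.W_one
          | succ k ih =>
            have e : (x ^ (k + 1))⁻¹ * (u * x) ^ (k + 1) =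
              (x⁻¹ * (((x ^ k)⁻¹ * (u * x) ^ k) * u) * x) := by
              rw [pow_succ (u * x), pow_succ x]; group
            rw [e]
            exact hcmp _ (C.W_mul _ ih _ hu)
        have h5 := C.W_mul _ hxn _ (h1 _ (this n))
        have e : x ^ n * a⁻¹ * (a * ((x ^ n)⁻¹ * (u * x) ^ n) * a⁻¹) = (u * x) ^ n * a⁻¹ := by
          group
        rwa [e] at h5
    exact hin2.2 (by simpa using hW)
  intro w hw g hg dg
  have := key _ (C.W_mul _ hw _ (hgx g hg dg))
  simpa [mul_assoc] using this

theorem exists_l (C : Ctx d P W p) {t : ℚ} (ht : Full d P W t)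
    (hII : ¬ ∀ s u x, x ∈ P → d x = s + u → ∃ y ∈ P, ∃ z ∈ P, d y = s ∧ d z = u ∧ x = y * z) :
    ∃ l : ℕ, 0 < l ∧ Full d P W (1 / (l : ℚ)) ∧ NoU d P (1 / (l : ℚ)) := by
  by_cases hWP : ∀ w ∈ W, w ∈ P
  · have hF : ∀ s, Full d P W s := fun s w hw g hg _ => C.P_mul _ (hWP w hw) _ hg
    by_contra! hc
    apply hII
    intro s u x hx dx
    have : ∃ v, d v = s ∧ v ∈ P ∧ v⁻¹ ∈ P := by
      have h1 := hc s.den s.den_pos (hF _)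
      unfold NoU at h1
      push Not at h1
      obtain ⟨v, dv, hv, hv'⟩ := h1
      have hs : s = s.num * (1 / (s.den : ℚ)) := by
        rw [mul_one_div]; exact (Rat.num_div_den s).symm
      rcases Int.eq_nat_or_neg s.num with ⟨n, hn | hn⟩
      · refine ⟨v ^ n, ?_, C.P_pow _ hv n, ?_⟩
        · rw [C.d_pow, dv]; rw [hn] at hs; push_cast at hs; exact hs.symm
        · rw [← inv_pow]; exact C.P_pow _ hv' n
      · refine ⟨v⁻¹ ^ n, ?_, C.P_pow _ hv' n, ?_⟩
        · rw [C.d_pow, C.d_inv, dv]; rw [hn] at hs; push_cast at hs; linarith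
        · rw [← inv_pow, inv_inv]; exact C.P_pow _ hv n
    obtain ⟨v, dv, hv, hv'⟩ := this
    exact ⟨v, hv, v⁻¹ * x, C.P_mul _ hv' _ hx, dv, by rw [C.d_mul, C.d_inv, dx, dv]; ring, by simp⟩
  · push Not at hWP
    obtain ⟨w, hw, hwP⟩ := hWP
    have hN : ∀ s, Full d P W s → NoU d P s := by
      intro s hs u du hu hu'
      exact hwP (by simpa using C.P_mul _ (hs w hw u hu du) _ hu')
    have t0 : t ≠ 0 := by
      rintro rfl
      exact hwP (by simpa using ht w hw 1 C.P_one C.d_one)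
    have main : ∀ t : ℚ, 0 < t → Full d P W t →
        ∃ l : ℕ, 0 < l ∧ Full d P W (1 / (l : ℚ)) ∧ NoU d P (1 / (l : ℚ)) := by
      intro t tp ht
      have hF : Full d P W (1 / (t.den : ℚ)) := by
        refine C.full_root t.num.toNat ?_ ht (hN _ ht)
        have h1 : ((t.num.toNat : ℤ) : ℚ) = t.num := by
          rw [Int.toNat_of_nonneg (Rat.num_nonneg.2 tp.le)]
        rw [Int.cast_natCast] at h1
        rw [h1, mul_one_div]; exact Rat.num_div_den t
      exact ⟨t.den, t.den_pos, hF, hN _ hF⟩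
    rcases lt_or_gt_of_ne t0 with h | h
    · exact main (-t) (by linarith) (C.full_neg ht (hN _ ht))
    · exact main t h ht

end Ctx

theorem Ctx.struct' {G : Type*} [Group G] {d : G → ℚ} {P W : Set G} {p : G}
    (C : Ctx d P W p) {t : ℚ} (ht : Ctx.Full d P W t) (hu : Ctx.NoU d P t) :
    ∃ a ∈ P, d a = t ∧ (∀ g, d g = t → (g ∈ P ↔ g * a⁻¹ ∈ W)) ∧
      (∀ g, d g = -t → (g ∈ P ↔ (g * a ∈ W ∧ (g * a)⁻¹ ∉ W))) ∧
      (∀ w ∈ W, a * w * a⁻¹ ∈ W) ∧ (∀ w ∈ W, a⁻¹ * w * a ∈ W) := by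
  obtain ⟨a, ha, da, A1, A2, h1, h2⟩ := C.struct ht hu
  refine ⟨a, ha, da, A1, fun g dg => ?_, h1, h2⟩
  rw [A2 g dg]
  have e : ∀ w, a * w * a⁻¹ ∈ W ↔ w ∈ W := fun w =>
    ⟨fun h => by simpa [mul_assoc] using h2 _ h, h1 w⟩
  rw [← e (g * a), ← e (g * a)⁻¹]
  have e1 : a * (g * a) * a⁻¹ = a * g := by group
  have e2 : a * (g * a)⁻¹ * a⁻¹ = (a * g)⁻¹ := by group
  rw [e1, e2]

theorem degen {G : Type*} [Group G] (d : G → ℚ) (P : Set G)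
    (d_mul : ∀ g h, d (g * h) = d g + d h) (d_surj : ∀ s, ∃ g, d g = s)
    (P_mul : ∀ g ∈ P, ∀ h ∈ P, g * h ∈ P) (P_tot : ∀ g, g ∈ P ∨ g⁻¹ ∈ P)
    (n0 : G) (dn0 : d n0 = 0) (hn0 : n0 ∉ P) (t : ℚ)
    (ht : ∀ w, d w = 0 → ∀ g ∈ P, d g = t → w * g ∈ P) :
    ∀ s u x, 0 < s * u → x ∈ P → d x = s + u →
      ∃ y ∈ P, ∃ z ∈ P, d y = s ∧ d z = u ∧ x = y * z := by
  have d_one : d 1 = 0 := by have := d_mul 1 1; simp at this; exact this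
  have d_inv : ∀ g, d g⁻¹ = - d g := fun g => by
    have := d_mul g g⁻¹
    rw [mul_inv_cancel, d_one] at this; linarith
  have P_one : (1 : G) ∈ P := by
    rcases P_tot 1 with h | h
    · exact h
    · simpa using h
  have d_pow : ∀ (g : G) (n : ℕ), d (g ^ n) = n * d g := by
    intro g n
    induction n with
    | zero => simp [d_one]
    | succ k ih => rw [pow_succ, d_mul, ih]; push_cast; ring
  have P_pow : ∀ g ∈ P, ∀ n : ℕ, g ^ n ∈ P := by
    intro g hg n
    induction n with
    | zero => simpa using P_one
    | succ k ih => rw [pow_succ]; exact P_mul _ ih _ hg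
  have t0 : t ≠ 0 := by
    rintro rfl
    exact hn0 (by simpa using ht n0 dn0 1 P_one d_one)
  have hτ : ∃ τ : ℚ, τ ≠ 0 ∧ ∀ g, d g = τ → g ∈ P := by
    by_cases h : ∃ g ∈ P, d g = t
    · obtain ⟨g, hg, dg⟩ := h
      refine ⟨t, t0, fun k dk => ?_⟩
      simpa using ht (k * g⁻¹) (by rw [d_mul, d_inv, dk, dg]; ring) g hg dg
    · refine ⟨-t, by simpa using t0, fun g dg => ?_⟩
      by_contra hc
      exact h ⟨g⁻¹, (P_tot g).resolve_left hc, by rw [d_inv, dg]; simp⟩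
  obtain ⟨τ, τ0, hτ⟩ := hτ
  have hk : ∀ k : ℕ, 0 < k → ∀ g, d g = k * τ → g ∈ P := by
    intro k hk g dg
    obtain ⟨h, dh⟩ := d_surj τ
    obtain ⟨m, rfl⟩ : ∃ m, k = m + 1 := ⟨k - 1, by omega⟩
    have h1 := P_mul _ (hτ (g * (h ^ m)⁻¹)
      (by rw [d_mul, d_inv, d_pow, dg, dh]; push_cast; ring)) _ (P_pow _ (hτ h dh) m)
    simpa using h1
  have hneg : ∀ g ∈ P, ¬ (d g * τ < 0) := by
    intro g hg hlt
    -- d g = - q τ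
    set q : ℚ := - d g / τ with hq
    have qpos : 0 < q := by
      have : q = -(d g * τ) / (τ * τ) := by rw [hq]; field_simp
      rw [this]
      exact div_pos (by linarith) (mul_self_pos.2 τ0)
    have e : (q.den : ℚ) * d g = - (q.num.toNat : ℚ) * τ := by
      have h1 : ((q.num.toNat : ℤ) : ℚ) = q.num := by
        rw [Int.toNat_of_nonneg (Rat.num_nonneg.2 qpos.le)]
      rw [Int.cast_natCast] at h1
      have h2 : (q.num : ℚ) = q * q.den := (Rat.mul_den_eq_num q).symm
      have h3 : d g = - q * τ := by rw [hq]; field_simp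
      rw [h1, h2, h3]; ring
    have hnum : 0 < q.num.toNat := by
      have := Rat.num_pos.2 qpos
      omega
    have h1 := hk _ hnum (n0 * (g ^ q.den)⁻¹) (by rw [d_mul, d_inv, d_pow, e, dn0]; ring)
    have h2 := P_mul _ h1 _ (P_pow _ hg q.den)
    exact hn0 (by simpa using h2)
  have hpos : ∀ g, 0 < d g * τ → g ∈ P := by
    intro g h
    by_contra hc
    exact hneg _ ((P_tot g).resolve_left hc) (by rw [d_inv]; linarith)
  intro s u x hsu hx dx
  have h1 := hneg x hx
  rw [dx] at h1
  have hs : 0 < s * τ ∧ 0 < u * τ := by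
    rcases lt_or_gt_of_ne τ0 with h | h <;> rcases pos_and_pos_or_neg_and_neg_of_mul_pos hsu with ⟨a, b⟩ | ⟨a, b⟩
    · exact absurd (mul_neg_of_pos_of_neg (by linarith) h) h1
    · exact ⟨mul_pos_of_neg_of_neg a h, mul_pos_of_neg_of_neg b h⟩
    · exact ⟨mul_pos a h, mul_pos b h⟩
    · exact absurd (mul_neg_of_neg_of_pos (by linarith) h) h1
  obtain ⟨y, dy⟩ := d_surj s
  have dz : d (y⁻¹ * x) = u := by rw [d_mul, d_inv, dx, dy]; ring
  exact ⟨y, hpos _ (by rw [dy]; exact hs.1), y⁻¹ * x, hpos _ (by rw [dz]; exact hs.2), dy, dz, by simp⟩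

/-- The action of `ℚ` on the unit group of `K`. -/
def phi (σ : ℚ → (K ≃+* K)) (hσ : ∀ r s : ℚ, σ (r + s) = (σ r).trans (σ s)) :
    Multiplicative ℚ →* MulAut Kˣ where
  toFun r := Units.mapEquiv (σ r.toAdd : K ≃* K)
  map_one' := by
    ext x
    have h := hσ 0 0
    have h2 : σ 0 (x : K) = σ 0 (σ 0 (x : K)) := by
      conv_lhs => rw [← add_zero (0 : ℚ), hσ]
      rfl
    have h3 := (σ 0).injective h2
    simpa using h3.symm
  map_mul' r s := by
    ext x
    have : σ (r.toAdd + s.toAdd) (x : K) = σ r.toAdd (σ s.toAdd x) := by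
      rw [add_comm, hσ]; rfl
    simpa using this

theorem stmt8 (V : Subring K) (hV : IsTVR V) (hVK : (V : Set K) ≠ Set.univ)
    (σ : ℚ → (K ≃+* K)) (hσ : ∀ r s : ℚ, σ (r + s) = (σ r).trans (σ s))
    (A : ℚ → Set K) (hA : IsGradedExtQ (V : Set K) σ A)
    (W : Set K) (hW : W = ⋃ s : ℚ, Ol (A s))
    (hII : ∃ r : ℚ, 0 < r ∧ ¬ HrTypeI σ A r)
    (b : K) (hb : jacS W = {b⁻¹} * W)
    (t : ℚ) (ht : Ol (A t) = W) :
    ∃ l : ℕ, 0 < l ∧ IsGradedExtHr (V : Set K) σ A (1 / (l : ℚ)) ∧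
      HrTypeE σ A (1 / (l : ℚ)) ∧ Ol (A (1 / (l : ℚ))) = W := by
  classical
  obtain ⟨hadd, hA0, htot, hmul⟩ := hA
  have hext : ∀ r, IsGradedExtHr (V : Set K) σ A r := fun r =>
    ⟨fun r _ => hadd r trivial, hA0, fun r _ => htot r trivial,
      fun r _ s _ => hmul r trivial s trivial⟩
  have σσ : ∀ r s x, σ r (σ s x) = σ (r + s) x := fun r s x => by
    rw [add_comm, hσ]; rfl
  have σ0 : ∀ x, σ 0 x = x := fun x => by
    have := σσ 0 0 x
    rw [add_zero] at this
    exact (σ 0).injective this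
  have z : ∀ r, (0 : K) ∈ A r := fun r => (hadd r trivial).1
  have hm : ∀ r s x y, x ∈ A r → y ∈ A s → x * σ r y ∈ A (r + s) := fun r s x y hx hy =>
    hmul r trivial s trivial (AddSubgroup.subset_closure (Set.mul_mem_mul hx ⟨y, hy, rfl⟩))
  have ht0 : ∀ r k, k ∈ A r ∨ σ (-r) k⁻¹ ∈ A (-r) := by
    intro r k
    have : k ∈ A r ∪ (σ r '' invS (A (-r))) := by rw [htot r trivial]; trivial
    rcases this with h | ⟨c, ⟨e, he, _, rfl⟩, rfl⟩
    · exact Or.inl h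
    · right
      rw [← map_inv₀, inv_inv, σσ, neg_add_cancel, σ0]; exact he
  let G := Kˣ ⋊[phi σ hσ] (Multiplicative ℚ)
  let d : G → ℚ := fun g => g.right.toAdd
  let P : Set G := {g | (g.left : K) ∈ A (d g)}
  let mk : K → ℚ → G := fun x r => if h : x = 0 then 1 else ⟨Units.mk0 x h, Multiplicative.ofAdd r⟩
  have dml : ∀ g h : G, ((g * h).left : K) = g.left * σ (d g) h.left := fun g h => rfl
  have d_mul : ∀ g h : G, d (g * h) = d g + d h := fun g h => rfl
  have dinv : ∀ g : G, d g⁻¹ = - d g := fun g => rfl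
  have linv : ∀ g : G, ((g⁻¹ : G).left : K) = σ (- d g) (g.left : K)⁻¹ := fun g => by
    have : ((g⁻¹ : G).left : K) = σ (- d g) ((g.left⁻¹ : Kˣ) : K) := rfl
    rw [this, Units.val_inv_eq_inv_val]
  have mkl : ∀ x r, x ≠ 0 → ((mk x r).left : K) = x := fun x r h => by simp [mk, h]
  have mkd : ∀ x r, x ≠ 0 → d (mk x r) = r := fun x r h => by simp [mk, h, d]
  have P_mul : ∀ g ∈ P, ∀ h ∈ P, g * h ∈ P := fun g hg h hh => by
    show ((g * h).left : K) ∈ A (d (g * h))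
    rw [dml, d_mul]; exact hm _ _ _ _ hg hh
  have P_tot : ∀ g, g ∈ P ∨ g⁻¹ ∈ P := fun g => by
    rcases ht0 (d g) g.left with h | h
    · exact Or.inl h
    · right
      show ((g⁻¹ : G).left : K) ∈ A (d g⁻¹)
      rw [linv, dinv]; exact h
  have typeI : (∀ s u x, 0 < s * u → x ∈ P → d x = s + u →
      ∃ y ∈ P, ∃ z ∈ P, d y = s ∧ d z = u ∧ x = y * z) → False := by
    intro H
    obtain ⟨r, hr, hn⟩ := hII
    apply hn
    have key : ∀ s u, 0 < s * u → aprod (A s) (σ s '' A u) = A (s + u) := by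
      intro s u hsu
      refine Set.Subset.antisymm (hmul s trivial u trivial) fun x hx => ?_
      by_cases hx0 : x = 0
      · rw [hx0]; exact AddSubgroup.zero_mem _
      · obtain ⟨y, hy, w, hw, dy, dw, e⟩ := H s u (mk x (s + u)) hsu
          (by show ((mk x (s+u)).left : K) ∈ A (d (mk x (s+u))); rw [mkl _ _ hx0, mkd _ _ hx0]; exact hx)
          (mkd _ _ hx0)
        have e2 : x = y.left * σ s w.left := by
          rw [← mkl x (s + u) hx0, e, dml, dy]
        rw [e2]
        subst dy dw
        exact AddSubgroup.subset_closure (Set.mul_mem_mul hy ⟨_, hw, rfl⟩)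
    intro i j hi hj
    have hi' : (0 : ℚ) < i := by exact_mod_cast hi
    have hj' : (0 : ℚ) < j := by exact_mod_cast hj
    have hp : 0 < ((i : ℚ) * r) * (j * r) := by positivity
    constructor
    · rw [key _ _ hp]; congr 1; push_cast; ring
    · rw [key _ _ (by linarith)]; congr 1; push_cast; ring
  have W1 : (1 : K) ∈ W := by rw [← ht]; intro x hx; simpa using hx
  have WW : ∀ x ∈ W, ∀ y ∈ W, x * y ∈ W := by
    rw [← ht]; intro x hx y hy k hk; rw [mul_assoc]; exact hx _ (hy _ hk)
  have W0 : (0 : K) ∈ W := by rw [← ht]; intro x hx; simpa using z t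
  have VW : ∀ v ∈ A 0, v ∈ W := by
    intro v hv; rw [← ht]; intro x hx
    have := hm 0 t v x hv hx
    rwa [σ0, zero_add] at this
  have Wtot : ∀ k, k ≠ 0 → k ∉ W → k⁻¹ ∈ W := by
    intro k hk hkW
    rcases hV k hk with h | h
    · exact absurd (VW _ (by rw [hA0]; exact h)) hkW
    · exact VW _ (by rw [hA0]; exact h)
  have hbJ : b⁻¹ ∈ jacS W := by
    rw [hb]; exact ⟨b⁻¹, rfl, 1, W1, by simp⟩
  by_cases hb0 : b = 0
  · exfalso
    have Wall : ∀ k, k ∈ W := by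
      intro k
      by_contra hk
      have k0 : k ≠ 0 := fun h => hk (h ▸ W0)
      have : k⁻¹ ∈ jacS W := ⟨Wtot k k0 hk, Or.inr (by simpa using hk)⟩
      rw [hb, hb0] at this
      obtain ⟨x, hx, y, _, e⟩ := this
      rw [Set.mem_singleton_iff] at hx
      subst hx
      simp at e
      exact k0 e.symm
    obtain ⟨n, hn⟩ := (Set.ne_univ_iff_exists_notMem _).1 hVK
    have n0 : n ≠ 0 := fun h => hn (h ▸ V.zero_mem)
    refine typeI (degen d P d_mul (fun s => ⟨mk 1 s, mkd _ _ one_ne_zero⟩) P_mul P_tot (mk n 0)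
      (mkd _ _ n0) ?_ t ?_)
    · intro h
      have h' : ((mk n 0).left : K) ∈ A (d (mk n 0)) := h
      rw [mkl _ _ n0, mkd _ _ n0, hA0] at h'
      exact hn h'
    · intro w dw g hg dg
      show ((w * g).left : K) ∈ A (d (w * g))
      rw [dml, d_mul, dw, zero_add, σ0, dg]
      have h1 := Wall w.left
      rw [← ht] at h1
      exact h1 _ (dg ▸ hg)
  · let WG : Set G := {g | d g = 0 ∧ (g.left : K) ∈ W}
    have bi0 : b⁻¹ ≠ 0 := inv_ne_zero hb0
    have invd0 : ∀ g : G, d g = 0 → ((g⁻¹ : G).left : K) = (g.left : K)⁻¹ := fun g hg => by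
      rw [linv, hg, neg_zero, σ0]
    have invW : ∀ g : G, d g = 0 → (g⁻¹ ∈ WG ↔ (g.left : K)⁻¹ ∈ W) := fun g hg => by
      show (d g⁻¹ = 0 ∧ ((g⁻¹ : G).left : K) ∈ W) ↔ _
      rw [dinv, hg, invd0 g hg]; simp
    have C : Ctx d P WG (mk b⁻¹ 0) := by
      refine ⟨d_mul, P_mul, P_tot, fun w hw => hw.1, ?_, ?_, ?_, ?_, ?_, ?_⟩
      · intro g hg h hh
        refine ⟨by rw [d_mul, hg.1, hh.1, add_zero], ?_⟩
        rw [dml, hg.1, σ0]; exact WW _ hg.2 _ hh.2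
      · intro g hg dg
        have hg' : (g.left : K) ∈ A (d g) := hg
        rw [dg] at hg'
        exact ⟨dg, VW _ hg'⟩
      · intro s w dw H
        refine ⟨dw, ?_⟩
        rw [hW]
        refine Set.mem_iUnion.2 ⟨s, fun x hx => ?_⟩
        by_cases hx0 : x = 0
        · rw [hx0, mul_zero]; exact z s
        · have h1 : ((w * mk x s).left : K) ∈ A (d (w * mk x s)) := H (mk x s)
            (by show ((mk x s).left : K) ∈ A (d (mk x s)); rw [mkl _ _ hx0, mkd _ _ hx0]; exact hx) (mkd _ _ hx0)
          rwa [dml, d_mul, dw, zero_add, σ0, mkl _ _ hx0, mkd _ _ hx0] at h1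
      · exact ⟨mkd _ _ bi0, by rw [mkl _ _ bi0]; exact hbJ.1⟩
      · rw [invW _ (mkd _ _ bi0), mkl _ _ bi0]
        exact hbJ.2.resolve_left bi0
      · intro j hj hjn
        rw [invW _ hj.1] at hjn
        have : (j.left : K) ∈ jacS W := ⟨hj.2, Or.inr hjn⟩
        rw [hb] at this
        obtain ⟨x, hx, w, hw, e⟩ := this
        rw [Set.mem_singleton_iff] at hx
        subst hx
        refine ⟨by rw [d_mul, dinv, mkd _ _ bi0, hj.1]; simp, ?_⟩
        rw [dml, dinv, invd0 _ (mkd _ _ bi0), mkd _ _ bi0, neg_zero, σ0, mkl _ _ bi0, ← e]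
        simpa [hb0] using hw
    have full_of : ∀ s, Ctx.Full d P WG s ↔ W ⊆ Ol (A s) := by
      intro s
      constructor
      · intro H w hw x hx
        by_cases hw0 : w = 0
        · rw [hw0, zero_mul]; exact z s
        by_cases hx0 : x = 0
        · rw [hx0, mul_zero]; exact z s
        have h1 : ((mk w 0 * mk x s).left : K) ∈ A (d (mk w 0 * mk x s)) :=
          H (mk w 0) ⟨mkd _ _ hw0, by rw [mkl _ _ hw0]; exact hw⟩ (mk x s)
            (by show ((mk x s).left : K) ∈ A (d (mk x s)); rw [mkl _ _ hx0, mkd _ _ hx0]; exact hx) (mkd _ _ hx0)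
        rwa [dml, d_mul, mkd _ _ hw0, zero_add, σ0, mkl _ _ hx0, mkd _ _ hx0, mkl _ _ hw0] at h1
      · intro H w hw g hg dg
        show ((w * g).left : K) ∈ A (d (w * g))
        rw [dml, d_mul, hw.1, zero_add, σ0, dg]
        exact H hw.2 _ (dg ▸ hg)
    obtain ⟨l, hl, hF, hN⟩ := C.exists_l ((full_of t).2 ht.ge)
      (fun H => typeI fun s u x _ => H s u x)
    set r : ℚ := 1 / (l : ℚ) with hr
    have hOl : Ol (A r) = W := Set.Subset.antisymm
      (by rw [hW]; exact Set.subset_iUnion (fun s => Ol (A s)) r) ((full_of r).1 hF)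
    refine ⟨l, hl, hext r, ?_, hOl⟩
    show HrTypeE σ A r
    clear_value r
    obtain ⟨ag, haP, da, A1, A2, h1, h2⟩ := C.struct' hF hN
    set a : K := (ag.left : Kˣ).val with hadef
    have a0 : a ≠ 0 := ag.left.ne_zero
    have B1 : ∀ x, x ∈ A r ↔ x * a⁻¹ ∈ W := by
      intro x
      by_cases hx0 : x = 0
      · rw [hx0, zero_mul]; exact ⟨fun _ => W0, fun _ => z r⟩
      have h := A1 (mk x r) (mkd _ _ hx0)
      have e1 : (mk x r ∈ P) ↔ x ∈ A r := by
        show ((mk x r).left : K) ∈ A (d (mk x r)) ↔ _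
        rw [mkl _ _ hx0, mkd _ _ hx0]
      have e2 : (mk x r * ag⁻¹ ∈ WG) ↔ x * a⁻¹ ∈ W := by
        show (d (mk x r * ag⁻¹) = 0 ∧ ((mk x r * ag⁻¹).left : K) ∈ W) ↔ _
        rw [dml, d_mul, dinv, linv, mkl _ _ hx0, mkd _ _ hx0, da, σσ]
        simp [σ0, hadef]
      rw [← e1, ← e2, h]
    have B3 : ∀ w ∈ W, a * σ r w * a⁻¹ ∈ W := by
      intro w hw
      by_cases hw0 : w = 0
      · rw [hw0]; simpa using W0
      have h := (h1 (mk w 0) ⟨mkd _ _ hw0, by rw [mkl _ _ hw0]; exact hw⟩).2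
      rw [dml, dml, d_mul, linv, mkl _ _ hw0, mkd _ _ hw0, da, σσ] at h
      simpa [σ0, hadef] using h
    have B4 : ∀ w ∈ W, σ (-r) (a⁻¹ * w * a) ∈ W := by
      intro w hw
      by_cases hw0 : w = 0
      · rw [hw0]; simpa using W0
      have h := (h2 (mk w 0) ⟨mkd _ _ hw0, by rw [mkl _ _ hw0]; exact hw⟩).2
      rw [dml, dml, d_mul, linv, dinv, mkl _ _ hw0, mkd _ _ hw0, da, add_zero, ← map_mul, ← map_mul] at h
      exact h
    have σa0 : σ (-r) a ≠ 0 := by simpa using a0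
    have B2 : ∀ y, y ∈ A (-r) ↔ y * σ (-r) a ∈ jacS W := by
      intro y
      by_cases hy0 : y = 0
      · rw [hy0, zero_mul]; exact ⟨fun _ => ⟨W0, Or.inl rfl⟩, fun _ => z _⟩
      have h := A2 (mk y (-r)) (mkd _ _ hy0)
      have e1 : (mk y (-r) ∈ P) ↔ y ∈ A (-r) := by
        show ((mk y (-r)).left : K) ∈ A (d (mk y (-r))) ↔ _
        rw [mkl _ _ hy0, mkd _ _ hy0]
      have dz : d (mk y (-r) * ag) = 0 := by rw [d_mul, mkd _ _ hy0, da]; ring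
      have el : ((mk y (-r) * ag).left : K) = y * σ (-r) a := by
        rw [dml, mkl _ _ hy0, mkd _ _ hy0]
      rw [← e1, h, invW _ dz, el]
      have : mk y (-r) * ag ∈ WG ↔ y * σ (-r) a ∈ W := by
        rw [← el]; exact ⟨fun h => h.2, fun h => ⟨dz, h⟩⟩
      rw [this]
      constructor
      · rintro ⟨h3, h4⟩; exact ⟨h3, Or.inr h4⟩
      · rintro ⟨h3, h4⟩; exact ⟨h3, h4.resolve_left (mul_ne_zero hy0 σa0)⟩
    refine ⟨a, b, ?_, ?_, ?_, ?_⟩ <;> rw [hOl]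
    · ext x
      rw [B1]
      constructor
      · intro h; exact ⟨_, h, a, rfl, by simp [a0]⟩
      · rintro ⟨w, hw, _, rfl, rfl⟩; simpa [a0] using hw
    · ext x
      rw [B1]
      constructor
      · intro h
        refine ⟨a, rfl, _, ⟨_, B4 _ h, rfl⟩, ?_⟩
        simp only [σσ, add_neg_cancel, σ0]
        simp [a0, mul_assoc]
      · rintro ⟨_, rfl, _, ⟨w, hw, rfl⟩, rfl⟩
        exact B3 w hw
    · ext y
      rw [B2]
      constructor
      · intro h; exact ⟨_, h, _, rfl, by simp [a0, mul_assoc]⟩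
      · rintro ⟨w, hw, _, rfl, rfl⟩
        simpa [a0, mul_assoc] using hw
    · ext x
      constructor
      · intro hx
        refine ⟨x * b, ?_, b⁻¹, rfl, by simp [hb0]⟩
        by_cases hx0 : x = 0
        · rw [hx0, zero_mul]; exact W0
        have h := C.hp' (mk x 0) ⟨mkd _ _ hx0, by rw [mkl _ _ hx0]; exact hx.1⟩
          (by rw [invW _ (mkd _ _ hx0), mkl _ _ hx0]; exact hx.2.resolve_left hx0)
        have h' := h.2
        rw [dml, mkl _ _ hx0, mkd _ _ hx0, invd0 _ (mkd _ _ bi0), mkl _ _ bi0, σ0, inv_inv] at h'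
        exact h'
      · rintro ⟨w, hw, _, rfl, rfl⟩
        refine ⟨WW _ hw _ hbJ.1, ?_⟩
        by_cases hw0 : w = 0
        · left; simp [hw0]
        right
        intro h
        have h3 := WW _ h _ hw
        refine hbJ.2.resolve_left bi0 ?_
        simpa [hw0, mul_assoc] using h3
end

section
/- Let (A_r)_{r∈ℚ} be a graded extension of V in K[ℚ,σ] of Type (e), and assume there exists t ∈ ℚ with O_l(A_t) = W, where W = ∪_{s∈ℚ} O_l(A_s). Then for every r ∈ ℚ there exists β_r ∈ K with WA_r = Wβ_r = β_r W^{σ(r)}. -/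
open scoped Pointwise

variable {K : Type*} [DivisionRing K]

/-- Working data extracted from the hypotheses. -/
structure Dat (σ : ℚ → (K ≃+* K)) (A : ℚ → Set K) (V W : Set K) (b : K) : Prop where
  s0 : ∀ x, σ 0 x = x
  sadd : ∀ r s x, σ (r + s) x = σ r (σ s x)
  A0 : A 0 = V
  zero : ∀ r, (0 : K) ∈ A r
  mul : ∀ r s x y, x ∈ A r → y ∈ A s → x * σ r y ∈ A (r + s)
  alt : ∀ r x, x ∉ A r → σ (-r) x⁻¹ ∈ A (-r)
  Vtv : ∀ k, k ∉ V → k⁻¹ ∈ V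
  VW : ∀ k ∈ V, k ∈ W
  V1 : (1 : K) ∈ V
  W0 : (0 : K) ∈ W
  Wm : ∀ x ∈ W, ∀ y ∈ W, x * y ∈ W
  Wa : ∀ x ∈ W, ∀ y ∈ W, x + y ∈ W
  Wn : ∀ x ∈ W, -x ∈ W
  Wtv : ∀ k, k ∉ W → k⁻¹ ∈ W
  Ol : ∀ s a, (∀ x ∈ A s, a * x ∈ A s) → a ∈ W
  b0 : b ≠ 0
  bW : b ∉ W
  bJ : ∀ x ∈ W, x⁻¹ ∉ W → b * x ∈ W
  bc : ∀ w ∈ W, b * w * b⁻¹ ∈ W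
  bc' : ∀ w ∈ W, b⁻¹ * w * b ∈ W

/-- Conjugation by the monomial `x X^r`. -/
def cj (σ : ℚ → (K ≃+* K)) (x : K) (r : ℚ) (k : K) : K := x * σ r k * x⁻¹

/-- `x` generates `W A_r`. -/
def Gen (A : ℚ → Set K) (W : Set K) (x : K) (r : ℚ) : Prop :=
  x ≠ 0 ∧ x ∈ A r ∧ ∀ a ∈ A r, a * x⁻¹ ∈ W

namespace Dat

variable {σ : ℚ → (K ≃+* K)} {A : ℚ → Set K} {V W : Set K} {b : K}

theorem sn (D : Dat σ A V W b) (r : ℚ) (x : K) : σ r (σ (-r) x) = x := by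
  rw [← D.sadd, add_neg_cancel, D.s0]

theorem sn' (D : Dat σ A V W b) (r : ℚ) (x : K) : σ (-r) (σ r x) = x := by
  rw [← D.sadd, neg_add_cancel, D.s0]

theorem W1 (D : Dat σ A V W b) : (1 : K) ∈ W := D.VW _ D.V1

theorem cj_surj (D : Dat σ A V W b) {x : K} (hx : x ≠ 0) (r : ℚ) (y : K) :
    ∃ k, cj σ x r k = y := by
  refine ⟨σ (-r) (x⁻¹ * y * x), ?_⟩
  simp only [cj, D.sn]
  simp [mul_assoc, hx]

theorem cj_mul {x : K} (hx : x ≠ 0) (r : ℚ) (k l : K) :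
    cj σ x r (k * l) = cj σ x r k * cj σ x r l := by
  simp [cj, mul_assoc, hx]

theorem cj_inv {x : K} (r : ℚ) (k : K) :
    cj σ x r k⁻¹ = (cj σ x r k)⁻¹ := by
  simp [cj, mul_assoc]

theorem cj_inj {x : K} (hx : x ≠ 0) (r : ℚ) {k l : K} (h : cj σ x r k = cj σ x r l) : k = l := by
  simpa [cj, hx] using h

theorem Jmul (D : Dat σ A V W b) {w y : K} (hw : w ∈ W) (hw0 : w ≠ 0) (hy : y⁻¹ ∉ W) :
    (w * y)⁻¹ ∉ W := by
  intro h
  apply hy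
  have := D.Wm _ h _ hw
  simpa [mul_assoc, hw0] using this

theorem Jmul' (D : Dat σ A V W b) {w y : K} (hw : w ∈ W) (hw0 : w ≠ 0) (hy : y⁻¹ ∉ W) :
    (y * w)⁻¹ ∉ W := by
  intro h
  apply hy
  have := D.Wm _ hw _ h
  simpa [mul_assoc, hw0] using this

theorem exGen (D : Dat σ A V W b) (t : ℚ) (h : ∀ a ∈ W, ∀ x ∈ A t, a * x ∈ A t) :
    ∃ x, Gen A W x t := by
  have h1 : ∃ x ∈ A t, b * x ∉ A t := by
    by_contra hc
    push Not at hc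
    exact D.bW (D.Ol t b hc)
  obtain ⟨x, hx, hbx⟩ := h1
  have hx0 : x ≠ 0 := by
    rintro rfl
    exact hbx (by simpa using D.zero t)
  refine ⟨x, hx0, hx, fun a ha => ?_⟩
  by_contra hc
  have ha0 : a ≠ 0 := by
    rintro rfl
    exact hc (by simpa using D.W0)
  have h2 := D.Wtv _ hc
  have h3 := D.bJ _ h2 (by simpa using hc)
  have h4 := h _ h3 a ha
  apply hbx
  simpa [mul_assoc, ha0] using h4

theorem hY (D : Dat σ A V W b) {t : ℚ} {x : K} (hx : Gen A W x t) {j : K}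
    (hj : j⁻¹ ∉ W) : σ (-t) (x⁻¹ * j) ∈ A (-t) := by
  have : j⁻¹ * x ∉ A t := by
    intro h
    apply hj
    have := hx.2.2 _ h
    simpa [mul_assoc, hx.1] using this
  simpa using D.alt _ _ this

theorem jA (D : Dat σ A V W b) {t : ℚ} {x : K} (hx : Gen A W x t) {j : K}
    (hj : j⁻¹ ∉ W) {r : ℚ} {a : K} (ha : a ∈ A r) : j * a ∈ A r := by
  have h1 := D.mul _ _ _ _ (D.hY hx hj) ha
  have h2 := D.mul _ _ _ _ hx.2.1 h1
  have h3 : t + (-t + r) = r := by ring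
  rw [h3, map_mul, D.sn, D.sn] at h2
  simpa [← mul_assoc, hx.1] using h2

theorem cjV (D : Dat σ A V W b) {t : ℚ} {x : K} (hx : Gen A W x t) {k : K} (hk : k ∈ V) :
    cj σ x t k ∈ W := by
  rw [← D.A0] at hk
  have := D.mul _ _ _ _ hx.2.1 hk
  rw [add_zero] at this
  exact hx.2.2 _ this

theorem good (D : Dat σ A V W b) {t : ℚ} (h : ∀ a ∈ W, ∀ x ∈ A t, a * x ∈ A t) {x : K}
    (hx : Gen A W x t) (k : K) : k ∈ W ↔ cj σ x t k ∈ W := by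
  have hx0 := hx.1
  have key : ∀ y, σ (-t) (x⁻¹ * y) ∈ A (-t) → ∀ w ∈ W, w * y ∈ V := by
    intro y hy w hw
    have := D.mul _ _ _ _ (h w hw x hx.2.1) hy
    rw [add_neg_cancel, D.sn, D.A0] at this
    simpa [mul_assoc, hx0] using this
  by_cases hc : ∃ y, y ≠ 0 ∧ σ (-t) (x⁻¹ * y) ∈ A (-t) ∧ y⁻¹ ∈ W
  · obtain ⟨y, hy0, hy, hyW⟩ := hc
    have hWV : ∀ w ∈ W, w ∈ V := by
      intro w hw
      have := key y hy _ (D.Wm _ hw _ hyW)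
      simpa [mul_assoc, hy0] using this
    refine ⟨fun hk => D.cjV hx (hWV _ hk), fun hk => ?_⟩
    have h1 := h _ (D.Wm _ hyW _ hk) x hx.2.1
    have h2 := D.mul _ _ _ _ hy h1
    rw [neg_add_cancel, D.A0, ← map_mul] at h2
    have h3 : x⁻¹ * y * (y⁻¹ * cj σ x t k * x) = σ t k := by
      simp [cj, mul_assoc, hx0, hy0]
    rw [h3, D.sn'] at h2
    exact D.VW _ h2
  · push Not at hc
    constructor
    · intro hk
      by_contra hu
      have hk0 : k ≠ 0 := by
        rintro rfl
        exact hu (by simpa [cj] using D.W0)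
      apply hu
      apply D.Ol (t + t)
      intro a ha
      obtain ⟨m, hm⟩ := D.cj_surj hx0 t (a * (σ t x)⁻¹ * x⁻¹)
      have hmW : m ∈ W := by
        by_contra hmW
        have hm0 : m ≠ 0 := by
          rintro rfl
          exact hmW D.W0
        have h1 : (m⁻¹ * k)⁻¹ ∉ W := D.Jmul' hk hk0 (by simpa using hmW)
        have h2 := D.mul _ _ _ _ ha (D.hY hx h1)
        have h3 : t + t + -t = t := by ring
        rw [h3, D.sadd, D.sn] at h2
        have h4 := hx.2.2 _ h2
        apply hu
        have h5 : a = cj σ x t m * x * σ t x := by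
          rw [hm]; simp [mul_assoc, hx0]
        rw [h5] at h4
        have h6 : cj σ x t m * x * σ t x * σ t (x⁻¹ * (m⁻¹ * k)) * x⁻¹ = cj σ x t k := by
          simp [cj, mul_assoc, hx0, hm0]
        rwa [h6] at h4
      have h5 : a = cj σ x t m * x * σ t x := by
        rw [hm]; simp [mul_assoc, hx0]
      have h6 := D.mul _ _ _ _ hx.2.1 (h _ (D.Wm _ hk _ hmW) x hx.2.1)
      have h7 : cj σ x t k * a = x * σ t (k * m * x) := by
        rw [h5]; simp [cj, mul_assoc, hx0]
      rwa [h7]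
    · intro hk
      apply D.Ol (-t)
      intro z hz
      by_cases hz0 : z = 0
      · subst hz0; simpa using D.zero (-t)
      by_cases hk0 : k = 0
      · subst hk0; simpa using D.zero (-t)
      have hy0 : x * σ t z ≠ 0 := by simp [hx0, hz0]
      have hc0 : cj σ x t k ≠ 0 := by simp [cj, hx0, hk0]
      have e1 : σ (-t) (x⁻¹ * (x * σ t z)) = z := by
        simp [hx0, D.sn']
      have h1 := hc _ hy0 (by rwa [e1])
      have h2 := D.hY hx (D.Jmul hk hc0 h1)
      have h3 : σ (-t) (x⁻¹ * (cj σ x t k * (x * σ t z))) = k * z := by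
        rw [← D.sn' t (k * z)]
        congr 1
        simp [cj, mul_assoc, hx0]
      rwa [h3] at h2

theorem allGen (D : Dat σ A V W b) {t : ℚ} (h : ∀ a ∈ W, ∀ x ∈ A t, a * x ∈ A t) (r : ℚ) :
    ∃ x, Gen A W x r := by
  obtain ⟨x, hx⟩ := D.exGen t h
  by_contra hc
  apply hc
  apply D.exGen
  intro w hw a ha
  by_cases ha0 : a = 0
  · subst ha0; simpa using D.zero r
  by_cases hw0 : w = 0
  · subst hw0; simpa using D.zero r
  have : ∃ y ∈ A r, y * a⁻¹ ∉ W := by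
    by_contra h1
    push Not at h1
    exact hc ⟨a, ha0, ha, h1⟩
  obtain ⟨y, hy, hya⟩ := this
  have hy0 : y ≠ 0 := by
    rintro rfl
    exact hya (by simpa using D.W0)
  have h1 : (w * (a * y⁻¹))⁻¹ ∉ W := D.Jmul hw hw0 (by simpa using hya)
  have h2 := D.jA hx h1 hy
  simpa [mul_assoc, hy0] using h2

theorem step (D : Dat σ A V W b) {g : ℚ → K} (hg : ∀ r, Gen A W (g r) r) (r s : ℚ) :
    ∃ w ∈ W, w ≠ 0 ∧ (∃ v ∈ W, w⁻¹ = b * cj σ (g r) r v) ∧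
      ∀ k, cj σ (g (r + s)) (r + s) k = w⁻¹ * cj σ (g r) r (cj σ (g s) s k) * w := by
  have hr := (hg r).1
  have hs := (hg s).1
  have hrs := (hg (r + s)).1
  refine ⟨g r * σ r (g s) * (g (r + s))⁻¹, ?_, ?_, ?_, ?_⟩
  · exact (hg (r + s)).2.2 _ (D.mul _ _ _ _ (hg r).2.1 (hg s).2.1)
  · simp [hr, hs, hrs]
  · have h1 := D.hY (hg r) (j := b⁻¹) (by simpa using D.bW)
    have h2 := D.mul _ _ _ _ h1 (hg (r + s)).2.1
    have e : -r + (r + s) = s := by ring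
    rw [e] at h2
    refine ⟨_, (hg s).2.2 _ h2, ?_⟩
    simp [cj, mul_assoc, hr, D.sn, D.b0]
  · intro k
    simp [cj, mul_assoc, hr, hrs, D.sadd, hs]

theorem unitc (D : Dat σ A V W b) {w : K} (hw0 : w ≠ 0) (hw : w ∈ W) (hw' : w⁻¹ ∈ W) (k : K) :
    w⁻¹ * k * w ∈ W ↔ k ∈ W := by
  refine ⟨fun h => ?_, fun h => D.Wm _ (D.Wm _ hw' _ h) _ hw⟩
  have := D.Wm _ (D.Wm _ hw _ h) _ hw'
  simpa [mul_assoc, hw0] using this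

theorem normc (D : Dat σ A V W b) {w : K} (hw0 : w ≠ 0) (hw : w ∈ W) {v : K} (hv : v ∈ W)
    (hwv : w⁻¹ = b * v) (k : K) : w⁻¹ * k * w ∈ W ↔ k ∈ W := by
  by_cases h : w⁻¹ ∈ W
  · exact D.unitc hw0 hw h k
  have h1 := D.bJ _ hw h
  have h2 : (b * w)⁻¹ ∈ W := by
    rw [mul_inv_rev, hwv]
    exact D.bc _ hv
  have h0 : b * w ≠ 0 := by simp [D.b0, hw0]
  have h3 := D.unitc h0 h1 h2 (b * k * b⁻¹)
  have e : (b * w)⁻¹ * (b * k * b⁻¹) * (b * w) = w⁻¹ * k * w := by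
    simp [mul_assoc, D.b0]
  rw [e] at h3
  rw [h3]
  refine ⟨fun h => ?_, fun h => D.bc _ h⟩
  have := D.bc' _ h
  simpa [mul_assoc, D.b0] using this

theorem stepDn (D : Dat σ A V W b) {g : ℚ → K} (hg : ∀ r, Gen A W (g r) r) (r s : ℚ)
    (hr : ∀ k ∈ W, cj σ (g r) r k ∈ W) (k : K) :
    cj σ (g (r + s)) (r + s) k ∈ W ↔ cj σ (g r) r (cj σ (g s) s k) ∈ W := by
  obtain ⟨w, hw, hw0, ⟨v, hv, hwv⟩, h⟩ := D.step hg r s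
  rw [h k]
  exact D.normc hw0 hw (hr _ hv) hwv _

theorem good0 (D : Dat σ A V W b) {g : ℚ → K} (hg : ∀ r, Gen A W (g r) r) (k : K) :
    cj σ (g 0) 0 k ∈ W ↔ k ∈ W := by
  have h1 := (hg 0).2.1
  have h2 := (hg 0).2.2 1 (by rw [D.A0]; exact D.V1)
  rw [D.A0] at h1
  have h0 := (hg 0).1
  have := D.unitc (inv_ne_zero h0) (by simpa using h2) (by simpa using D.VW _ h1) k
  simpa [cj, D.s0] using this

theorem goodadd (D : Dat σ A V W b) {g : ℚ → K} (hg : ∀ r, Gen A W (g r) r) (r s : ℚ)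
    (hr : ∀ k, cj σ (g r) r k ∈ W ↔ k ∈ W) (hs : ∀ k, cj σ (g s) s k ∈ W ↔ k ∈ W) (k : K) :
    cj σ (g (r + s)) (r + s) k ∈ W ↔ k ∈ W := by
  rw [D.stepDn hg r s (fun k hk => (hr k).2 hk), hr, hs]

theorem goodneg (D : Dat σ A V W b) {g : ℚ → K} (hg : ∀ r, Gen A W (g r) r) (r : ℚ)
    (hr : ∀ k, cj σ (g r) r k ∈ W ↔ k ∈ W) (k : K) :
    cj σ (g (-r)) (-r) k ∈ W ↔ k ∈ W := by
  have := D.stepDn hg r (-r) (fun k hk => (hr k).2 hk) k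
  rw [add_neg_cancel, D.good0 hg, hr] at this
  exact this.symm

theorem goodnat (D : Dat σ A V W b) {g : ℚ → K} (hg : ∀ r, Gen A W (g r) r) (r : ℚ)
    (hr : ∀ k, cj σ (g r) r k ∈ W ↔ k ∈ W) (n : ℕ) :
    ∀ k, cj σ (g (n * r)) (n * r) k ∈ W ↔ k ∈ W := by
  induction n with
  | zero => simpa using D.good0 hg
  | succ n ih =>
    have e : ((n + 1 : ℕ) : ℚ) * r = n * r + r := by push_cast; ring
    rw [e]
    exact D.goodadd hg _ _ ih hr

theorem goodint (D : Dat σ A V W b) {g : ℚ → K} (hg : ∀ r, Gen A W (g r) r) (r : ℚ)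
    (hr : ∀ k, cj σ (g r) r k ∈ W ↔ k ∈ W) (n : ℤ) :
    ∀ k, cj σ (g (n * r)) (n * r) k ∈ W ↔ k ∈ W := by
  obtain ⟨m, rfl | rfl⟩ := n.eq_nat_or_neg
  · simpa using D.goodnat hg r hr m
  · have := D.goodneg hg _ (D.goodnat hg r hr m)
    have e : ((-(m : ℤ) : ℤ) : ℚ) * r = -(m * r) := by push_cast; ring
    rw [e]
    exact this

theorem up (D : Dat σ A V W b) {g : ℚ → K} (hg : ∀ r, Gen A W (g r) r) (r : ℚ)
    (h1 : ∀ k, cj σ (g r) r k ∈ W → k ∈ W) {k0 : K} (hk0 : k0 ∈ W) (hk1 : cj σ (g r) r k0 ∉ W)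
    (n : ℕ) :
    (∀ k, cj σ (g ((n + 1) * r)) ((n + 1) * r) k ∈ W → k ∈ W) ∧
      ∃ k ∈ W, cj σ (g ((n + 1) * r)) ((n + 1) * r) k ∉ W := by
  have hr0 := (hg r).1
  induction n with
  | zero => simpa using ⟨h1, k0, hk0, hk1⟩
  | succ n ih =>
    have e : (((n + 1 : ℕ) : ℚ) + 1) * r = r + (n + 1) * r := by push_cast; ring
    rw [e]
    generalize ((n : ℚ) + 1) * r = s at ih
    obtain ⟨ih, -⟩ := ih
    obtain ⟨w, hw, hw0, ⟨v, hv, hwv⟩, h⟩ := D.step hg r s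
    have hb : ∃ b1 ∈ W, cj σ (g r) r b1 = b := by
      have hc0 : cj σ (g r) r k0 ≠ 0 := fun h0 => hk1 (h0 ▸ D.W0)
      have h2 := D.bJ _ (D.Wtv _ hk1) (by simpa using hk1)
      obtain ⟨b2, hb2⟩ := D.cj_surj hr0 r (b * (cj σ (g r) r k0)⁻¹)
      have : b2 ∈ W := h1 _ (by rwa [hb2])
      refine ⟨b2 * k0, D.Wm _ this _ hk0, ?_⟩
      rw [cj_mul hr0, hb2]
      simp [mul_assoc, hc0]
    obtain ⟨b1, hb1, hb⟩ := hb
    obtain ⟨w1, hw1⟩ := D.cj_surj hr0 r w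
    have hw1W : w1 ∈ W := h1 _ (by rwa [hw1])
    have hw10 : w1 ≠ 0 := by
      rintro rfl
      apply hw0
      rw [← hw1]; simp [cj]
    have hw1i : w1⁻¹ ∈ W := by
      have : w1⁻¹ = b1 * v := by
        apply cj_inj (σ := σ) hr0 r
        rw [cj_inv, hw1, cj_mul hr0, hb, hwv]
      rw [this]
      exact D.Wm _ hb1 _ hv
    have h' : ∀ k, cj σ (g (r + s)) (r + s) k = cj σ (g r) r (w1⁻¹ * cj σ (g s) s k * w1) := by
      intro k
      rw [h k, cj_mul hr0, cj_mul hr0, cj_inv, hw1]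
    refine ⟨fun k hk => ?_, ?_⟩
    · rw [h'] at hk
      exact ih _ ((D.unitc hw10 hw1W hw1i _).1 (h1 _ hk))
    · obtain ⟨k, hk⟩ := D.cj_surj (hg s).1 s (w1 * k0 * w1⁻¹)
      refine ⟨k, ih _ ?_, ?_⟩
      · rw [hk]
        exact D.Wm _ (D.Wm _ hw1W _ hk0) _ hw1i
      · rw [h', hk]
        have : w1⁻¹ * (w1 * k0 * w1⁻¹) * w1 = k0 := by simp [mul_assoc, hw10]
        rwa [this]

theorem dn (D : Dat σ A V W b) {g : ℚ → K} (hg : ∀ r, Gen A W (g r) r) (r : ℚ)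
    (h1 : ∀ k ∈ W, cj σ (g r) r k ∈ W) {k0 : K} (hk0 : k0 ∉ W) (hk1 : cj σ (g r) r k0 ∈ W)
    (n : ℕ) :
    (∀ k ∈ W, cj σ (g ((n + 1) * r)) ((n + 1) * r) k ∈ W) ∧
      ∃ k, k ∉ W ∧ cj σ (g ((n + 1) * r)) ((n + 1) * r) k ∈ W := by
  induction n with
  | zero => simpa using ⟨h1, k0, hk0, hk1⟩
  | succ n ih =>
    have e : (((n + 1 : ℕ) : ℚ) + 1) * r = r + (n + 1) * r := by push_cast; ring
    rw [e]
    generalize ((n : ℚ) + 1) * r = s at ih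
    obtain ⟨ih, k, hk, hk'⟩ := ih
    have h := D.stepDn hg r s h1
    exact ⟨fun k hk => (h k).2 (h1 _ (ih _ hk)), k, hk, (h k).2 (h1 _ hk')⟩

theorem comparable (D : Dat σ A V W b) {x : K} {r : ℚ} (hx : Gen A W x r) :
    (∀ k, cj σ x r k ∈ W → k ∈ W) ∨ (∀ k ∈ W, cj σ x r k ∈ W) := by
  by_contra hc
  push Not at hc
  obtain ⟨⟨k, hk, hk'⟩, l, hl, hl'⟩ := hc
  have hk0 : k ≠ 0 := fun h => hk' (h ▸ D.W0)
  have hl0 : l ≠ 0 := by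
    rintro rfl
    exact hl' (by simpa [cj] using D.W0)
  by_cases h : k⁻¹ * l ∈ V
  · apply hl'
    have h2 := D.Wm _ hk _ (D.cjV hx h)
    rw [← cj_mul hx.1] at h2
    simpa [hk0] using h2
  · apply hk'
    have h2 := D.Wm _ hl _ (D.VW _ (D.Vtv _ h))
    simpa [hl0] using h2

theorem goodall (D : Dat σ A V W b) {g : ℚ → K} (hg : ∀ r, Gen A W (g r) r) {t : ℚ}
    (h : ∀ a ∈ W, ∀ x ∈ A t, a * x ∈ A t) (r : ℚ) (k : K) :
    cj σ (g r) r k ∈ W ↔ k ∈ W := by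
  by_cases ht : t = 0
  · subst ht
    have hWV : ∀ w ∈ W, w ∈ V := by
      intro w hw
      have := h w hw 1 (by rw [D.A0]; exact D.V1)
      rwa [D.A0, mul_one] at this
    refine (D.good (t := r) ?_ (hg r) k).symm
    intro a ha x hx
    have := D.mul 0 r a x (by rw [D.A0]; exact hWV _ ha) hx
    rwa [zero_add, D.s0] at this
  have hgt := D.goodint hg t (fun k => (D.good h (hg t) k).symm)
  have hnj : ∃ (n : ℕ) (j : ℤ), ((n : ℚ) + 1) * r = j * t := by
    have hd : 0 < r.den * t.num.natAbs :=
      Nat.mul_pos r.den_pos (Int.natAbs_pos.2 (by simpa using ht))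
    refine ⟨r.den * t.num.natAbs - 1, r.num * t.den * t.num.sign, ?_⟩
    have e : (((r.den * t.num.natAbs - 1 : ℕ) : ℚ) + 1) = r.den * t.num.natAbs := by
      exact_mod_cast Nat.sub_add_cancel hd
    rw [e]
    have e1 : (r.den : ℚ) * r = r.num := Rat.den_mul_eq_num r
    have e2 : (t.den : ℚ) * t = t.num := Rat.den_mul_eq_num t
    have e3 : ((t.num.natAbs : ℕ) : ℚ) = t.num.sign * t.num := by
      have := Int.sign_mul_self_eq_natAbs t.num
      rw [← Int.cast_mul, this]; simp
    push_cast
    calc (r.den : ℚ) * (t.num.natAbs : ℚ) * r = (r.den * r) * (t.num.natAbs : ℚ) := by ring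
      _ = r.num * (t.num.sign * t.num) := by rw [e1, e3]
      _ = r.num * (t.num.sign * (t.den * t)) := by rw [e2]
      _ = _ := by ring
  obtain ⟨n, j, hn⟩ := hnj
  have hgn := hgt j
  rw [← hn] at hgn
  rcases D.comparable (hg r) with h1 | h1
  · refine ⟨h1 k, fun hk => ?_⟩
    by_contra hc
    obtain ⟨-, l, hl, hl'⟩ := D.up hg r h1 hk hc n
    exact hl' ((hgn l).2 hl)
  · refine ⟨fun hk => ?_, h1 k⟩
    by_contra hc
    obtain ⟨-, l, hl, hl'⟩ := D.dn hg r h1 hc hk n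
    exact hl ((hgn l).1 hl')

theorem final (D : Dat σ A V W b) {t : ℚ} (h : ∀ a ∈ W, ∀ x ∈ A t, a * x ∈ A t) (r : ℚ) :
    ∃ β : K, aprod W (A r) = W * {β} ∧ W * {β} = {β} * (σ r '' W) := by
  choose g hg using D.allGen h
  have hr := hg r
  have hr0 := hr.1
  refine ⟨g r, ?_, ?_⟩
  · apply Set.Subset.antisymm
    · intro x hx
      simp only [aprod, SetLike.mem_coe] at hx
      simp only [Set.mul_singleton, Set.mem_image]
      induction hx using AddSubgroup.closure_induction with
      | mem x hx =>
        obtain ⟨w, hw, a, ha, rfl⟩ := hx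
        exact ⟨_, D.Wm _ hw _ (hr.2.2 a ha), by simp [mul_assoc, hr0]⟩
      | zero => exact ⟨0, D.W0, by simp⟩
      | add x y _ _ hx hy =>
        obtain ⟨u, hu, rfl⟩ := hx
        obtain ⟨v, hv, rfl⟩ := hy
        exact ⟨u + v, D.Wa _ hu _ hv, by rw [add_mul]⟩
      | neg x _ hx =>
        obtain ⟨u, hu, rfl⟩ := hx
        exact ⟨-u, D.Wn _ hu, by rw [neg_mul]⟩
    · rintro _ ⟨w, hw, _, rfl, rfl⟩
      exact AddSubgroup.subset_closure ⟨w, hw, _, hr.2.1, rfl⟩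
  · ext x
    simp only [Set.mul_singleton, Set.singleton_mul, Set.mem_image]
    constructor
    · rintro ⟨w, hw, rfl⟩
      obtain ⟨k, hk⟩ := D.cj_surj hr0 r w
      refine ⟨σ r k, ⟨k, (D.goodall hg h r k).1 (by rwa [hk]), rfl⟩, ?_⟩
      rw [← hk]; simp [cj, hr0]
    · rintro ⟨_, ⟨k, hk, rfl⟩, rfl⟩
      exact ⟨_, (D.goodall hg h r k).2 hk, by simp [cj, hr0]⟩

end Dat

/-- For a graded extension of Type (e) with `O_l(A_t) = W` for some `t`, for every `r ∈ ℚ`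
there is `β_r ∈ K` with `WA_r = Wβ_r = β_r W^{σ(r)}`. -/
theorem stmt11 (V : Subring K) (hV : IsTVR V) (hVK : (V : Set K) ≠ Set.univ)
    (σ : ℚ → (K ≃+* K)) (hσ : ∀ r s : ℚ, σ (r + s) = (σ r).trans (σ s))
    (A : ℚ → Set K) (hA : IsGradedExtQ (V : Set K) σ A)
    (W : Set K) (hW : W = ⋃ s : ℚ, Ol (A s))
    (hII : ∃ r : ℚ, 0 < r ∧ ¬ HrTypeI σ A r)
    (b : K) (hb : jacS W = {b⁻¹} * W)
    (t : ℚ) (ht : Ol (A t) = W) :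
    ∀ r : ℚ, ∃ β : K, aprod W (A r) = W * {β} ∧ W * {β} = {β} * (σ r '' W) := by
  obtain ⟨hAs, hA0, hAalt, hAmul⟩ := hA
  have hs0 : ∀ x, σ 0 x = x := by
    intro x
    have := congrArg (fun f : K ≃+* K => f x) (hσ 0 0)
    simp only [add_zero, RingEquiv.trans_apply] at this
    exact ((σ 0).injective this).symm
  have hsadd : ∀ r s x, σ (r + s) x = σ r (σ s x) := by
    intro r s x
    rw [add_comm, hσ]; rfl
  have hzero : ∀ r, (0 : K) ∈ A r := fun r => (hAs r trivial).1
  have hneg : ∀ r, ∀ x ∈ A r, -x ∈ A r := fun r x hx => by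
    simpa using (hAs r trivial).2 0 (hzero r) x hx
  have hadd : ∀ r, ∀ x ∈ A r, ∀ y ∈ A r, x + y ∈ A r := fun r x hx y hy => by
    simpa using (hAs r trivial).2 x hx _ (hneg r y hy)
  have hmul : ∀ r s x y, x ∈ A r → y ∈ A s → x * σ r y ∈ A (r + s) := by
    intro r s x y hx hy
    exact hAmul r trivial s trivial
      (AddSubgroup.subset_closure ⟨x, hx, _, ⟨y, hy, rfl⟩, rfl⟩)
  have halt : ∀ r x, x ∉ A r → σ (-r) x⁻¹ ∈ A (-r) := by
    intro r x hx
    have h : x ∈ A r ∪ (σ r '' invS (A (-r))) := by rw [hAalt r trivial]; trivial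
    rcases h with h | ⟨_, ⟨c, hc, -, rfl⟩, rfl⟩
    · exact absurd h hx
    · rw [← map_inv₀, inv_inv, ← hsadd, neg_add_cancel, hs0]; exact hc
  have hVW : ∀ k ∈ (V : Set K), k ∈ W := by
    intro k hk
    rw [← ht]
    intro x hx
    have := hmul 0 t k x (by rwa [hA0]) hx
    rwa [zero_add, hs0] at this
  have hOlW : ∀ a ∈ W, ∀ x ∈ A t, a * x ∈ A t := by
    intro a ha
    rw [← ht] at ha
    exact ha
  have hW0 : (0 : K) ∈ W := hVW _ V.zero_mem
  have hWm : ∀ x ∈ W, ∀ y ∈ W, x * y ∈ W := by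
    intro x hx y hy
    rw [← ht]
    intro z hz
    rw [mul_assoc]
    exact hOlW _ hx _ (hOlW _ hy _ hz)
  have hVtv : ∀ k, k ∉ (V : Set K) → k⁻¹ ∈ (V : Set K) := by
    intro k hk
    rcases hV k (by rintro rfl; exact hk V.zero_mem) with h | h
    · exact absurd h hk
    · exact h
  have hWtv : ∀ k, k ∉ W → k⁻¹ ∈ W := fun k hk =>
    hVW _ (hVtv _ (fun h => hk (hVW _ h)))
  by_cases hb0 : b = 0
  · subst hb0
    have hWu : ∀ x, x ∈ W := by
      intro x
      by_contra hx
      have h1 : x⁻¹ ∈ jacS W := ⟨hWtv _ hx, Or.inr (by simpa using hx)⟩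
      rw [hb] at h1
      obtain ⟨_, rfl, w, -, h⟩ := h1
      have : x = 0 := by simpa using h.symm
      exact hx (this ▸ hW0)
    have hWe : W = Set.univ := Set.eq_univ_of_forall hWu
    intro r
    by_cases hr : ∀ a ∈ A r, a = 0
    · refine ⟨0, ?_, ?_⟩
      · apply Set.Subset.antisymm
        · have : AddSubgroup.closure (W * A r) ≤ ⊥ := by
            rw [AddSubgroup.closure_le]
            rintro _ ⟨w, -, a, ha, rfl⟩
            simp [hr a ha]
          intro x hx
          have := this hx
          rw [AddSubgroup.mem_bot] at this
          exact ⟨0, hW0, 0, rfl, by simp [this]⟩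
        · rintro _ ⟨w, -, _, rfl, rfl⟩
          simp [aprod]
      · ext x
        constructor
        · rintro ⟨w, -, _, rfl, rfl⟩
          exact ⟨0, rfl, _, ⟨0, hW0, rfl⟩, by simp⟩
        · rintro ⟨_, rfl, w, -, rfl⟩
          exact ⟨0, hW0, 0, rfl, by simp⟩
    · push Not at hr
      obtain ⟨a, ha, ha0⟩ := hr
      refine ⟨1, ?_, ?_⟩
      · apply Set.Subset.antisymm
        · intro x _
          exact ⟨x, hWu x, 1, rfl, by simp⟩
        · intro x _
          refine AddSubgroup.subset_closure ⟨x * a⁻¹, hWu _, a, ha, ?_⟩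
          simp [mul_assoc, ha0]
      · ext x
        constructor
        · intro _
          exact ⟨1, rfl, x, ⟨(σ r).symm x, hWu _, by simp⟩, by simp⟩
        · intro _
          exact ⟨x, hWu x, 1, rfl, by simp⟩
  · have hbJ : b⁻¹ ∈ jacS W := by
      rw [hb]
      exact ⟨b⁻¹, rfl, 1, hVW _ V.one_mem, by simp⟩
    have hbW : b ∉ W := by
      rcases hbJ.2 with h | h
      · exact absurd h (inv_ne_zero hb0)
      · simpa using h
    have hJ : ∀ x ∈ W, x⁻¹ ∉ W → b * x ∈ W := by
      intro x hx hx'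
      have h1 : x ∈ jacS W := ⟨hx, Or.inr hx'⟩
      rw [hb] at h1
      obtain ⟨_, rfl, w, hw, rfl⟩ := h1
      simpa [hb0] using hw
    have hbc : ∀ w ∈ W, b * w * b⁻¹ ∈ W := by
      intro w hw
      by_cases hw0 : w = 0
      · subst hw0; simpa using hW0
      rw [mul_assoc]
      refine hJ _ (hWm _ hw _ hbJ.1) ?_
      intro h
      apply hbW
      have := hWm _ h _ hw
      simpa [mul_assoc, hw0] using this
    have hbc' : ∀ w ∈ W, b⁻¹ * w * b ∈ W := by
      intro w hw
      by_contra hc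
      have h1 := hJ _ (hWtv _ hc) (by simpa using hc)
      have hw0 : w ≠ 0 := by
        rintro rfl
        exact hc (by simpa using hW0)
      apply hbW
      have h2 := hWm _ hw _ h1
      simpa [mul_assoc, hb0, hw0] using h2
    have D : Dat σ A (V : Set K) W b :=
      { s0 := hs0, sadd := hsadd, A0 := hA0, zero := hzero, mul := hmul, alt := halt,
        Vtv := hVtv, VW := hVW, V1 := V.one_mem, W0 := hW0, Wm := hWm,
        Wa := by
          intro x hx y hy
          rw [← ht]
          intro z hz
          rw [add_mul]
          exact hadd _ _ (hOlW _ hx _ hz) _ (hOlW _ hy _ hz)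
        Wn := by
          intro x hx
          rw [← ht]
          intro z hz
          rw [neg_mul]
          exact hneg _ _ (hOlW _ hx _ hz)
        Wtv := hWtv
        Ol := by
          intro s a h
          rw [hW]
          exact Set.mem_iUnion.2 ⟨s, h⟩
        b0 := hb0, bW := hbW, bJ := hJ, bc := hbc, bc' := hbc' }
    exact D.final hOlW
end
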